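/- Let K = H1 ∩ H, where H1 is a height-2 prime ideal with e(R/H1) = 2 and H is an ideal with e(R/H) = 2 that is primary to a linear prime (x, y) of height 2. If either K = I^un or K = L, then pd(R/I) ≤ 5. -/

import Mathlib

open MvPolynomial Filter CategoryTheory

noncomputable section

/-- The height of an ideal `J`: the infimum of the heights of the prime ideals containing it. -/
def idealHeight {R : Type} [CommRing R] (J : Ideal R) : ℕ∞ :=
  ⨅ p ∈ {p : {q : Ideal R // q.IsPrime} | J ≤ p.1}, Order.height p

/-- `pdQuotLE J n` holds iff `R ⧸ J` admits a projective resolution of length at most `n`,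
i.e. the projective dimension of `R ⧸ J` as an `R`-module is at most `n`. -/
def pdQuotLE {R : Type} [CommRing R] (J : Ideal R) (n : ℕ) : Prop :=
  ∃ P : ProjectiveResolution (ModuleCat.of R (R ⧸ J)),
    ∀ i, n < i → Limits.IsZero (P.complex.X i)

/-- The `p`-primary component of `J` for `p` a minimal prime of `J`:
the saturation of `J` at `p`. -/
def primaryComponent {R : Type} [CommRing R] (J p : Ideal R) : Ideal R :=
  ⨆ (s : R) (_ : s ∉ p), Submodule.colon J (Ideal.span {s})

/-- The unmixed part `J^un` of `J`: the intersection of the primary components of `J`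
corresponding to the minimal primes of `J` of minimal height. -/
def unmixedPart {R : Type} [CommRing R] (J : Ideal R) : Ideal R :=
  ⨅ p ∈ {p : Ideal R | p.IsPrime ∧ J ≤ p ∧ idealHeight p = idealHeight J},
    primaryComponent J p

/-- A linear prime: a prime ideal generated by forms of degree one. -/
def IsLinearPrime {k : Type} [CommSemiring k] {N : ℕ} (p : Ideal (MvPolynomial (Fin N) k)) : Prop :=
  p.IsPrime ∧ ∃ S : Set (MvPolynomial (Fin N) k), (∀ ℓ ∈ S, ℓ.IsHomogeneous 1) ∧ p = Ideal.span S

/-- A homogeneous ideal: an ideal generated by homogeneous elements. -/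
def IsHomogeneousIdeal {k : Type} [CommSemiring k] {N : ℕ}
    (J : Ideal (MvPolynomial (Fin N) k)) : Prop :=
  ∃ S : Set (MvPolynomial (Fin N) k), (∀ g ∈ S, ∃ d, g.IsHomogeneous d) ∧ J = Ideal.span S

/-- `[B]_n`: the ideal generated by all forms of degree `n` belonging to `B`. -/
def degreePart {k : Type} [CommSemiring k] {N : ℕ} (B : Ideal (MvPolynomial (Fin N) k)) (n : ℕ) :
    Ideal (MvPolynomial (Fin N) k) :=
  Ideal.span {f | f ∈ B ∧ f.IsHomogeneous n}

/-- The Hilbert–Samuel function of `R/J` with respect to the irrelevant maximal ideal: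
`n ↦ length (R / (J + 𝔪^n)) = dim_k (R / (J + 𝔪^n))`. -/
def hilbertSamuelFn {k : Type} [Field k] {N : ℕ} (J : Ideal (MvPolynomial (Fin N) k))
    (n : ℕ) : ℕ :=
  Module.finrank k
    (MvPolynomial (Fin N) k ⧸
      (J ⊔ (Ideal.span (Set.range (MvPolynomial.X : Fin N → MvPolynomial (Fin N) k))) ^ n))

/-- `HasMultiplicity J d e`: the quotient `R/J` has Krull dimension `d` and Hilbert–Samuel
multiplicity `e`, expressed through the asymptotics `d! · HS_J(n) / n^d → e` of the
Hilbert–Samuel function. -/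
def HasMultiplicity {k : Type} [Field k] {N : ℕ} (J : Ideal (MvPolynomial (Fin N) k))
    (d e : ℕ) : Prop :=
  Tendsto (fun n : ℕ => (Nat.factorial d : ℝ) * (hilbertSamuelFn J n : ℝ) / (n : ℝ) ^ d)
    atTop (nhds (e : ℝ))

/-- An ideal of `R` is extended from a subalgebra `A` if it is generated by elements of `A`. -/
def extendedFrom {k R : Type} [CommRing k] [CommRing R] [Algebra k R]
    (K : Ideal R) (A : Subalgebra k R) : Prop :=
  ∃ S : Set R, S ⊆ (A : Set R) ∧ K = Ideal.span S

section homological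

variable {R : Type} [CommRing R]

/-- projective dimension at most `n`, unbundled. -/
def PDLE (R : Type) [CommRing R] (M : Type) [AddCommGroup M] [Module R M] (n : ℕ) : Prop :=
  HasProjectiveDimensionLE (ModuleCat.of R M) n

abbrev ExtM (R : Type) [CommRing R] (M N : Type) [AddCommGroup M] [Module R M]
    [AddCommGroup N] [Module R N] (n : ℕ) : Type :=
  Abelian.Ext (ModuleCat.of R M) (ModuleCat.of R N) n

variable {A B C D : Type} [AddCommGroup A] [Module R A] [AddCommGroup B] [Module R B]
  [AddCommGroup C] [Module R C] [AddCommGroup D] [Module R D]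

/-- a short exact sequence of modules -/
structure SES (f : A →ₗ[R] B) (g : B →ₗ[R] C) : Prop where
  inj : Function.Injective f
  surj : Function.Surjective g
  exact : Function.Exact f g

def SES.sc {f : A →ₗ[R] B} {g : B →ₗ[R] C} (h : SES f g) : ShortComplex (ModuleCat R) :=
  ShortComplex.mk (ModuleCat.ofHom f) (ModuleCat.ofHom g) (by
    ext x; exact h.exact.apply_apply_eq_zero x)

lemma SES.shortExact {f : A →ₗ[R] B} {g : B →ₗ[R] C} (h : SES f g) : h.sc.ShortExact where
  exact := by
    rw [ShortComplex.moduleCat_exact_iff]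
    intro x hx
    exact (h.exact x).1 hx
  mono_f := (ModuleCat.mono_iff_injective _).2 h.inj
  epi_g := (ModuleCat.epi_iff_surjective _).2 h.surj

lemma PDLE.mono {n m : ℕ} (h : PDLE R A n) (hnm : n ≤ m) : PDLE R A m := by
  haveI : HasProjectiveDimensionLT (ModuleCat.of R A) (n + 1) := h
  exact hasProjectiveDimensionLT_of_ge (ModuleCat.of R A) (n + 1) (m + 1) (by omega)

lemma PDLE.of_equiv {n : ℕ} (h : PDLE R A n) (e : A ≃ₗ[R] B) : PDLE R B n := by
  haveI : HasProjectiveDimensionLT (ModuleCat.of R A) (n + 1) := h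
  exact hasProjectiveDimensionLT_of_iso (e.toModuleIso) (n + 1)

lemma SES.pd2 {f : A →ₗ[R] B} {g : B →ₗ[R] C} (h : SES f g) {n : ℕ}
    (h1 : PDLE R A n) (h3 : PDLE R C n) : PDLE R B n :=
  h.shortExact.hasProjectiveDimensionLT_X₂ (n + 1) h1 h3

lemma SES.pd3 {f : A →ₗ[R] B} {g : B →ₗ[R] C} (h : SES f g) {n : ℕ}
    (h1 : PDLE R A n) (h2 : PDLE R B (n + 1)) : PDLE R C (n + 1) :=
  h.shortExact.hasProjectiveDimensionLT_X₃ (n + 1) h1 h2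

lemma SES.pd1 {f : A →ₗ[R] B} {g : B →ₗ[R] C} (h : SES f g) {n : ℕ}
    (h2 : PDLE R B n) (h3 : PDLE R C (n + 1)) : PDLE R A n :=
  h.shortExact.hasProjectiveDimensionLT_X₁ (n + 1) h2 h3

lemma PDLE.of_subsingleton [Subsingleton A] (n : ℕ) : PDLE R A n := by
  have : Limits.IsZero (ModuleCat.of R A) := ModuleCat.isZero_of_subsingleton _
  haveI := this.hasProjectiveDimensionLT_zero
  exact hasProjectiveDimensionLT_of_ge _ 0 (n + 1) (by omega)

lemma PDLE.of_projective [Module.Projective R A] (n : ℕ) : PDLE R A n := by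
  have : Projective (ModuleCat.of R A) := inferInstance
  have h : PDLE R A 0 := (projective_iff_hasProjectiveDimensionLE_zero _).1 this
  exact h.mono (Nat.zero_le n)

lemma PDLE.prod {n : ℕ} (h1 : PDLE R A n) (h2 : PDLE R B n) : PDLE R (A × B) n := by
  have : SES (LinearMap.inl R A B) (LinearMap.snd R A B) :=
    ⟨LinearMap.inl_injective, LinearMap.snd_surjective, Function.Exact.inl_snd⟩
  exact this.pd2 h1 h2

/-- precomposition -/
def epre (f : A →ₗ[R] B) (N : Type) [AddCommGroup N] [Module R N] (n : ℕ) :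
    ExtM R B N n →ₗ[R] ExtM R A N n :=
  (Abelian.Ext.mk₀ (ModuleCat.ofHom f)).precompOfLinear R (ModuleCat.of R N) (zero_add n)

def SES.δ {f : A →ₗ[R] B} {g : B →ₗ[R] C} (h : SES f g) (N : Type) [AddCommGroup N]
    [Module R N] (n : ℕ) : ExtM R A N n →ₗ[R] ExtM R C N (n + 1) :=
  h.shortExact.extClass.precompOfLinear R (ModuleCat.of R N) (add_comm 1 n)

variable {N : Type} [AddCommGroup N] [Module R N]

lemma epre_comp (f : A →ₗ[R] B) (g : B →ₗ[R] C) (n : ℕ) (z : ExtM R C N n) :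
    epre f N n (epre g N n z) = epre (g ∘ₗ f) N n z := by
  simp only [epre, ModuleCat.ofHom_comp]
  simp only [Abelian.Ext.precompOfLinear, Abelian.Ext.bilinearCompOfLinear_apply_apply]
  rw [Abelian.Ext.mk₀_comp_mk₀_assoc]

lemma epre_id (n : ℕ) (z : ExtM R A N n) :
    epre (LinearMap.id) N n z = z := by
  simp only [epre, ModuleCat.ofHom_id]
  simp only [Abelian.Ext.precompOfLinear, Abelian.Ext.bilinearCompOfLinear_apply_apply]
  rw [Abelian.Ext.mk₀_id_comp]

lemma SES.ex2 {f : A →ₗ[R] B} {g : B →ₗ[R] C} (h : SES f g) (n : ℕ) :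
    Function.Exact (epre g N n) (epre f N n) := by
  intro z
  constructor
  · intro hz
    obtain ⟨w, hw⟩ := Abelian.Ext.contravariant_sequence_exact₂ h.shortExact _ z hz
    exact ⟨w, hw⟩
  · rintro ⟨w, rfl⟩
    rw [epre_comp]
    have : g ∘ₗ f = 0 := by ext x; exact h.exact.apply_apply_eq_zero x
    rw [this]
    simp [epre]

lemma SES.ex1 {f : A →ₗ[R] B} {g : B →ₗ[R] C} (h : SES f g) (n : ℕ) :
    Function.Exact (epre f N n) (h.δ N n) := by
  intro z
  constructor
  · intro hz
    obtain ⟨w, hw⟩ := Abelian.Ext.contravariant_sequence_exact₁ h.shortExact _ z (add_comm 1 n) hz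
    exact ⟨w, hw⟩
  · rintro ⟨w, rfl⟩
    exact h.shortExact.extClass_comp_assoc w (h := add_comm 1 n)

lemma SES.ex3 {f : A →ₗ[R] B} {g : B →ₗ[R] C} (h : SES f g) (n : ℕ) :
    Function.Exact (h.δ N n) (epre g N (n + 1)) := by
  intro z
  constructor
  · intro hz
    obtain ⟨w, hw⟩ := Abelian.Ext.contravariant_sequence_exact₃ h.shortExact _ z hz (add_comm 1 n)
    exact ⟨w, hw⟩
  · rintro ⟨w, rfl⟩
    exact h.shortExact.comp_extClass_assoc w (add_comm 1 n)

lemma SES.inj0 {f : A →ₗ[R] B} {g : B →ₗ[R] C} (h : SES f g) :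
    Function.Injective (epre g N 0) := by
  have := h.shortExact.epi_g
  exact Abelian.Ext.precomp_mk₀_injective_of_epi (ModuleCat.of R N) (h.sc.g)

lemma ext_subsingleton_of_pd {n m : ℕ} (h : PDLE R A n) (hnm : n < m) :
    Subsingleton (ExtM R A N m) := by
  haveI : HasProjectiveDimensionLT (ModuleCat.of R A) (n + 1) := h
  exact HasProjectiveDimensionLT.subsingleton (ModuleCat.of R A) (n + 1) m (by omega) _

/-- postcomposition -/
def epost (M : Type) [AddCommGroup M] [Module R M] (f : A →ₗ[R] B) (n : ℕ) :
    ExtM R M A n →ₗ[R] ExtM R M B n :=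
  (Abelian.Ext.mk₀ (ModuleCat.ofHom f)).postcompOfLinear R (ModuleCat.of R M) (add_zero n)

def SES.δ' {f : A →ₗ[R] B} {g : B →ₗ[R] C} (h : SES f g) (M : Type) [AddCommGroup M]
    [Module R M] (n : ℕ) : ExtM R M C n →ₗ[R] ExtM R M A (n + 1) :=
  h.shortExact.extClass.postcompOfLinear R (ModuleCat.of R M) rfl

variable {M : Type} [AddCommGroup M] [Module R M]

lemma SES.cex2 {f : A →ₗ[R] B} {g : B →ₗ[R] C} (h : SES f g) (n : ℕ)
    (z : ExtM R M B n) (hz : epost M g n z = 0) : ∃ w, epost M f n w = z :=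
  Abelian.Ext.covariant_sequence_exact₂ _ h.shortExact z hz

lemma SES.cex3 {f : A →ₗ[R] B} {g : B →ₗ[R] C} (h : SES f g) (n : ℕ)
    (z : ExtM R M C n) (hz : h.δ' M n z = 0) : ∃ w, epost M g n w = z :=
  Abelian.Ext.covariant_sequence_exact₃ _ h.shortExact z rfl hz

lemma SES.cex1 {f : A →ₗ[R] B} {g : B →ₗ[R] C} (h : SES f g) (n : ℕ)
    (z : ExtM R M A (n+1)) (hz : epost M f (n+1) z = 0) : ∃ w, h.δ' M n w = z :=
  Abelian.Ext.covariant_sequence_exact₁ _ h.shortExact z hz rfl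

lemma SES.cinj0 {f : A →ₗ[R] B} {g : B →ₗ[R] C} (h : SES f g) :
    Function.Injective (epost M f 0) := by
  have := h.shortExact.mono_f
  exact Abelian.Ext.postcomp_mk₀_injective_of_mono (ModuleCat.of R M) (h.sc.f)

/-- scalar action on Ext through the first variable -/
lemma ext_smul_eq_zero (r : R) (hM : ∀ m : M, r • m = 0) (n : ℕ) (z : ExtM R M N n) :
    r • z = 0 := by
  have h1 : (r • Abelian.Ext.mk₀ (𝟙 (ModuleCat.of R M))).comp z (zero_add n) = r • z := by
    rw [Abelian.Ext.smul_comp, Abelian.Ext.mk₀_id_comp]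
  rw [← h1, ← Abelian.Ext.mk₀_smul]
  have : r • 𝟙 (ModuleCat.of R M) = 0 := by
    ext m
    simpa using hM m
  rw [this]; simp

lemma epost_smul (r : R) (n : ℕ) (z : ExtM R M N n) :
    epost M (LinearMap.lsmul R N r) n z = r • z := by
  rw [Abelian.Ext.smul_eq_comp_mk₀]
  rfl

/-- shifting -/
lemma ext_shift (r : R) (hM : ∀ m : M, r • m = 0) (g : A →ₗ[R] B)
    (h : SES (LinearMap.lsmul R A r) g) (n : ℕ) (hs : Subsingleton (ExtM R M A n)) :
    Nonempty (ExtM R M B n ≃ₗ[R] ExtM R M A (n + 1)) := by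
  refine ⟨LinearEquiv.ofBijective (h.δ' M n) ⟨?_, ?_⟩⟩
  · rw [← LinearMap.ker_eq_bot, LinearMap.ker_eq_bot']
    intro z hz
    obtain ⟨w, rfl⟩ := h.cex3 n z hz
    rw [Subsingleton.elim w 0, map_zero]
  · intro z
    exact h.cex1 n z (by rw [epost_smul, ext_smul_eq_zero r hM])

lemma ext_zero_vanish (r : R) (hM : ∀ m : M, r • m = 0) (hN : ∀ a : A, r • a = 0 → a = 0) :
    Subsingleton (ExtM R M A 0) := by
  have : Subsingleton (ModuleCat.of R M ⟶ ModuleCat.of R A) := by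
    refine ⟨fun f g => ?_⟩
    ext m
    have key : ∀ f : (ModuleCat.of R M ⟶ ModuleCat.of R A), f m = 0 := by
      intro f
      apply hN
      have : f (r • m) = r • f m := map_smul f.hom r m
      rw [← this, hM, map_zero]
    change f m = g m
    rw [key f, key g]
  exact (Abelian.Ext.homEquiv₀ (X := ModuleCat.of R M) (Y := ModuleCat.of R A)).subsingleton

/-- All `Ext^i(M,N)` vanish for `i < n`. -/
def GradeGE (R : Type) [CommRing R] (M N : Type) [AddCommGroup M] [Module R M]
    [AddCommGroup N] [Module R N] (n : ℕ) : Prop := ∀ i < n, Subsingleton (ExtM R M N i)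

lemma GradeGE.step {n : ℕ} (r : R) (hM : ∀ m : M, r • m = 0) (g : A →ₗ[R] B)
    (h : SES (LinearMap.lsmul R A r) g) (hB : GradeGE R M B n) : GradeGE R M A (n + 1) := by
  intro i
  induction i with
  | zero =>
    intro _
    apply ext_zero_vanish r hM
    intro a ha
    exact h.inj (by simpa using ha)
  | succ i ih =>
    intro hi
    obtain ⟨e⟩ := ext_shift r hM g h i (ih (by omega))
    have := hB i (by omega)
    exact e.symm.toEquiv.subsingleton

end homological

section tools

variable {R : Type} [CommRing R]

lemma mem_addI {J : Ideal R} {r z : R} : z ∈ J ⊔ Ideal.span {r} ↔ ∃ s, z - s * r ∈ J := by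
  rw [Submodule.mem_sup]
  constructor
  · rintro ⟨a, ha, b, hb, rfl⟩
    obtain ⟨s, rfl⟩ := Ideal.mem_span_singleton'.1 hb
    exact ⟨s, by simpa using ha⟩
  · rintro ⟨s, hs⟩
    exact ⟨_, hs, s * r, Ideal.mem_span_singleton'.2 ⟨s, rfl⟩, by ring⟩

/-- `r` is regular modulo `J`. -/
def RegM (J : Ideal R) (r : R) : Prop := ∀ a, r * a ∈ J → a ∈ J

def RS : Ideal R → List R → Prop
  | _, [] => True
  | J, r :: rs => RegM J r ∧ RS (J ⊔ Ideal.span {r}) rs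

def addL : Ideal R → List R → Ideal R
  | J, [] => J
  | J, r :: rs => addL (J ⊔ Ideal.span {r}) rs

lemma RegM.of_prime {J : Ideal R} (h : J.IsPrime) {r : R} (hr : r ∉ J) : RegM J r := by
  intro a ha
  exact (h.mem_or_mem ha).resolve_left hr

lemma ses_ker {A B : Type} [AddCommGroup A] [Module R A] [AddCommGroup B] [Module R B]
    (g : A →ₗ[R] B) (hg : Function.Surjective g) : SES (LinearMap.ker g).subtype g :=
  ⟨Subtype.val_injective, hg, LinearMap.exact_subtype_ker_map g⟩

lemma ses_range {A B : Type} [AddCommGroup A] [Module R A] [AddCommGroup B] [Module R B]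
    (g : A →ₗ[R] B) : SES (LinearMap.ker g).subtype g.rangeRestrict := by
  refine ⟨Subtype.val_injective, g.surjective_rangeRestrict, ?_⟩
  intro z
  constructor
  · intro hz
    exact ⟨⟨z, by simpa [Subtype.ext_iff] using hz⟩, rfl⟩
  · rintro ⟨w, rfl⟩
    ext
    exact w.2

/-- the map `R/J' → R/J`, multiplication by `r`. -/
def mulQ (J' J : Ideal R) (r : R) (h : ∀ a ∈ J', r * a ∈ J) : (R ⧸ J') →ₗ[R] (R ⧸ J) :=
  Submodule.mapQ J' J (LinearMap.lsmul R R r) (fun a ha => h a ha)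

lemma ses_colon (J' J J'' : Ideal R) (r : R) (h : ∀ a, a ∈ J' ↔ r * a ∈ J)
    (h2 : ∀ a, a ∈ J'' ↔ ∃ s, a - s * r ∈ J) :
    ∃ (f : (R ⧸ J') →ₗ[R] (R ⧸ J)) (g : (R ⧸ J) →ₗ[R] (R ⧸ J'')), SES f g := by
  have hle : J ≤ J'' := fun a ha => (h2 a).2 ⟨0, by simpa using ha⟩
  refine ⟨mulQ J' J r (fun a => (h a).1), Submodule.factor hle, ?_, ?_, ?_⟩
  · rw [← LinearMap.ker_eq_bot, LinearMap.ker_eq_bot']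
    intro z
    obtain ⟨a, rfl⟩ := Submodule.mkQ_surjective J' z
    intro hz
    have : r * a ∈ J := (Submodule.Quotient.mk_eq_zero J).1 hz
    exact (Submodule.Quotient.mk_eq_zero J').2 ((h a).2 this)
  · intro z
    obtain ⟨a, rfl⟩ := Submodule.mkQ_surjective J'' z
    exact ⟨Submodule.mkQ J a, rfl⟩
  · intro z
    obtain ⟨a, rfl⟩ := Submodule.mkQ_surjective J z
    constructor
    · intro hz
      have : a ∈ J'' := (Submodule.Quotient.mk_eq_zero J'').1 hz
      obtain ⟨s, hs⟩ := (h2 a).1 this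
      refine ⟨Submodule.mkQ J' s, ?_⟩
      refine (Submodule.Quotient.eq J).2 ?_
      rw [← neg_mem_iff]
      simpa [mul_comm] using hs
    · rintro ⟨w, hw⟩
      obtain ⟨s, rfl⟩ := Submodule.mkQ_surjective J' w
      rw [← hw]
      refine (Submodule.Quotient.mk_eq_zero J'').2 ((h2 _).2 ⟨s, ?_⟩)
      simp [mul_comm]

lemma ses_lsmul (J : Ideal R) (r : R) (h : RegM J r) :
    ∃ g : (R ⧸ J) →ₗ[R] (R ⧸ (J ⊔ Ideal.span {r})), SES (LinearMap.lsmul R (R ⧸ J) r) g := by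
  have hle : J ≤ J ⊔ Ideal.span {r} := le_sup_left
  refine ⟨Submodule.factor hle, ?_, ?_, ?_⟩
  · rw [← LinearMap.ker_eq_bot, LinearMap.ker_eq_bot']
    intro z
    obtain ⟨a, rfl⟩ := Submodule.mkQ_surjective J z
    intro hz
    have : r * a ∈ J := (Submodule.Quotient.mk_eq_zero J).1 hz
    exact (Submodule.Quotient.mk_eq_zero J).2 (h a this)
  · intro z
    obtain ⟨a, rfl⟩ := Submodule.mkQ_surjective _ z
    exact ⟨Submodule.mkQ J a, rfl⟩
  · intro z
    obtain ⟨a, rfl⟩ := Submodule.mkQ_surjective J z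
    constructor
    · intro hz
      have : a ∈ J ⊔ Ideal.span {r} := (Submodule.Quotient.mk_eq_zero _).1 hz
      obtain ⟨s, hs⟩ := mem_addI.1 this
      refine ⟨Submodule.mkQ J s, ?_⟩
      refine (Submodule.Quotient.eq J).2 ?_
      rw [← neg_mem_iff]
      simpa [mul_comm] using hs
    · rintro ⟨w, hw⟩
      obtain ⟨s, rfl⟩ := Submodule.mkQ_surjective J w
      rw [← hw]
      refine (Submodule.Quotient.mk_eq_zero _).2 (mem_addI.2 ⟨s, ?_⟩)
      simp [mul_comm]

lemma pd_add {J : Ideal R} {r : R} (h : RegM J r) {n : ℕ} (hJ : PDLE R (R ⧸ J) n) :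
    PDLE R (R ⧸ (J ⊔ Ideal.span {r})) (n + 1) := by
  obtain ⟨g, hg⟩ := ses_lsmul J r h
  exact hg.pd3 hJ (hJ.mono (by omega))

lemma pd_RS {J : Ideal R} {rs : List R} (h : RS J rs) {n : ℕ} (hJ : PDLE R (R ⧸ J) n) :
    PDLE R (R ⧸ addL J rs) (n + rs.length) := by
  induction rs generalizing J n with
  | nil => exact hJ
  | cons r rs ih =>
    have := ih h.2 (pd_add h.1 hJ)
    refine this.mono ?_
    simp; omega

lemma pd_bot (n : ℕ) : PDLE R (R ⧸ (⊥ : Ideal R)) n :=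
  (PDLE.of_projective (R := R) (A := R) n).of_equiv (Submodule.quotEquivOfEqBot ⊥ rfl).symm

lemma pd_top (J : Ideal R) (h : J = ⊤) (n : ℕ) : PDLE R (R ⧸ J) n := by
  subst h
  have : Subsingleton (R ⧸ (⊤ : Ideal R)) := Ideal.Quotient.subsingleton_iff.2 rfl
  exact PDLE.of_subsingleton n

lemma pd_RS' {J : Ideal R} (rs : List R) (h : RS ⊥ rs) (hJ : addL ⊥ rs = J) :
    PDLE R (R ⧸ J) rs.length := by
  subst hJ
  simpa using pd_RS h (pd_bot 0)

section
variable {M : Type} [AddCommGroup M] [Module R M]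

lemma grade_RS {J : Ideal R} {rs : List R} (h : RS J rs) (hM : ∀ r ∈ rs, ∀ m : M, r • m = 0) :
    GradeGE R M (R ⧸ J) rs.length := by
  induction rs generalizing J with
  | nil => intro i hi; simp at hi
  | cons r rs ih =>
    obtain ⟨g, hg⟩ := ses_lsmul J r h.1
    exact GradeGE.step r (hM r (by simp)) g hg (ih h.2 (fun s hs => hM s (by simp [hs])))

lemma ext_RS {J : Ideal R} {rs : List R} (h : RS J rs) (hM : ∀ r ∈ rs, ∀ m : M, r • m = 0) :
    Nonempty (ExtM R M (R ⧸ addL J rs) 0 ≃ₗ[R] ExtM R M (R ⧸ J) rs.length) := by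
  induction rs generalizing J with
  | nil => exact ⟨LinearEquiv.refl _ _⟩
  | cons r rs ih =>
    obtain ⟨g, hg⟩ := ses_lsmul J r h.1
    obtain ⟨e⟩ := ih h.2 (fun s hs => hM s (by simp [hs]))
    have hgr := grade_RS h hM
    obtain ⟨e'⟩ := ext_shift r (hM r (by simp)) g hg rs.length (hgr _ (by simp))
    exact ⟨e.trans e'⟩

end

/-- evaluation at `1` on `Ext^0(R/J', N)` -/
lemma ext0_inj (J' : Ideal R) (N : Type) [AddCommGroup N] [Module R N] :
    ∃ f : ExtM R (R ⧸ J') N 0 →ₗ[R] N, Function.Injective f ∧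
      ∀ n : N, (∀ a ∈ J', a • n = 0) → ∃ z, f z = n := by
  let e : ExtM R (R ⧸ J') N 0 ≃ₗ[R] (ModuleCat.of R (R ⧸ J') ⟶ ModuleCat.of R N) :=
    Abelian.Ext.linearEquiv₀
  let e2 : (ModuleCat.of R (R ⧸ J') ⟶ ModuleCat.of R N) ≃ₗ[R] ((R ⧸ J') →ₗ[R] N) :=
    ModuleCat.homLinearEquiv
  let e3 : ((R ⧸ J') →ₗ[R] N) →ₗ[R] N := LinearMap.applyₗ (Submodule.mkQ J' 1)
  refine ⟨e3 ∘ₗ (e.trans e2).toLinearMap, ?_, ?_⟩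
  · have : Function.Injective e3 := by
      intro f g hfg
      apply Submodule.linearMap_qext
      ext
      exact hfg
    exact this.comp (e.trans e2).injective
  · intro n hn
    let φ : (R ⧸ J') →ₗ[R] N := Submodule.liftQ J' (LinearMap.toSpanSingleton R N n)
      (fun a ha => hn a ha)
    obtain ⟨z, hz⟩ := (e.trans e2).surjective φ
    refine ⟨z, ?_⟩
    change e3 ((e.trans e2) z) = n
    rw [hz]
    change φ (Submodule.mkQ J' 1) = n
    exact one_smul R n

/-- canonical coefficient module -/
abbrev EE (R : Type) [CommRing R] (M : Type) [AddCommGroup M] [Module R M] (n : ℕ) : Type :=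
  ExtM R M (R ⧸ (⊥ : Ideal R)) n

lemma smul_quot_zero {J' : Ideal R} {r : R} (h : r ∈ J') (m : R ⧸ J') : r • m = 0 := by
  obtain ⟨a, rfl⟩ := Submodule.mkQ_surjective J' m
  exact (Submodule.Quotient.mk_eq_zero J').2 (J'.mul_mem_right a h)

lemma ee_ci {J : Ideal R} (rs : List R) (h : RS ⊥ rs) (hJ : addL ⊥ rs = J) (hm : ∀ r ∈ rs, r ∈ J) :
    Nonempty (EE R (R ⧸ J) rs.length ≃ₗ[R] (R ⧸ J)) := by
  obtain ⟨e⟩ := ext_RS (M := R ⧸ J) h (fun r hr m => smul_quot_zero (hm r hr) m)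
  rw [hJ] at e
  obtain ⟨f, hf, hs⟩ := ext0_inj J (R ⧸ J)
  refine ⟨e.symm.trans (LinearEquiv.ofBijective f ⟨hf, fun n => hs n ?_⟩)⟩
  intro a ha
  exact smul_quot_zero ha n

lemma ee_inj {J J' : Ideal R} (rs : List R) (h : RS ⊥ rs) (hJ : addL ⊥ rs = J)
    (hm : ∀ r ∈ rs, r ∈ J') :
    ∃ f : EE R (R ⧸ J') rs.length →ₗ[R] (R ⧸ J), Function.Injective f := by
  obtain ⟨e⟩ := ext_RS (M := R ⧸ J') h (fun r hr m => smul_quot_zero (hm r hr) m)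
  rw [hJ] at e
  obtain ⟨f, hf, hs⟩ := ext0_inj J' (R ⧸ J)
  exact ⟨f ∘ₗ e.symm.toLinearMap, hf.comp e.symm.injective⟩

/-- exactness bookkeeping -/
lemma SES.ee_inj {A B C N : Type} [AddCommGroup A] [Module R A] [AddCommGroup B] [Module R B]
    [AddCommGroup C] [Module R C] [AddCommGroup N] [Module R N]
    {f : A →ₗ[R] B} {g : B →ₗ[R] C} (h : SES f g) (n : ℕ)
    (hA : Subsingleton (ExtM R A N n)) : Function.Injective (epre g N (n + 1)) := by
  rw [← LinearMap.ker_eq_bot, LinearMap.ker_eq_bot']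
  intro z hz
  obtain ⟨w, rfl⟩ := (h.ex3 n z).1 hz
  rw [Subsingleton.elim w 0, map_zero]

lemma SES.ee_surj {A B C N : Type} [AddCommGroup A] [Module R A] [AddCommGroup B] [Module R B]
    [AddCommGroup C] [Module R C] [AddCommGroup N] [Module R N]
    {f : A →ₗ[R] B} {g : B →ₗ[R] C} (h : SES f g) (n : ℕ)
    (hC : Subsingleton (ExtM R C N (n + 1))) : Function.Surjective (epre f N n) := by
  intro z
  exact (h.ex1 n z).1 (Subsingleton.elim _ _)

lemma SES.sub_mid {A B C N : Type} [AddCommGroup A] [Module R A] [AddCommGroup B] [Module R B]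
    [AddCommGroup C] [Module R C] [AddCommGroup N] [Module R N]
    {f : A →ₗ[R] B} {g : B →ₗ[R] C} (h : SES f g) (n : ℕ)
    (hA : Subsingleton (ExtM R A N n)) (hC : Subsingleton (ExtM R C N n)) :
    Subsingleton (ExtM R B N n) := by
  refine subsingleton_of_forall_eq 0 fun z => ?_
  obtain ⟨w, rfl⟩ := (h.ex2 n z).1 (Subsingleton.elim _ _)
  rw [Subsingleton.elim w 0, map_zero]

lemma omega_pd {X Y W U : Type} [AddCommGroup X] [Module R X] [AddCommGroup Y] [Module R Y]
    [AddCommGroup W] [Module R W] [AddCommGroup U] [Module R U]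
    (f : X →ₗ[R] Y) (g : Y →ₗ[R] W) (ψ : W →ₗ[R] U) (hf : Function.Injective f)
    (hfg : Function.Exact f g) (hgψ : Function.Exact g ψ) {n : ℕ}
    (hX : PDLE R X n) (hW : PDLE R W n) (hr : PDLE R (LinearMap.range ψ) (n + 1)) :
    PDLE R Y n := by
  have h1 := (ses_range ψ).pd1 hW hr
  have h2 := ses_range g
  have : LinearMap.range g = LinearMap.ker ψ := (LinearMap.exact_iff.1 hgψ).symm
  rw [← this] at h1
  refine h2.pd2 ?_ h1
  have h3 : LinearMap.ker g = LinearMap.range f := LinearMap.exact_iff.1 hfg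
  rw [h3]
  exact hX.of_equiv (LinearEquiv.ofInjective f hf)

/-- isomorphism invariance in the first variable -/
lemma epre_bij {A B N : Type} [AddCommGroup A] [Module R A] [AddCommGroup B] [Module R B]
    [AddCommGroup N] [Module R N] (e : A ≃ₗ[R] B) (n : ℕ) :
    Nonempty (ExtM R B N n ≃ₗ[R] ExtM R A N n) := by
  refine ⟨LinearEquiv.ofLinearMap (epre e.toLinearMap N n) (epre e.symm.toLinearMap N n) ?_ ?_⟩
  · ext z
    simp only [LinearMap.comp_apply]
    rw [epre_comp]
    have : e.symm.toLinearMap ∘ₗ e.toLinearMap = LinearMap.id := by ext; simp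
    rw [this, epre_id]; rfl
  · ext z
    simp only [LinearMap.comp_apply]
    rw [epre_comp]
    have : e.toLinearMap ∘ₗ e.symm.toLinearMap = LinearMap.id := by ext; simp
    rw [this, epre_id]; rfl

/-- two-generated modules with the same relations -/
lemma two_gen_iso {Z T : Type} [AddCommGroup Z] [Module R Z] [AddCommGroup T] [Module R T]
    (z1 z2 : Z) (t1 t2 : T) (hz : ∀ z : Z, ∃ α β : R, z = α • z1 + β • z2)
    (ht : ∀ z : T, ∃ α β : R, z = α • t1 + β • t2)
    (h : ∀ α β : R, α • z1 + β • z2 = 0 ↔ α • t1 + β • t2 = 0) : Nonempty (Z ≃ₗ[R] T) := by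
  let f : (R × R) →ₗ[R] Z := (LinearMap.toSpanSingleton R Z z1).coprod (LinearMap.toSpanSingleton R Z z2)
  let g : (R × R) →ₗ[R] T := (LinearMap.toSpanSingleton R T t1).coprod (LinearMap.toSpanSingleton R T t2)
  have hf : Function.Surjective f := by
    intro z; obtain ⟨α, β, rfl⟩ := hz z; exact ⟨(α, β), by simp [f]⟩
  have hg : Function.Surjective g := by
    intro z; obtain ⟨α, β, rfl⟩ := ht z; exact ⟨(α, β), by simp [g]⟩
  have hk : LinearMap.ker f = LinearMap.ker g := by
    ext ⟨α, β⟩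
    simpa [f, g] using h α β
  exact ⟨(f.quotKerEquivOfSurjective hf).symm.trans
    ((Submodule.quotEquivOfEq _ _ hk).trans (g.quotKerEquivOfSurjective hg))⟩

lemma pd_two_gen {Z : Type} [AddCommGroup Z] [Module R Z] (J : Ideal R) {n : ℕ}
    (hJ : PDLE R (R ⧸ J) n) (z1 z2 : Z) (hz : ∀ z : Z, ∃ α β : R, z = α • z1 + β • z2) (a b : R)
    (hrel : ∀ α β : R, α • z1 + β • z2 = 0 ↔ ∃ γ, α - γ * a ∈ J ∧ β - γ * b ∈ J)
    (hfree : ∀ γ, γ * a ∈ J → γ * b ∈ J → γ ∈ J) : PDLE R Z (n + 1) := by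
  have h1 : ∀ r ∈ J, r • z1 = 0 := fun r hr => by
    have := (hrel r 0).2 ⟨0, by simpa using hr, by simp⟩
    simpa using this
  have h2 : ∀ r ∈ J, r • z2 = 0 := fun r hr => by
    have := (hrel 0 r).2 ⟨0, by simp, by simpa using hr⟩
    simpa using this
  let f1 : (R ⧸ J) →ₗ[R] Z := Submodule.liftQ J (LinearMap.toSpanSingleton R Z z1)
      (fun a ha => h1 a ha)
  let f2 : (R ⧸ J) →ₗ[R] Z := Submodule.liftQ J (LinearMap.toSpanSingleton R Z z2)
      (fun a ha => h2 a ha)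
  let i : (R ⧸ J) →ₗ[R] (R ⧸ J) × (R ⧸ J) :=
    (LinearMap.lsmul R (R ⧸ J) a).prod (LinearMap.lsmul R (R ⧸ J) b)
  have hs : SES i (f1.coprod f2) := by
    refine ⟨?_, ?_, ?_⟩
    · rw [← LinearMap.ker_eq_bot, LinearMap.ker_eq_bot']
      intro z
      obtain ⟨c, rfl⟩ := Submodule.mkQ_surjective J z
      intro hc
      have h := Prod.ext_iff.1 hc
      have e1 : a * c ∈ J := (Submodule.Quotient.mk_eq_zero J).1 h.1
      have e2 : b * c ∈ J := (Submodule.Quotient.mk_eq_zero J).1 h.2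
      exact (Submodule.Quotient.mk_eq_zero J).2 (hfree c (by rwa [mul_comm]) (by rwa [mul_comm]))
    · intro z
      obtain ⟨α, β, rfl⟩ := hz z
      exact ⟨(Submodule.mkQ J α, Submodule.mkQ J β), rfl⟩
    · rintro ⟨u, v⟩
      obtain ⟨α, rfl⟩ := Submodule.mkQ_surjective J u
      obtain ⟨β, rfl⟩ := Submodule.mkQ_surjective J v
      constructor
      · intro h
        have : α • z1 + β • z2 = 0 := h
        obtain ⟨γ, e1, e2⟩ := (hrel α β).1 this
        refine ⟨Submodule.mkQ J γ, ?_⟩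
        refine Prod.ext ?_ ?_
        · refine (Submodule.Quotient.eq J).2 ?_
          rw [← neg_mem_iff]
          simpa [mul_comm] using e1
        · refine (Submodule.Quotient.eq J).2 ?_
          rw [← neg_mem_iff]
          simpa [mul_comm] using e2
      · rintro ⟨w, hw⟩
        obtain ⟨γ, rfl⟩ := Submodule.mkQ_surjective J w
        have h := Prod.ext_iff.1 hw
        have e1 : a * γ - α ∈ J := (Submodule.Quotient.eq J).1 h.1
        have e2 : b * γ - β ∈ J := (Submodule.Quotient.eq J).1 h.2
        have : α • z1 + β • z2 = 0 := (hrel α β).2 ⟨γ, by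
          rw [← neg_mem_iff]; simpa [mul_comm] using e1, by
          rw [← neg_mem_iff]; simpa [mul_comm] using e2⟩
        exact this
  exact hs.pd3 hJ ((hJ.prod hJ).mono (by omega))

lemma pd_one_gen {Z : Type} [AddCommGroup Z] [Module R Z] (J : Ideal R) {n : ℕ}
    (hJ : PDLE R (R ⧸ J) n) (z1 : Z) (hz : ∀ z : Z, ∃ α : R, z = α • z1)
    (hrel : ∀ α : R, α • z1 = 0 ↔ α ∈ J) : PDLE R Z n := by
  have hk : LinearMap.ker (LinearMap.toSpanSingleton R Z z1) = J := by
    ext α; simpa using hrel α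
  have hs : Function.Surjective (LinearMap.toSpanSingleton R Z z1) := by
    intro z; obtain ⟨α, rfl⟩ := hz z; exact ⟨α, by simp⟩
  refine hJ.of_equiv ((Submodule.quotEquivOfEq _ _ hk.symm).trans
    (LinearMap.quotKerEquivOfSurjective _ hs))

/-- syzygy-coprimality modulo `J`. -/
def Cop (J : Ideal R) (a b : R) : Prop :=
  ∀ α β, α * a + β * b ∈ J → ∃ γ, α - γ * b ∈ J ∧ β + γ * a ∈ J

/-- `R/J` is a domain with gcds (ideal theoretic form) -/
structure UFDI (J : Ideal R) : Prop where
  prime : J.IsPrime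
  gcd : ∀ a b, (a ∉ J ∨ b ∉ J) → ∃ g a' b', g ∉ J ∧ a - g * a' ∈ J ∧ b - g * b' ∈ J ∧ Cop J a' b'

end tools

section seven

variable {R : Type} [CommRing R]

lemma addL_two (x y : R) : addL ⊥ [x, y] = Ideal.span {x, y} := by
  simp [addL, Ideal.span_insert]

lemma addL_three (l x y : R) : addL ⊥ [l, x, y] = Ideal.span {l, x, y} := by
  simp [addL, Ideal.span_insert, sup_assoc]

lemma mem_span_three {l x y z : R} :
    z ∈ Ideal.span {l, x, y} ↔ ∃ u s t, u * l + s * x + t * y = z := by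
  rw [Ideal.mem_span_insert]
  constructor
  · rintro ⟨u, w, hw, rfl⟩
    obtain ⟨s, t, rfl⟩ := Ideal.mem_span_pair.1 hw
    exact ⟨u, s, t, by ring⟩
  · rintro ⟨u, s, t, rfl⟩
    exact ⟨u, s * x + t * y, Ideal.mem_span_pair.2 ⟨s, t, rfl⟩, by ring⟩

/-- the double structure ideal -/
def HI (x y a b : R) : Ideal R := Ideal.span {x * x, x * y, y * y, a * x + b * y}

lemma mem_HI {x y a b z : R} : z ∈ HI x y a b ↔
    ∃ s t u γ, z = s * (x * x) + t * (x * y) + u * (y * y) + γ * (a * x + b * y) := by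
  rw [HI, Ideal.mem_span_insert]
  constructor
  · rintro ⟨s, w, hw, rfl⟩
    obtain ⟨t, u, γ, rfl⟩ := mem_span_three.1 hw
    exact ⟨s, t, u, γ, by ring⟩
  · rintro ⟨s, t, u, γ, rfl⟩
    exact ⟨s, _, mem_span_three.2 ⟨t, u, γ, rfl⟩, by ring⟩

lemma coef {J : Ideal R} {x y α β s t u : R} (hx : RegM J x) (hy : RegM (J ⊔ Ideal.span {x}) y)
    (h : α * x + β * y - (s * (x * x) + t * (x * y) + u * (y * y)) ∈ J) :
    α ∈ J ⊔ Ideal.span {x} ⊔ Ideal.span {y} ∧ β ∈ J ⊔ Ideal.span {x} ⊔ Ideal.span {y} := by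
  have h1 : β - u * y ∈ J ⊔ Ideal.span {x} := by
    apply hy
    refine mem_addI.2 ⟨s * x + t * y - α, ?_⟩
    convert h using 1; ring
  obtain ⟨v, hv⟩ := mem_addI.1 h1
  have h2 : α - s * x - t * y + v * y ∈ J := by
    apply hx
    have := J.sub_mem h (J.mul_mem_left y hv)
    convert this using 1; ring
  constructor
  · refine mem_addI.2 ⟨t - v, mem_addI.2 ⟨s, ?_⟩⟩
    convert h2 using 1; ring
  · exact mem_addI.2 ⟨u, h1⟩

variable {x y a b l q : R}

lemma sq_mem_HI {α β : R} (hα : α ∈ Ideal.span {x, y}) (hβ : β ∈ Ideal.span {x, y}) :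
    α * β ∈ HI x y a b := by
  obtain ⟨s, t, rfl⟩ := Ideal.mem_span_pair.1 hα
  obtain ⟨s', t', rfl⟩ := Ideal.mem_span_pair.1 hβ
  exact mem_HI.2 ⟨s * s', s * t' + t * s', t * t', 0, by ring⟩

lemma HI_le : HI x y a b ≤ Ideal.span {x, y} := by
  intro z hz
  obtain ⟨s, t, u, γ, rfl⟩ := mem_HI.1 hz
  exact Ideal.mem_span_pair.2 ⟨s * x + t * y + γ * a, u * y + γ * b, by ring⟩

lemma relH (hx : RegM ⊥ x) (hy : RegM (⊥ ⊔ Ideal.span {x}) y) (α β : R) :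
    α * x + β * y ∈ HI x y a b ↔
      ∃ γ, α - γ * a ∈ Ideal.span {x, y} ∧ β - γ * b ∈ Ideal.span {x, y} := by
  constructor
  · intro h
    obtain ⟨s, t, u, γ, h⟩ := mem_HI.1 h
    refine ⟨γ, ?_⟩
    rw [← addL_two]
    apply coef (s := s) (t := t) (u := u) hx hy
    rw [Ideal.mem_bot]
    linear_combination h
  · rintro ⟨γ, h1, h2⟩
    have hX : x ∈ Ideal.span {x, y} := Ideal.subset_span (by simp)
    have hY : y ∈ Ideal.span {x, y} := Ideal.subset_span (by simp)
    have e1 := sq_mem_HI (a := a) (b := b) h1 hX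
    have e2 := sq_mem_HI (a := a) (b := b) h2 hY
    have e3 : γ * (a * x + b * y) ∈ HI x y a b := mem_HI.2 ⟨0, 0, 0, γ, by ring⟩
    have := Ideal.add_mem _ (Ideal.add_mem _ e1 e2) e3
    convert this using 1; ring

lemma relHl (hx : RegM (⊥ ⊔ Ideal.span {l}) x)
    (hy : RegM (⊥ ⊔ Ideal.span {l} ⊔ Ideal.span {x}) y) (α β : R) :
    α * x + β * y ∈ HI x y a b ⊔ Ideal.span {l} ↔
      ∃ γ, α - γ * a ∈ Ideal.span {l, x, y} ∧ β - γ * b ∈ Ideal.span {l, x, y} := by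
  constructor
  · intro h
    obtain ⟨v, h⟩ := mem_addI.1 h
    obtain ⟨s, t, u, γ, h⟩ := mem_HI.1 h
    refine ⟨γ, ?_⟩
    rw [← addL_three]
    apply coef (s := s) (t := t) (u := u) hx hy
    refine mem_addI.2 ⟨v, ?_⟩
    rw [Ideal.mem_bot]
    linear_combination h
  · rintro ⟨γ, h1, h2⟩
    obtain ⟨u, s, t, h1⟩ := mem_span_three.1 h1
    obtain ⟨u', s', t', h2⟩ := mem_span_three.1 h2
    refine mem_addI.2 ⟨u * x + u' * y, mem_HI.2 ⟨s, t + s', t', γ, ?_⟩⟩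
    linear_combination (-x) * h1 - y * h2

/-- hypotheses common to all cases -/
structure Base (x y a b : R) : Prop where
  rx : RegM ⊥ x
  ry : RegM (⊥ ⊔ Ideal.span {x}) y
  ufd : UFDI (Ideal.span {x, y})
  cop : Cop (Ideal.span {x, y}) a b

namespace Base

lemma rs (B : Base x y a b) : RS ⊥ [x, y] := ⟨B.rx, B.ry, trivial⟩

lemma ne (B : Base x y a b) : a ∉ Ideal.span {x, y} ∨ b ∉ Ideal.span {x, y} := by
  by_contra h
  push Not at h
  obtain ⟨γ, h1, -⟩ := B.cop 1 0 (by simpa using h.1)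
  apply B.ufd.prime.ne_top
  rw [Ideal.eq_top_iff_one]
  have := Ideal.add_mem _ h1 (Ideal.mul_mem_left _ γ h.2)
  simpa using this

lemma pdp (B : Base x y a b) : PDLE R (R ⧸ Ideal.span {x, y}) 2 := pd_RS' [x, y] B.rs (addL_two x y)

/-- a module of the two-generator type -/
lemma kerGen : ∀ z : LinearMap.ker (Submodule.factor (HI_le : HI x y a b ≤ Ideal.span {x, y})),
    ∃ α β : R, z = α • (⟨Submodule.mkQ (HI x y a b) x, (Submodule.Quotient.mk_eq_zero _).2
        (Ideal.subset_span (by simp))⟩ : LinearMap.ker (Submodule.factor (HI_le : HI x y a b ≤ Ideal.span {x, y})))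
      + β • ⟨Submodule.mkQ (HI x y a b) y, (Submodule.Quotient.mk_eq_zero _).2
        (Ideal.subset_span (by simp))⟩ := by
  rintro ⟨z, hz⟩
  obtain ⟨c, rfl⟩ := Submodule.mkQ_surjective _ z
  have : c ∈ Ideal.span {x, y} := (Submodule.Quotient.mk_eq_zero _).1 hz
  obtain ⟨s, t, rfl⟩ := Ideal.mem_span_pair.1 this
  exact ⟨s, t, rfl⟩

lemma kerRel (B : Base x y a b) (α β : R) : α • (⟨Submodule.mkQ (HI x y a b) x, (Submodule.Quotient.mk_eq_zero _).2
        (Ideal.subset_span (by simp))⟩ : LinearMap.ker (Submodule.factor (HI_le : HI x y a b ≤ Ideal.span {x, y})))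
      + β • ⟨Submodule.mkQ (HI x y a b) y, (Submodule.Quotient.mk_eq_zero _).2
        (Ideal.subset_span (by simp))⟩ = 0 ↔
     ∃ γ, α - γ * a ∈ Ideal.span {x, y} ∧ β - γ * b ∈ Ideal.span {x, y} := by
  rw [← relH B.rx B.ry, Subtype.ext_iff]
  exact Submodule.Quotient.mk_eq_zero (HI x y a b) (x := α * x + β * y)

lemma sesZ : SES (LinearMap.ker (Submodule.factor (HI_le : HI x y a b ≤ Ideal.span {x, y}))).subtype
    (Submodule.factor (HI_le : HI x y a b ≤ Ideal.span {x, y})) :=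
  ses_ker _ (Submodule.factor_surjective _)

lemma pdH (B : Base x y a b) : PDLE R (R ⧸ HI x y a b) 3 := by
  refine (sesZ (x := x) (y := y) (a := a) (b := b)).pd2 ?_ (B.pdp.mono (by omega))
  refine pd_two_gen _ B.pdp _ _ kerGen a b B.kerRel ?_
  intro γ h1 h2
  rcases B.ne with h | h
  · exact (B.ufd.prime.mem_or_mem h1).resolve_right h
  · exact (B.ufd.prime.mem_or_mem h2).resolve_right h

lemma gradeP (B : Base x y a b) {M : Type} [AddCommGroup M] [Module R M] (hM : ∀ r ∈ Ideal.span {x, y}, ∀ m : M, r • m = 0) :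
    GradeGE R M (R ⧸ (⊥ : Ideal R)) 2 :=
  grade_RS B.rs (by
    intro r hr; apply hM
    apply Ideal.subset_span; simpa using hr)

lemma eep (B : Base x y a b) : Nonempty (EE R (R ⧸ Ideal.span {x, y}) 2 ≃ₗ[R] (R ⧸ Ideal.span {x, y})) :=
  ee_ci [x, y] B.rs (addL_two x y) (by intro r hr; apply Ideal.subset_span; simpa using hr)

lemma gradeAB (B : Base x y a b) : GradeGE R (R ⧸ Ideal.span {x, y, a, b}) (R ⧸ (⊥ : Ideal R)) 4 := by
  have hle : Ideal.span {x, y} ≤ Ideal.span {x, y, a, b} := Ideal.span_mono (by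
    intro z; simp; tauto)
  have ha : a ∈ Ideal.span {x, y, a, b} := Ideal.subset_span (by simp)
  have hb : b ∈ Ideal.span {x, y, a, b} := Ideal.subset_span (by simp)
  by_cases h : a ∈ Ideal.span {x, y}
  · obtain ⟨γ, h1, -⟩ := B.cop 1 0 (by simpa using h)
    have : Ideal.span {x, y, a, b} = ⊤ := by
      rw [Ideal.eq_top_iff_one]
      have := Ideal.add_mem _ (hle h1) (Ideal.mul_mem_left _ γ hb)
      simpa using this
    have hs : Subsingleton (R ⧸ Ideal.span {x, y, a, b}) := Ideal.Quotient.subsingleton_iff.2 this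
    intro i _
    have hp : PDLE R (R ⧸ Ideal.span {x, y, a, b}) 0 := PDLE.of_subsingleton 0
    rcases Nat.eq_zero_or_pos i with rfl | hi
    · exact ext_zero_vanish 1 (fun m => Subsingleton.elim _ _) (by simp)
    · exact ext_subsingleton_of_pd hp hi
  · have hrs : RS ⊥ [x, y, a, b] := by
      refine ⟨B.rx, B.ry, ?_, ?_, trivial⟩
      · have : ⊥ ⊔ Ideal.span {x} ⊔ Ideal.span {y} = Ideal.span {x, y} := addL_two x y
        rw [this]
        exact RegM.of_prime B.ufd.prime h
      · have : ⊥ ⊔ Ideal.span {x} ⊔ Ideal.span {y} = Ideal.span {x, y} := addL_two x y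
        rw [this]
        intro r hr
        obtain ⟨s, hs⟩ := mem_addI.1 hr
        obtain ⟨γ, -, h2⟩ := B.cop (-s) r (by convert hs using 1; ring)
        exact mem_addI.2 ⟨-γ, by simpa using h2⟩
    refine grade_RS (rs := [x, y, a, b]) hrs ?_
    intro r hr m
    exact smul_quot_zero (Ideal.subset_span (by simpa using hr)) m

lemma omegaH (B : Base x y a b) : PDLE R (EE R (R ⧸ HI x y a b) 2) 2 ∧
    ∃ w1 w2 : EE R (R ⧸ HI x y a b) 2, ∀ w, ∃ α β : R, w = α • w1 + β • w2 := by
  set p := Ideal.span {x, y} with hp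
  have hle : p ≤ Ideal.span {x, y, a, b} := Ideal.span_mono (by
    intro z; simp; tauto)
  have ha : a ∈ Ideal.span {x, y, a, b} := Ideal.subset_span (by simp)
  have hb : b ∈ Ideal.span {x, y, a, b} := Ideal.subset_span (by simp)
  let g := Submodule.factor hle
  have hT : SES (LinearMap.ker g).subtype g := ses_ker _ (Submodule.factor_surjective _)
  -- iso between Z and T
  let t1 : LinearMap.ker g := ⟨Submodule.mkQ p b, (Submodule.Quotient.mk_eq_zero _).2 hb⟩
  let t2 : LinearMap.ker g := ⟨-Submodule.mkQ p a, by
    rw [neg_mem_iff]; exact (Submodule.Quotient.mk_eq_zero _).2 ha⟩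
  have ht : ∀ z : LinearMap.ker g, ∃ α β : R, z = α • t1 + β • t2 := by
    rintro ⟨z, hz⟩
    obtain ⟨c, rfl⟩ := Submodule.mkQ_surjective _ z
    have hc : c ∈ Ideal.span {x, y, a, b} := (Submodule.Quotient.mk_eq_zero _).1 hz
    have : Ideal.span {x, y, a, b} = Ideal.span {a, b} ⊔ p := by
      rw [hp, ← Ideal.span_union]; congr 1; ext; simp only [Set.mem_insert_iff, Set.mem_singleton_iff, Set.mem_union]; tauto
    rw [this] at hc
    obtain ⟨c1, h1, c2, h2, rfl⟩ := Submodule.mem_sup.1 hc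
    obtain ⟨s, t, rfl⟩ := Ideal.mem_span_pair.1 h1
    refine ⟨t, -s, ?_⟩
    apply Subtype.ext
    refine (Submodule.Quotient.eq p).2 ?_
    convert h2 using 1
    simp; ring
  have hrel : ∀ α β : R, α • t1 + β • t2 = 0 ↔
      ∃ γ, α - γ * a ∈ p ∧ β - γ * b ∈ p := by
    intro α β
    have : α • t1 + β • t2 = 0 ↔ α * b - β * a ∈ p := by
      rw [← Submodule.Quotient.mk_eq_zero, Subtype.ext_iff]
      have : (α • t1 + β • t2).1 = Submodule.Quotient.mk (α * b - β * a) := by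
        change Submodule.Quotient.mk _ = _
        congr 1
        change α * b + β * (-a) = _
        ring
      rw [this]; rfl
    rw [this]
    constructor
    · intro h
      obtain ⟨γ, h1, h2⟩ := B.cop (-β) α (by convert h using 1; ring)
      refine ⟨-γ, by simpa using h2, ?_⟩
      rw [← neg_mem_iff]
      convert h1 using 1; ring
    · rintro ⟨γ, h1, h2⟩
      have := p.sub_mem (p.mul_mem_left b h1) (p.mul_mem_left a h2)
      convert this using 1; ring
  obtain ⟨e⟩ := two_gen_iso _ _ t1 t2 kerGen ht
    (fun α β => (B.kerRel α β).trans (hrel α β).symm)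
  have gAB := B.gradeAB
  have gp : GradeGE R (R ⧸ p) (R ⧸ (⊥ : Ideal R)) 2 := B.gradeP (fun r hr m => smul_quot_zero hr m)
  -- E^2(T) ≅ E^2(R/p)
  have i2 : Function.Injective (epre (LinearMap.ker g).subtype (R ⧸ (⊥ : Ideal R)) 2) := by
    rw [← LinearMap.ker_eq_bot, LinearMap.ker_eq_bot']
    intro z hz
    obtain ⟨w, rfl⟩ := (hT.ex2 2 z).1 hz
    have := gAB 2 (by omega)
    rw [Subsingleton.elim w 0, map_zero]
  have s2 : Function.Surjective (epre (LinearMap.ker g).subtype (R ⧸ (⊥ : Ideal R)) 2) :=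
    hT.ee_surj 2 (gAB 3 (by omega))
  have eT := LinearEquiv.ofBijective _ ⟨i2, s2⟩
  obtain ⟨e2⟩ := epre_bij (N := R ⧸ (⊥ : Ideal R)) e 2
  obtain ⟨e1⟩ := epre_bij (N := R ⧸ (⊥ : Ideal R)) e 1
  have T1 : Subsingleton (EE R (LinearMap.ker g) 1) := by
    refine subsingleton_of_forall_eq 0 fun z => ?_
    obtain ⟨w, rfl⟩ := hT.ee_surj 1 (gAB 2 (by omega)) z
    have := gp 1 (by omega)
    rw [Subsingleton.elim w 0, map_zero]
  have Z1 := e1.symm.toEquiv.subsingleton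
  have hZ := sesZ (x := x) (y := y) (a := a) (b := b)
  have inj := hZ.ee_inj 1 Z1
  have surj := hZ.ee_surj (N := R ⧸ (⊥ : Ideal R)) 2 (ext_subsingleton_of_pd B.pdp (by omega))
  have hS : SES _ _ := ⟨inj, surj, hZ.ex2 2⟩
  obtain ⟨ep⟩ := B.eep
  have eZ := ep.symm.trans (eT.trans e2)
  refine ⟨hS.pd2 (B.pdp.of_equiv ep.symm) (B.pdp.of_equiv eZ), ?_⟩
  obtain ⟨w2, hw2⟩ := surj (eZ (Submodule.mkQ p 1))
  refine ⟨epre (Submodule.factor HI_le) _ 2 (ep.symm (Submodule.mkQ p 1)), w2, ?_⟩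
  intro w
  obtain ⟨β, hβ⟩ := Submodule.mkQ_surjective p (eZ.symm (epre (LinearMap.ker (Submodule.factor (HI_le : HI x y a b ≤ p))).subtype _ 2 w))
  have h1 : epre (LinearMap.ker (Submodule.factor (HI_le : HI x y a b ≤ p))).subtype (R ⧸ (⊥ : Ideal R)) 2 (w - β • w2) = 0 := by
    rw [map_sub, map_smul, hw2, ← map_smul, sub_eq_zero]
    rw [LinearEquiv.eq_symm_apply] at hβ
    rw [← hβ]
    congr 1
    rw [← map_smul]
    congr 1
    simp
  obtain ⟨v, hv⟩ := (hZ.ex2 2 _).1 h1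
  obtain ⟨α, hα⟩ := Submodule.mkQ_surjective p (ep v)
  refine ⟨α, β, ?_⟩
  rw [← map_smul, ← map_smul, ← map_smul]
  have : α • (1 : R) = α := by simp
  rw [this, hα, LinearEquiv.symm_apply_apply, hv]
  abel

end Base

/-- range of a map from a two-generated module into `R/Q` -/
lemma pd_range_two {Q : Ideal R} (hQ : UFDI Q) {n : ℕ} (hpd : PDLE R (R ⧸ Q) n) {W : Type}
    [AddCommGroup W] [Module R W] (ψ : W →ₗ[R] (R ⧸ Q))
    (hW : ∃ w1 w2 : W, ∀ w, ∃ α β : R, w = α • w1 + β • w2) :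
    PDLE R (LinearMap.range ψ) (n + 1) := by
  obtain ⟨w1, w2, hW⟩ := hW
  obtain ⟨h1, e1⟩ := Submodule.mkQ_surjective Q (ψ w1)
  obtain ⟨h2, e2⟩ := Submodule.mkQ_surjective Q (ψ w2)
  have hgen : ∀ z : LinearMap.range ψ, ∃ α β : R, z = α • ψ.rangeRestrict w1 + β • ψ.rangeRestrict w2 := by
    rintro ⟨z, w, rfl⟩
    obtain ⟨α, β, rfl⟩ := hW w
    exact ⟨α, β, by ext; simp⟩
  have hz : ∀ α β : R, α • ψ.rangeRestrict w1 + β • ψ.rangeRestrict w2 = 0 ↔ α * h1 + β * h2 ∈ Q := by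
    intro α β
    rw [← Submodule.Quotient.mk_eq_zero, Subtype.ext_iff]
    have : (α • ψ.rangeRestrict w1 + β • ψ.rangeRestrict w2).1 = Submodule.Quotient.mk (α * h1 + β * h2) := by
      change α • ψ w1 + β • ψ w2 = _
      rw [← e1, ← e2]; rfl
    rw [this]; rfl
  by_cases h : h1 ∈ Q ∧ h2 ∈ Q
  · have : Subsingleton (LinearMap.range ψ) := by
      refine subsingleton_of_forall_eq 0 fun z => ?_
      obtain ⟨α, β, rfl⟩ := hgen z
      exact (hz α β).2 (Q.add_mem (Q.mul_mem_left _ h.1) (Q.mul_mem_left _ h.2))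
    exact PDLE.of_subsingleton _
  · obtain ⟨g, a, b, hg, ha, hb, hc⟩ := hQ.gcd h1 h2 (by tauto)
    refine pd_two_gen Q hpd _ _ hgen b (-a) ?_ ?_
    · intro α β
      rw [hz]
      constructor
      · intro hh
        have : g * (α * a + β * b) ∈ Q := by
          have := Q.sub_mem hh (Q.add_mem (Q.mul_mem_left α ha) (Q.mul_mem_left β hb))
          convert this using 1; ring
        obtain ⟨γ, h3, h4⟩ := hc α β ((hQ.prime.mem_or_mem this).resolve_left hg)
        exact ⟨γ, h3, by simpa using h4⟩
      · rintro ⟨γ, h3, h4⟩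
        have := Q.add_mem (Q.add_mem (Q.mul_mem_left α ha) (Q.mul_mem_left β hb))
          (Q.add_mem (Q.mul_mem_left (g * a) h3) (Q.mul_mem_left (g * b) h4))
        convert this using 1; ring
    · intro γ h3 h4
      by_contra hγ
      have hb' := (hQ.prime.mem_or_mem h3).resolve_left hγ
      have ha' := (hQ.prime.mem_or_mem h4).resolve_left hγ
      rw [neg_mem_iff] at ha'
      apply h
      constructor
      · have := Q.add_mem ha (Q.mul_mem_left g ha'); simpa using this
      · have := Q.add_mem hb (Q.mul_mem_left g hb'); simpa using this

end seven

section cases7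

variable {R : Type} [CommRing R] {x y a b l q : R}

def GoodK (K : Ideal R) : Prop := PDLE R (R ⧸ K) 4 ∧ PDLE R (EE R (R ⧸ K) 2) 3

lemma prin {Q : Ideal R} (hQ : UFDI Q) {g0 : R} (hg : g0 ∉ Q) (τ : R) :
    ∃ g1, g1 ∉ Q ∧ ∀ r, (∃ γ, r * τ - γ * g0 ∈ Q) ↔ r ∈ Q ⊔ Ideal.span {g1} := by
  obtain ⟨h, g1, τ1, hh, e1, e2, hc⟩ := hQ.gcd g0 τ (Or.inl hg)
  refine ⟨g1, fun hg1 => hg ?_, fun r => ⟨?_, ?_⟩⟩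
  · have := Q.add_mem e1 (Q.mul_mem_left h hg1); simpa using this
  · rintro ⟨γ, hγ⟩
    have : h * (-γ * g1 + r * τ1) ∈ Q := by
      have := Q.add_mem hγ (Q.sub_mem (Q.mul_mem_left γ e1) (Q.mul_mem_left r e2))
      convert this using 1; ring
    obtain ⟨δ, -, h2⟩ := hc _ _ ((hQ.prime.mem_or_mem this).resolve_left hh)
    exact mem_addI.2 ⟨-δ, by simpa using h2⟩
  · intro hr
    obtain ⟨s, hs⟩ := mem_addI.1 hr
    refine ⟨s * τ1, ?_⟩
    have := Q.sub_mem (Q.add_mem (Q.mul_mem_left τ hs) (Q.mul_mem_left (s * g1) e2)) (Q.mul_mem_left (s * τ1) e1)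
    convert this using 1; ring

/-- hypotheses for `l ∉ (x,y)` -/
structure Base2 (x y a b l q : R) : Prop extends Base x y a b where
  rl : RegM ⊥ l
  rlx : RegM (⊥ ⊔ Ideal.span {l}) x
  rly : RegM (⊥ ⊔ Ideal.span {l} ⊔ Ideal.span {x}) y
  ufdQ : UFDI (Ideal.span {l, x, y})
  rlq : RegM (⊥ ⊔ Ideal.span {l}) q
  rlH : RegM (HI x y a b) l

namespace Base2

lemma rs3 (B : Base2 x y a b l q) : RS ⊥ [l, x, y] := ⟨B.rl, B.rlx, B.rly, trivial⟩
lemma rsH1 (B : Base2 x y a b l q) : RS ⊥ [l, q] := ⟨B.rl, B.rlq, trivial⟩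

lemma pdQ (B : Base2 x y a b l q) : PDLE R (R ⧸ Ideal.span {l, x, y}) 3 :=
  pd_RS' [l, x, y] B.rs3 (addL_three l x y)

lemma pdH1 (B : Base2 x y a b l q) : PDLE R (R ⧸ Ideal.span {l, q}) 2 :=
  pd_RS' [l, q] B.rsH1 (addL_two l q)

lemma p_le_Q : Ideal.span {x, y} ≤ Ideal.span {l, x, y} := Ideal.span_mono (by
    intro z; simp; tauto)

lemma l_mem_Q : l ∈ Ideal.span {l, x, y} := Ideal.subset_span (by simp)

lemma mem_Q {z : R} : z ∈ Ideal.span {l, x, y} ↔ ∃ s, z - s * l ∈ Ideal.span {x, y} := by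
  rw [← mem_addI, Ideal.span_insert, sup_comm]

lemma abne (B : Base2 x y a b l q) : a ∉ Ideal.span {l, x, y} ∨ b ∉ Ideal.span {l, x, y} := by
  by_contra h
  push Not at h
  obtain ⟨a', ha'⟩ := mem_Q.1 h.1
  obtain ⟨b', hb'⟩ := mem_Q.1 h.2
  set p := Ideal.span {x, y} with hp
  obtain ⟨γ, h1, h2⟩ := B.cop b' (-a') (by
    have := p.sub_mem (p.mul_mem_left b' ha') (p.mul_mem_left a' hb')
    convert this using 1; ring)
  have hu : 1 - γ * l ∉ p := by
    intro hu
    apply B.ufdQ.prime.ne_top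
    rw [Ideal.eq_top_iff_one]
    have := Ideal.add_mem _ (p_le_Q (l := l) hu) (Ideal.mul_mem_left _ γ l_mem_Q)
    simpa using this
  have hb0 : b' * (1 - γ * l) ∈ p := by
    have := p.add_mem h1 (p.mul_mem_left γ hb')
    convert this using 1; ring
  have ha0 : a' * (1 - γ * l) ∈ p := by
    have := p.sub_mem (p.mul_mem_left γ ha') h2
    convert this using 1; ring
  have hb1 := (B.ufd.prime.mem_or_mem hb0).resolve_right hu
  have ha1 := (B.ufd.prime.mem_or_mem ha0).resolve_right hu
  rcases B.ne with h | h
  · apply h; have := p.add_mem ha' (p.mul_mem_right l ha1); simpa using this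
  · apply h; have := p.add_mem hb' (p.mul_mem_right l hb1); simpa using this

/-- the colon ideal -/
def Gam (x y a b l q : R) : Ideal R :=
  Submodule.comap (LinearMap.lsmul R R q) (HI x y a b ⊔ Ideal.span {l})

lemma mem_Gam {r : R} : r ∈ Gam x y a b l q ↔ q * r ∈ HI x y a b ⊔ Ideal.span {l} := Iff.rfl

def KK (x y a b l q : R) : Ideal R := Ideal.span {l, q} ⊓ HI x y a b

lemma sesA (B : Base2 x y a b l q) :
    ∃ (f : (R ⧸ HI x y a b) →ₗ[R] (R ⧸ KK x y a b l q))
      (g : (R ⧸ KK x y a b l q) →ₗ[R] (R ⧸ (KK x y a b l q ⊔ Ideal.span {l}))), SES f g := by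
  apply ses_colon _ _ _ l
  · intro r
    constructor
    · intro h
      exact ⟨Ideal.mul_mem_right _ _ (Ideal.subset_span (by simp)), Ideal.mul_mem_left _ _ h⟩
    · rintro ⟨-, h⟩
      exact B.rlH r h
  · intro r; exact mem_addI

lemma sesB :
    ∃ (f : (R ⧸ Gam x y a b l q) →ₗ[R] (R ⧸ (KK x y a b l q ⊔ Ideal.span {l})))
      (g : (R ⧸ (KK x y a b l q ⊔ Ideal.span {l})) →ₗ[R] (R ⧸ Ideal.span {l, q})), SES f g := by
  apply ses_colon _ _ _ q
  · intro r
    rw [mem_Gam]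
    constructor
    · intro h
      obtain ⟨s, hs⟩ := mem_addI.1 h
      refine mem_addI.2 ⟨s, ⟨?_, hs⟩⟩
      exact Ideal.mem_span_pair.2 ⟨-s, r, by ring⟩
    · intro h
      have hle : KK x y a b l q ⊔ Ideal.span {l} ≤ HI x y a b ⊔ Ideal.span {l} :=
        sup_le_sup_right inf_le_right _
      exact hle h
  · intro r
    constructor
    · intro h
      obtain ⟨s, t, rfl⟩ := Ideal.mem_span_pair.1 h
      exact ⟨t, mem_addI.2 ⟨s, by ring_nf; exact Ideal.zero_mem _⟩⟩
    · rintro ⟨s, hs⟩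
      have : KK x y a b l q ⊔ Ideal.span {l} ≤ Ideal.span {l, q} := by
        refine sup_le inf_le_left (Ideal.span_mono (by simp))
      have h2 := Ideal.add_mem _ (this hs) (Ideal.mul_mem_left _ s
        (Ideal.subset_span (by simp) : q ∈ Ideal.span {l, q}))
      simpa using h2

lemma pdK (B : Base2 x y a b l q) (h : PDLE R (R ⧸ Gam x y a b l q) 4) :
    PDLE R (R ⧸ KK x y a b l q) 4 := by
  obtain ⟨f, g, hA⟩ := B.sesA
  obtain ⟨f', g', hB⟩ := sesB (x := x) (y := y) (a := a) (b := b) (l := l) (q := q)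
  exact hA.pd2 (B.pdH.mono (by omega)) (hB.pd2 h (B.pdH1.mono (by omega)))

lemma gradeH (B : Base x y a b) : GradeGE R (R ⧸ HI x y a b) (R ⧸ (⊥ : Ideal R)) 2 := by
  intro i hi
  refine Base.sesZ.sub_mid i ?_ (B.gradeP (fun r hr m => smul_quot_zero hr m) i hi)
  refine B.gradeP ?_ i hi
  rintro r hr ⟨z, hz⟩
  obtain ⟨c, rfl⟩ := Submodule.mkQ_surjective _ z
  have hc : c ∈ Ideal.span {x, y} := (Submodule.Quotient.mk_eq_zero _).1 hz
  apply Subtype.ext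
  exact (Submodule.Quotient.mk_eq_zero _).2 (sq_mem_HI hr hc)

lemma caseii_gam (B : Base2 x y a b l q) (hq : q ∈ Ideal.span {l, x, y}) :
    Ideal.span {l, x, y} ≤ Gam x y a b l q ∧ PDLE R (R ⧸ Gam x y a b l q) 4 := by
  obtain ⟨e, c, d, hqe⟩ := mem_span_three.1 hq
  set Q := Ideal.span {l, x, y} with hQ
  have key : ∀ r, r ∈ Gam x y a b l q ↔ ∃ γ, r * c - γ * a ∈ Q ∧ r * d - γ * b ∈ Q := by
    intro r
    rw [mem_Gam, ← relHl B.rlx B.rly]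
    have hl : r * e * l ∈ HI x y a b ⊔ Ideal.span {l} :=
      Ideal.mul_mem_left _ _ (Ideal.mem_sup_right (Ideal.mem_span_singleton_self l))
    have : q * r = r * c * x + r * d * y + r * e * l := by rw [← hqe]; ring
    rw [this]
    exact Ideal.add_mem_iff_left _ hl
  have hP := B.ufdQ.prime
  refine ⟨fun r hr => (key r).2 ⟨0, by simpa using Q.mul_mem_right c hr, by simpa using Q.mul_mem_right d hr⟩, ?_⟩
  obtain ⟨g0, a0, b0, hg0, ha0, hb0, hcop⟩ := B.ufdQ.gcd a b B.abne
  have hne : a0 ∉ Q ∨ b0 ∉ Q := by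
    by_contra h
    push Not at h
    rcases B.abne with h1 | h1
    · apply h1; have := Q.add_mem ha0 (Q.mul_mem_left g0 h.1); simpa using this
    · apply h1; have := Q.add_mem hb0 (Q.mul_mem_left g0 h.2); simpa using this
  by_cases hcd : c * b0 - d * a0 ∈ Q
  · obtain ⟨τ', h1, h2⟩ := hcop (-d) c (by convert hcd using 1; ring)
    obtain ⟨g1, hg1, hg⟩ := prin B.ufdQ hg0 (-τ')
    have : Gam x y a b l q = Q ⊔ Ideal.span {g1} := by
      ext r
      rw [key, ← hg]
      constructor
      · rintro ⟨γ, e1, e2⟩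
        refine ⟨γ, ?_⟩
        rcases hne with h | h
        · refine (hP.mem_or_mem (x := a0) ?_).resolve_left h
          have := Q.add_mem (Q.sub_mem e1 (Q.mul_mem_left r h2)) (Q.mul_mem_left γ ha0)
          convert this using 1; ring
        · refine (hP.mem_or_mem (x := b0) ?_).resolve_left h
          have := Q.add_mem (Q.add_mem e2 (Q.mul_mem_left r h1)) (Q.mul_mem_left γ hb0)
          convert this using 1; ring
      · rintro ⟨γ, e1⟩
        refine ⟨γ, ?_, ?_⟩
        · have := Q.sub_mem (Q.add_mem (Q.mul_mem_left a0 e1) (Q.mul_mem_left r h2)) (Q.mul_mem_left γ ha0)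
          convert this using 1; ring
        · have := Q.sub_mem (Q.sub_mem (Q.mul_mem_left b0 e1) (Q.mul_mem_left r h1)) (Q.mul_mem_left γ hb0)
          convert this using 1; ring
    rw [this]
    exact pd_add (RegM.of_prime hP hg1) B.pdQ
  · have : Gam x y a b l q = Q := by
      ext r
      rw [key]
      constructor
      · rintro ⟨γ, e1, e2⟩
        refine (hP.mem_or_mem (y := c * b0 - d * a0) ?_).resolve_right hcd
        have := Q.add_mem (Q.sub_mem (Q.mul_mem_left b0 e1) (Q.mul_mem_left a0 e2))
          (Q.sub_mem (Q.mul_mem_left (γ * b0) ha0) (Q.mul_mem_left (γ * a0) hb0))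
        convert this using 1; ring
      · intro hr
        exact ⟨0, by simpa using Q.mul_mem_right c hr, by simpa using Q.mul_mem_right d hr⟩
    rw [this]
    exact B.pdQ.mono (by omega)

lemma mem3 {r : R} (h : r ∈ [l, x, y]) : r ∈ Ideal.span {l, x, y} := by
  apply Ideal.subset_span; simpa using h

lemma eeH1 (B : Base2 x y a b l q) : PDLE R (EE R (R ⧸ Ideal.span {l, q}) 2) 2 := by
  obtain ⟨e⟩ := ee_ci [l, q] B.rsH1 (addL_two l q) (by
    intro r hr; apply Ideal.subset_span; simpa using hr)
  exact B.pdH1.of_equiv e.symm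

theorem caseii (B : Base2 x y a b l q) (hq : q ∈ Ideal.span {l, x, y}) :
    GoodK (KK x y a b l q) := by
  obtain ⟨hle, hpd⟩ := B.caseii_gam hq
  refine ⟨B.pdK hpd, ?_⟩
  obtain ⟨f, g, hA⟩ := B.sesA
  obtain ⟨f', g', hB⟩ := sesB (x := x) (y := y) (a := a) (b := b) (l := l) (q := q)
  have gG : GradeGE R (R ⧸ Gam x y a b l q) (R ⧸ (⊥ : Ideal R)) 3 :=
    grade_RS (rs := [l, x, y]) B.rs3 (fun r hr m => smul_quot_zero (hle (mem3 hr)) m)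
  have inj2 := hB.ee_inj 1 (gG 1 (by omega))
  have surj2 : Function.Surjective (epre g' (R ⧸ (⊥ : Ideal R)) 2) := by
    intro z
    have := gG 2 (by omega)
    exact (hB.ex2 2 z).1 (Subsingleton.elim _ _)
  have pdX : PDLE R (EE R (R ⧸ (KK x y a b l q ⊔ Ideal.span {l})) 2) 2 :=
    B.eeH1.of_equiv (LinearEquiv.ofBijective _ ⟨inj2, surj2⟩)
  have inj3 : Function.Injective (epre f' (R ⧸ (⊥ : Ideal R)) 3) := by
    rw [← LinearMap.ker_eq_bot, LinearMap.ker_eq_bot']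
    intro z hz
    obtain ⟨w, rfl⟩ := (hB.ex2 3 z).1 hz
    have : Subsingleton (EE R (R ⧸ Ideal.span {l, q}) 3) := ext_subsingleton_of_pd B.pdH1 (by omega)
    rw [Subsingleton.elim w 0, map_zero]
  obtain ⟨φ, hφ⟩ := _root_.ee_inj (J' := Gam x y a b l q) [l, x, y] B.rs3 (addL_three l x y) (fun r hr => hle (mem3 hr))
  have injA := hA.ee_inj 1 (gradeH B.toBase 1 (by omega))
  let φ' : EE R (R ⧸ Gam x y a b l q) 3 →ₗ[R] (R ⧸ Ideal.span {l, x, y}) := φ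
  let ψ := (φ' ∘ₗ epre f' (R ⧸ (⊥ : Ideal R)) 3) ∘ₗ hA.δ (R ⧸ (⊥ : Ideal R)) 2
  have hψi : Function.Injective (φ' ∘ₗ epre f' (R ⧸ (⊥ : Ideal R)) 3) := hφ.comp inj3
  obtain ⟨pdW, hW⟩ := B.omegaH
  refine omega_pd (epre g _ 2) (epre f _ 2) ψ injA (hA.ex2 2) ?_ (pdX.mono (by omega)) (pdW.mono (by omega))
    (pd_range_two B.ufdQ B.pdQ ψ hW)
  intro z
  rw [← hA.ex1 2 z]
  change (φ' ∘ₗ epre f' (R ⧸ (⊥ : Ideal R)) 3) _ = 0 ↔ _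
  constructor
  · intro h; exact hψi (by rw [h, map_zero])
  · intro h; rw [h, map_zero]

lemma casei_gam (B : Base2 x y a b l q) (hq : q ∉ Ideal.span {l, x, y}) :
    PDLE R (R ⧸ Gam x y a b l q) 4 := by
  set Q := Ideal.span {l, x, y} with hQ
  have hP := B.ufdQ.prime
  have hHQ : HI x y a b ⊔ Ideal.span {l} ≤ Q := sup_le (HI_le.trans p_le_Q) (by
    rw [Ideal.span_singleton_le_iff_mem]; exact l_mem_Q)
  have hle : Gam x y a b l q ≤ Q := by
    intro r hr
    exact (hP.mem_or_mem (hHQ (mem_Gam.1 hr))).resolve_left hq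
  have hl : l ∈ Gam x y a b l q := mem_Gam.2 (Ideal.mul_mem_left _ _ (Ideal.mem_sup_right (Ideal.mem_span_singleton_self l)))
  have hs := ses_ker _ (Submodule.factor_surjective hle)
  refine hs.pd2 ?_ (B.pdQ.mono (by omega))
  obtain ⟨g0, a0, b0, hg0, ha0, hb0, hcop⟩ := B.ufdQ.gcd a b B.abne
  have hne : a0 ∉ Q ∨ b0 ∉ Q := by
    by_contra h
    push Not at h
    rcases B.abne with h1 | h1
    · apply h1; have := Q.add_mem ha0 (Q.mul_mem_left g0 h.1); simpa using this
    · apply h1; have := Q.add_mem hb0 (Q.mul_mem_left g0 h.2); simpa using this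
  obtain ⟨g1, hg1, hg⟩ := prin B.ufdQ hg0 q
  have hx : x ∈ Q := Ideal.subset_span (by simp)
  have hy : y ∈ Q := Ideal.subset_span (by simp)
  let z1 : LinearMap.ker (Submodule.factor hle) := ⟨Submodule.mkQ _ x, (Submodule.Quotient.mk_eq_zero _).2 hx⟩
  let z2 : LinearMap.ker (Submodule.factor hle) := ⟨Submodule.mkQ _ y, (Submodule.Quotient.mk_eq_zero _).2 hy⟩
  refine pd_two_gen Q B.pdQ z1 z2 ?_ (g1 * a0) (g1 * b0) ?_ ?_
  · rintro ⟨z, hz⟩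
    obtain ⟨c, rfl⟩ := Submodule.mkQ_surjective _ z
    have : c ∈ Q := (Submodule.Quotient.mk_eq_zero _).1 hz
    obtain ⟨u, s, t, rfl⟩ := mem_span_three.1 this
    refine ⟨s, t, ?_⟩
    apply Subtype.ext
    refine (Submodule.Quotient.eq _).2 ?_
    have := Ideal.mul_mem_left _ u hl
    convert this using 1
    change u * l + s * x + t * y - (s * x + t * y) = _
    ring
  · intro α β
    have h1 : α • z1 + β • z2 = 0 ↔ α * x + β * y ∈ Gam x y a b l q := by
      rw [Subtype.ext_iff]
      exact Submodule.Quotient.mk_eq_zero _ (x := α * x + β * y)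
    have h2 : q * (α * x + β * y) = (α * q) * x + (β * q) * y := by ring
    rw [h1, mem_Gam, h2, relHl B.rlx B.rly]
    constructor
    · rintro ⟨γ, e1, e2⟩
      have h3 : q * (-β * a0 + α * b0) ∈ Q := by
        have := Q.add_mem (Q.sub_mem (Q.mul_mem_left b0 e1) (Q.mul_mem_left a0 e2))
          (Q.sub_mem (Q.mul_mem_left (γ * b0) ha0) (Q.mul_mem_left (γ * a0) hb0))
        convert this using 1; ring
      obtain ⟨τ', h4, h5⟩ := hcop _ _ ((hP.mem_or_mem h3).resolve_left hq)
      have h6 : (-τ') ∈ Q ⊔ Ideal.span {g1} := by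
        rw [← hg]
        refine ⟨γ, ?_⟩
        rcases hne with h | h
        · refine (hP.mem_or_mem (x := a0) ?_).resolve_left h
          have := Q.add_mem (Q.sub_mem e1 (Q.mul_mem_left q h5)) (Q.mul_mem_left γ ha0)
          convert this using 1; ring
        · refine (hP.mem_or_mem (x := b0) ?_).resolve_left h
          have := Q.add_mem (Q.add_mem e2 (Q.mul_mem_left q h4)) (Q.mul_mem_left γ hb0)
          convert this using 1; ring
      obtain ⟨s, hs⟩ := mem_addI.1 h6
      refine ⟨s, ?_, ?_⟩
      · have := Q.add_mem h5 (Q.mul_mem_left a0 hs)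
        convert this using 1; ring
      · have := Q.sub_mem (Q.mul_mem_left b0 hs) h4
        convert this using 1; ring
    · rintro ⟨s, e1, e2⟩
      obtain ⟨γ, hγ⟩ := (hg (s * g1)).2 (mem_addI.2 ⟨s, by simp⟩)
      refine ⟨γ, ?_, ?_⟩
      · have := Q.sub_mem (Q.add_mem (Q.mul_mem_left q e1) (Q.mul_mem_left a0 hγ)) (Q.mul_mem_left γ ha0)
        convert this using 1; ring
      · have := Q.sub_mem (Q.add_mem (Q.mul_mem_left q e2) (Q.mul_mem_left b0 hγ)) (Q.mul_mem_left γ hb0)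
        convert this using 1; ring
  · intro γ e1 e2
    rcases hne with h | h
    · exact (hP.mem_or_mem e1).resolve_right (fun h' => (hP.mem_or_mem h').elim hg1 h)
    · exact (hP.mem_or_mem e2).resolve_right (fun h' => (hP.mem_or_mem h').elim hg1 h)

theorem casei (B : Base2 x y a b l q) (hq : q ∉ Ideal.span {l, x, y}) :
    GoodK (KK x y a b l q) := by
  refine ⟨B.pdK (B.casei_gam hq), ?_⟩
  have rs4 : RS ⊥ [l, x, y, q] := by
    refine ⟨B.rl, B.rlx, B.rly, ?_, trivial⟩
    have : ⊥ ⊔ Ideal.span {l} ⊔ Ideal.span {x} ⊔ Ideal.span {y} = Ideal.span {l, x, y} := addL_three l x y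
    rw [this]
    exact RegM.of_prime B.ufdQ.prime hq
  set H := HI x y a b with hH
  set H1 := Ideal.span {l, q} with hH1
  set p := Ideal.span {x, y} with hp
  -- grade of R/(H1+H)
  have g4 : GradeGE R (R ⧸ (H1 ⊔ H)) (R ⧸ (⊥ : Ideal R)) 4 := by
    have hle : H1 ⊔ H ≤ H1 ⊔ p := sup_le_sup_left HI_le _
    have hs := ses_ker _ (Submodule.factor_surjective hle)
    have hmem : ∀ r ∈ [l, x, y, q], r ∈ H1 ∨ r ∈ p := by
      intro r hr
      simp only [List.mem_cons, List.not_mem_nil, or_false] at hr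
      rcases hr with rfl | rfl | rfl | rfl
      · left; exact Ideal.subset_span (by simp)
      · right; exact Ideal.subset_span (by simp)
      · right; exact Ideal.subset_span (by simp)
      · left; exact Ideal.subset_span (by simp)
    intro i hi
    refine hs.sub_mid i ?_ ?_
    · refine grade_RS (rs := [l, x, y, q]) rs4 ?_ i hi
      rintro r hr ⟨z, hz⟩
      obtain ⟨c, rfl⟩ := Submodule.mkQ_surjective _ z
      have hc : c ∈ H1 ⊔ p := (Submodule.Quotient.mk_eq_zero _).1 hz
      apply Subtype.ext
      refine (Submodule.Quotient.mk_eq_zero _ (x := r * c)).2 ?_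
      rcases hmem r hr with h | h
      · exact Ideal.mul_mem_right _ _ (Ideal.mem_sup_left h)
      · obtain ⟨c1, h1, c2, h2, rfl⟩ := Submodule.mem_sup.1 hc
        rw [mul_add]
        exact Ideal.add_mem _ (Ideal.mem_sup_left (Ideal.mul_mem_left _ _ h1))
          (Ideal.mem_sup_right (sq_mem_HI h h2))
    · refine grade_RS (rs := [l, x, y, q]) rs4 ?_ i hi
      intro r hr m
      apply smul_quot_zero
      rcases hmem r hr with h | h
      · exact Ideal.mem_sup_left h
      · exact Ideal.mem_sup_right h
  -- the Mayer-Vietoris sequence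
  let f : (R ⧸ KK x y a b l q) →ₗ[R] (R ⧸ H) × (R ⧸ H1) :=
    (Submodule.factor (inf_le_right : KK x y a b l q ≤ H)).prod
      (Submodule.factor (inf_le_left : KK x y a b l q ≤ H1))
  let g : (R ⧸ H) × (R ⧸ H1) →ₗ[R] (R ⧸ (H1 ⊔ H)) :=
    (Submodule.factor (le_sup_right : H ≤ H1 ⊔ H)).coprod
      (-(Submodule.factor (le_sup_left : H1 ≤ H1 ⊔ H)))
  have hs : SES f g := by
    refine ⟨?_, ?_, ?_⟩
    · rw [← LinearMap.ker_eq_bot, LinearMap.ker_eq_bot']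
      intro z
      obtain ⟨c, rfl⟩ := Submodule.mkQ_surjective _ z
      intro hc
      have h := Prod.ext_iff.1 hc
      have e1 : c ∈ H := (Submodule.Quotient.mk_eq_zero _).1 h.1
      have e2 : c ∈ H1 := (Submodule.Quotient.mk_eq_zero _).1 h.2
      exact (Submodule.Quotient.mk_eq_zero _).2 ⟨e2, e1⟩
    · intro z
      obtain ⟨c, rfl⟩ := Submodule.mkQ_surjective _ z
      refine ⟨(Submodule.mkQ _ c, 0), ?_⟩
      simp only [g, LinearMap.coprod_apply, map_zero, add_zero]
      rfl
    · rintro ⟨u, v⟩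
      obtain ⟨α, rfl⟩ := Submodule.mkQ_surjective _ u
      obtain ⟨β, rfl⟩ := Submodule.mkQ_surjective _ v
      have hg : g (Submodule.mkQ _ α, Submodule.mkQ _ β) = Submodule.Quotient.mk (α - β) := by
        simp only [g, LinearMap.coprod_apply, LinearMap.neg_apply, ← sub_eq_add_neg]
        rfl
      rw [hg, Submodule.Quotient.mk_eq_zero]
      constructor
      · intro h
        obtain ⟨c1, h1, c2, h2, e⟩ := Submodule.mem_sup.1 h
        refine ⟨Submodule.mkQ _ (β + c1), Prod.ext ?_ ?_⟩
        · refine (Submodule.Quotient.eq _).2 ?_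
          have : β + c1 - α = -c2 := by rw [← sub_eq_zero]; linear_combination e
          change β + c1 - α ∈ H
          rw [this]; exact H.neg_mem h2
        · refine (Submodule.Quotient.eq _).2 ?_
          change β + c1 - β ∈ H1
          simpa using h1
      · rintro ⟨w, hw⟩
        obtain ⟨c, rfl⟩ := Submodule.mkQ_surjective _ w
        have h := Prod.ext_iff.1 hw
        have e1 : c - α ∈ H := (Submodule.Quotient.eq _).1 h.1
        have e2 : c - β ∈ H1 := (Submodule.Quotient.eq _).1 h.2
        have := Ideal.sub_mem _ (Ideal.mem_sup_left e2 : _ ∈ H1 ⊔ H) (Ideal.mem_sup_right e1 : _ ∈ H1 ⊔ H)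
        convert this using 1; ring
  have i2 : Function.Injective (epre f (R ⧸ (⊥ : Ideal R)) 2) := by
    rw [← LinearMap.ker_eq_bot, LinearMap.ker_eq_bot']
    intro z hz
    obtain ⟨w, rfl⟩ := (hs.ex2 2 z).1 hz
    have := g4 2 (by omega)
    rw [Subsingleton.elim w 0, map_zero]
  have s2 := hs.ee_surj 2 (g4 3 (by omega))
  refine PDLE.of_equiv ?_ (LinearEquiv.ofBijective _ ⟨i2, s2⟩)
  have hp : SES (LinearMap.inl R (R ⧸ H) (R ⧸ H1)) (LinearMap.snd R (R ⧸ H) (R ⧸ H1)) :=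
    ⟨LinearMap.inl_injective, LinearMap.snd_surjective, Function.Exact.inl_snd⟩
  have j2 := hp.ee_inj 1 (gradeH B.toBase 1 (by omega))
  have t2 := hp.ee_surj (N := R ⧸ (⊥ : Ideal R)) 2 (ext_subsingleton_of_pd B.pdH1 (by omega))
  have : SES _ _ := ⟨j2, t2, hp.ex2 2⟩
  exact (this.pd2 B.eeH1 B.omegaH.1).mono (by omega)

end Base2

end cases7

section cases7iii

variable {R : Type} [CommRing R] {x y a b q : R}

lemma RegM.mul {J : Ideal R} {r s : R} (hr : RegM J r) (hs : RegM J s) : RegM J (r * s) := by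
  intro a ha
  exact hs _ (hr _ (by rwa [← mul_assoc]))

open Base2 in
theorem caseiii (B : Base x y a b) (rxq : RegM (⊥ ⊔ Ideal.span {x}) q)
    (hq : q ∉ Ideal.span {x, y}) (rqH : RegM (HI x y a b) q) :
    GoodK (KK x y a b x q) := by
  set p := Ideal.span {x, y} with hp
  have hP := B.ufd.prime
  have hx : x ∈ p := Ideal.subset_span (by simp)
  have hy : y ∈ p := Ideal.subset_span (by simp)
  have hxb : Ideal.span {x} = ⊥ ⊔ Ideal.span {x} := by simp
  by_cases hb : b ∈ p
  · have hxH : x ∈ HI x y a b := by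
      obtain ⟨γ, h1, h2⟩ := B.cop 0 1 (by simpa using hb)
      have := (relH (a := a) (b := b) B.rx B.ry 1 0).2 ⟨-γ, by simpa using h2, by simpa using h1⟩
      simpa using this
    have hK : addL ⊥ [x, q * (y * y)] = KK x y a b x q := by
      rw [addL_two]
      apply le_antisymm
      · rw [Ideal.span_le]
        rintro z (rfl | rfl)
        · exact ⟨Ideal.subset_span (by simp), hxH⟩
        · exact ⟨Ideal.mul_mem_right _ _ (Ideal.subset_span (by simp)), Ideal.mul_mem_left _ _ (sq_mem_HI hy hy)⟩
      · rintro z ⟨h1, h2⟩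
        obtain ⟨α, β, rfl⟩ := Ideal.mem_span_pair.1 h1
        have h3 : q * β ∈ HI x y a b := by
          have := Ideal.sub_mem _ h2 (Ideal.mul_mem_left _ α hxH)
          convert this using 1; ring
        obtain ⟨s, t, u, γ, e⟩ := mem_HI.1 (rqH _ h3)
        obtain ⟨b1, b2, rfl⟩ := Ideal.mem_span_pair.1 hb
        refine Ideal.mem_span_pair.2 ⟨α + q * (s * x + t * y + γ * a + γ * b1 * y), u + γ * b2, ?_⟩
        rw [e]; ring
    have hrs : RS ⊥ [x, q * (y * y)] := ⟨B.rx, rxq.mul (B.ry.mul B.ry), trivial⟩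
    have hpd := pd_RS' _ hrs hK
    obtain ⟨e⟩ := ee_ci _ hrs hK (by
      intro r hr
      rw [← hK, addL_two]
      apply Ideal.subset_span; simpa using hr)
    exact ⟨hpd.mono (by simp), (hpd.of_equiv e.symm).mono (by simp)⟩
  · -- main case
    have hbxq : Ideal.span {x, q * y} = addL ⊥ [x, q * y] := (addL_two _ _).symm
    have hrs : RS ⊥ [x, q * y] := ⟨B.rx, rxq.mul B.ry, trivial⟩
    have hpdD : PDLE R (R ⧸ Ideal.span {x, q * y}) 2 := pd_RS' [x, q * y] hrs (addL_two _ _)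
    obtain ⟨eD⟩ := ee_ci [x, q * y] hrs (addL_two _ _) (by
      intro r hr; apply Ideal.subset_span; simpa using hr)
    obtain ⟨b1, hb1, hg⟩ := prin B.ufd hb q
    set K := KK x y a b x q with hK
    set G := p ⊔ Ideal.span {b1} with hG
    have hA : ∃ (f : (R ⧸ p) →ₗ[R] (R ⧸ K)) (g : (R ⧸ K) →ₗ[R] (R ⧸ (K ⊔ Ideal.span {x}))), SES f g := by
      apply ses_colon _ _ _ x
      · intro r
        constructor
        · intro h
          exact ⟨Ideal.mul_mem_right _ _ (Ideal.subset_span (by simp)), sq_mem_HI hx h⟩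
        · rintro ⟨-, h⟩
          obtain ⟨γ, h1, h2⟩ := (relH (a := a) (b := b) B.rx B.ry r 0).1 (by
            have e : r * x + 0 * y = x * r := by ring
            rw [e]; exact h)
          have h3 : γ * b ∈ p := by simpa using h2
          have h4 := (hP.mem_or_mem h3).resolve_right hb
          have := p.add_mem h1 (p.mul_mem_right a h4)
          simpa using this
      · intro r; exact mem_addI
    have hGm : ∀ r, r ∈ G ↔ q * y * r ∈ K ⊔ Ideal.span {x} := by
      intro r
      rw [← hg]
      constructor
      · rintro ⟨γ, h⟩
        obtain ⟨s, t, h⟩ := Ideal.mem_span_pair.1 h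
        refine mem_addI.2 ⟨-γ * a + s * y, ?_, ?_⟩
        · exact Ideal.mem_span_pair.2 ⟨γ * a - s * y, y * r, by ring⟩
        · refine mem_HI.2 ⟨0, 0, t, γ, ?_⟩
          linear_combination (-y) * h
      · intro h
        obtain ⟨v, -, h⟩ := mem_addI.1 h
        obtain ⟨s, t, u, γ, h⟩ := mem_HI.1 h
        refine ⟨γ, ?_⟩
        have : r * q - u * y - γ * b ∈ ⊥ ⊔ Ideal.span {x} := by
          apply B.ry
          refine mem_addI.2 ⟨v + s * x + t * y + γ * a, ?_⟩
          rw [Ideal.mem_bot]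
          linear_combination h
        rw [← hxb] at this
        have h2 : Ideal.span {x} ≤ p := by rw [Ideal.span_singleton_le_iff_mem]; exact hx
        have := p.add_mem (h2 this) (p.mul_mem_left u hy)
        convert this using 1; ring
    have hB : ∃ (f : (R ⧸ G) →ₗ[R] (R ⧸ (K ⊔ Ideal.span {x})))
        (g : (R ⧸ (K ⊔ Ideal.span {x})) →ₗ[R] (R ⧸ Ideal.span {x, q * y})), SES f g := by
      apply ses_colon _ _ _ (q * y) hGm
      intro r
      constructor
      · intro h
        obtain ⟨s, t, rfl⟩ := Ideal.mem_span_pair.1 h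
        exact ⟨t, mem_addI.2 ⟨s, by ring_nf; exact Ideal.zero_mem _⟩⟩
      · rintro ⟨s, hs⟩
        have : K ⊔ Ideal.span {x} ≤ Ideal.span {x, q * y} := by
          refine sup_le ?_ (Ideal.span_mono (by simp))
          rintro z ⟨h1, h2⟩
          obtain ⟨α, β, rfl⟩ := Ideal.mem_span_pair.1 h1
          have h3 : q * β ∈ p := by
            have := p.sub_mem (HI_le h2) (p.mul_mem_left α hx)
            convert this using 1; ring
          obtain ⟨c, d, rfl⟩ := Ideal.mem_span_pair.1 ((hP.mem_or_mem h3).resolve_left hq)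
          exact Ideal.mem_span_pair.2 ⟨α + q * c, d, by ring⟩
        have h2 := Ideal.add_mem _ (this hs) (Ideal.mul_mem_left _ s
          (Ideal.subset_span (by simp) : q * y ∈ Ideal.span {x, q * y}))
        simpa using h2
    have hpG : PDLE R (R ⧸ G) 3 := pd_add (RegM.of_prime hP hb1) B.pdp
    obtain ⟨f, g, hA⟩ := hA
    obtain ⟨f', g', hB⟩ := hB
    refine ⟨hA.pd2 (B.pdp.mono (by omega)) (hB.pd2 (hpG.mono (by omega)) (hpdD.mono (by omega))), ?_⟩
    have hrs3 : RS ⊥ [x, y, b1] := by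
      refine ⟨B.rx, B.ry, ?_, trivial⟩
      have : ⊥ ⊔ Ideal.span {x} ⊔ Ideal.span {y} = Ideal.span {x, y} := addL_two x y
      rw [this]
      exact RegM.of_prime hP hb1
    have hG3 : addL ⊥ [x, y, b1] = G := by
      change (⊥ ⊔ Ideal.span {x} ⊔ Ideal.span {y}) ⊔ Ideal.span {b1} = _
      have : ⊥ ⊔ Ideal.span {x} ⊔ Ideal.span {y} = Ideal.span {x, y} := addL_two x y
      rw [this]
    have hmG : ∀ r ∈ [x, y, b1], r ∈ G := by
      intro r hr
      simp only [List.mem_cons, List.not_mem_nil, or_false] at hr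
      rcases hr with rfl | rfl | rfl
      · exact Ideal.mem_sup_left hx
      · exact Ideal.mem_sup_left hy
      · exact Ideal.mem_sup_right (Ideal.mem_span_singleton_self _)
    have gG : GradeGE R (R ⧸ G) (R ⧸ (⊥ : Ideal R)) 3 :=
      grade_RS hrs3 (fun r hr m => smul_quot_zero (hmG r hr) m)
    have inj2 := hB.ee_inj 1 (gG 1 (by omega))
    have surj2 : Function.Surjective (epre g' (R ⧸ (⊥ : Ideal R)) 2) := by
      intro z
      have := gG 2 (by omega)
      exact (hB.ex2 2 z).1 (Subsingleton.elim _ _)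
    have pdX : PDLE R (EE R (R ⧸ (K ⊔ Ideal.span {x})) 2) 2 :=
      (hpdD.of_equiv eD.symm).of_equiv (LinearEquiv.ofBijective _ ⟨inj2, surj2⟩)
    have inj3 : Function.Injective (epre f' (R ⧸ (⊥ : Ideal R)) 3) := by
      rw [← LinearMap.ker_eq_bot, LinearMap.ker_eq_bot']
      intro z hz
      obtain ⟨w, rfl⟩ := (hB.ex2 3 z).1 hz
      have : Subsingleton (EE R (R ⧸ Ideal.span {x, q * y}) 3) := ext_subsingleton_of_pd hpdD (by omega)
      rw [Subsingleton.elim w 0, map_zero]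
    obtain ⟨φ, hφ⟩ := ee_inj (J' := G) [x, y, b1] hrs3 hG3 hmG
    have injA := hA.ee_inj (N := R ⧸ (⊥ : Ideal R)) 1 (B.gradeP (fun r hr m => smul_quot_zero hr m) 1 (by omega))
    let φ' : EE R (R ⧸ G) 3 →ₗ[R] (R ⧸ G) := φ
    let ψ := (φ' ∘ₗ epre f' (R ⧸ (⊥ : Ideal R)) 3) ∘ₗ hA.δ (R ⧸ (⊥ : Ideal R)) 2
    have hψi : Function.Injective (φ' ∘ₗ epre f' (R ⧸ (⊥ : Ideal R)) 3) := hφ.comp inj3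
    obtain ⟨ep⟩ := B.eep
    have pdW : PDLE R (EE R (R ⧸ p) 2) 2 := B.pdp.of_equiv ep.symm
    refine omega_pd (epre g _ 2) (epre f _ 2) ψ injA (hA.ex2 2) ?_ (pdX.mono (by omega)) (pdW.mono (by omega)) ?_
    · intro z
      rw [← hA.ex1 2 z]
      change (φ' ∘ₗ epre f' (R ⧸ (⊥ : Ideal R)) 3) _ = 0 ↔ _
      constructor
      · intro h; exact hψi (by rw [h, map_zero])
      · intro h; rw [h, map_zero]
    · -- the range is cyclic
      let w0 := ep.symm (Submodule.mkQ p 1)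
      obtain ⟨h, hh⟩ := Submodule.mkQ_surjective G (ψ w0)
      obtain ⟨c1, hc1, hc⟩ := prin B.ufd hb1 h
      refine PDLE.mono (n := 3) ?_ (by omega)
      refine pd_one_gen (p ⊔ Ideal.span {c1}) (pd_add (RegM.of_prime hP hc1) B.pdp) (ψ.rangeRestrict w0) ?_ ?_
      · rintro ⟨z, w, rfl⟩
        obtain ⟨α, hα⟩ := Submodule.mkQ_surjective p (ep w)
        refine ⟨α, ?_⟩
        apply Subtype.ext
        change ψ w = α • ψ w0
        rw [← map_smul]
        congr 1
        rw [← map_smul, ← map_smul]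
        have : α • (1 : R) = α := by simp
        rw [this, hα, LinearEquiv.symm_apply_apply]
      · intro α
        rw [← hc, Subtype.ext_iff]
        change α • ψ w0 = 0 ↔ _
        rw [← hh, ← map_smul]
        have := Submodule.Quotient.mk_eq_zero G (x := α * h)
        rw [mem_addI] at this
        exact this

end cases7iii

section final8

variable {R : Type} [CommRing R]

lemma pd_I_of_L {f1 f2 f3 : R} (r1 : RegM ⊥ f1) (r2 : RegM (⊥ ⊔ Ideal.span {f1}) f2)
    {L : Ideal R} (hL : ∀ r, r ∈ L ↔ f3 * r ∈ Ideal.span {f1, f2})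
    (h : PDLE R (R ⧸ L) 4) : PDLE R (R ⧸ Ideal.span {f1, f2, f3}) 5 := by
  obtain ⟨f, g, hs⟩ := ses_colon L (Ideal.span {f1, f2}) (Ideal.span {f1, f2, f3}) f3 hL (by
    intro a
    rw [← mem_addI, ← Ideal.span_union]
    have : ({f1, f2, f3} : Set R) = {f1, f2} ∪ {f3} := by
      ext; simp only [Set.mem_insert_iff, Set.mem_singleton_iff, Set.mem_union]; tauto
    rw [this])
  have hC : PDLE R (R ⧸ Ideal.span {f1, f2}) 2 := pd_RS' [f1, f2] ⟨r1, r2, trivial⟩ (addL_two _ _)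
  exact hs.pd3 h (hC.mono (by omega))

lemma pd_L_of_link {f1 f2 : R} (r1 : RegM ⊥ f1) (r2 : RegM (⊥ ⊔ Ideal.span {f1}) f2)
    {L K : Ideal R} (h1 : f1 ∈ K) (h2 : f2 ∈ K)
    (hL : ∀ r, r ∈ L ↔ ∀ c ∈ K, c * r ∈ Ideal.span {f1, f2})
    (h : PDLE R (EE R (R ⧸ K) 2) 3) : PDLE R (R ⧸ L) 4 := by
  set C := Ideal.span {f1, f2} with hC'
  have hrs : RS ⊥ [f1, f2] := ⟨r1, r2, trivial⟩
  have hC : PDLE R (R ⧸ C) 2 := pd_RS' [f1, f2] hrs (addL_two _ _)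
  have hmem : ∀ r ∈ [f1, f2], r ∈ K := by
    intro r hr
    simp only [List.mem_cons, List.not_mem_nil, or_false] at hr
    rcases hr with rfl | rfl <;> assumption
  obtain ⟨e⟩ := ext_RS (M := R ⧸ K) hrs (fun r hr m => smul_quot_zero (hmem r hr) m)
  rw [addL_two] at e
  obtain ⟨f, hf, hsurj⟩ := ext0_inj K (R ⧸ C)
  have hle : C ≤ L := by
    intro r hr
    rw [hL]
    intro c _
    exact C.mul_mem_left c hr
  have hs : SES f (Submodule.factor hle) := by
    refine ⟨hf, Submodule.factor_surjective _, ?_⟩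
    intro z
    obtain ⟨c, rfl⟩ := Submodule.mkQ_surjective _ z
    have e1 : Submodule.factor hle (Submodule.mkQ C c) = 0 ↔ c ∈ L := Submodule.Quotient.mk_eq_zero _
    rw [e1, hL]
    constructor
    · intro hc
      obtain ⟨w, hw⟩ := hsurj (Submodule.mkQ C c) (fun a ha => (Submodule.Quotient.mk_eq_zero _).2 (hc a ha))
      exact ⟨w, hw⟩
    · rintro ⟨w, hw⟩ a ha
      have : a • w = 0 := ext_smul_eq_zero a (fun m => smul_quot_zero ha m) 0 w
      have h3 : a • Submodule.mkQ C c = 0 := by rw [← hw, ← map_smul, this, map_zero]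
      exact (Submodule.Quotient.mk_eq_zero _).1 h3
  exact hs.pd3 (h.of_equiv e.symm) (hC.mono (by omega))

end final8

section resolution

variable {R : Type} [CommRing R]

/-- a finite projective resolution, unbundled -/
structure GoodRes (M : ModuleCat.{0} R) (n : ℕ) where
  C : ChainComplex (ModuleCat.{0} R) ℕ
  p : C.X 0 ⟶ M
  w : C.d 1 0 ≫ p = 0
  proj : ∀ i, Projective (C.X i)
  epi : Epi p
  ex0 : (ShortComplex.mk (C.d 1 0) p w).Exact
  ex : ∀ i, (ShortComplex.mk _ _ (C.d_comp_d (i + 2) (i + 1) i)).Exact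
  zero : ∀ i, n < i → Limits.IsZero (C.X i)

def GoodRes.step {n : ℕ} (S : ShortComplex (ModuleCat.{0} R)) (hS : S.ShortExact)
    (hp : Projective S.X₂) (G : GoodRes S.X₁ n) : GoodRes S.X₃ (n + 1) where
  C := G.C.augment (G.p ≫ S.f) (by rw [← Category.assoc, G.w, Limits.zero_comp])
  p := S.g
  w := by
    change (G.p ≫ S.f) ≫ S.g = 0
    rw [Category.assoc, S.zero, Limits.comp_zero]
  proj := by
    rintro (_ | i)
    · exact hp
    · exact G.proj i
  epi := hS.epi_g
  ex0 := by
    have := G.epi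
    let φ : ShortComplex.mk (G.p ≫ S.f) S.g (by simp [S.zero]) ⟶ S :=
      { τ₁ := G.p, τ₂ := 𝟙 _, τ₃ := 𝟙 _, comm₁₂ := by simp, comm₂₃ := by simp }
    have : Epi φ.τ₁ := G.epi
    have : IsIso φ.τ₂ := by dsimp [φ]; infer_instance
    have : Mono φ.τ₃ := by dsimp [φ]; infer_instance
    exact (ShortComplex.exact_iff_of_epi_of_isIso_of_mono φ).2 hS.exact
  ex := by
    rintro (_ | i)
    · let φ : ShortComplex.mk (G.C.d 1 0) G.p G.w ⟶
        ShortComplex.mk (G.C.d 1 0) (G.p ≫ S.f) (by rw [← Category.assoc, G.w, Limits.zero_comp]) :=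
        { τ₁ := 𝟙 _, τ₂ := 𝟙 _, τ₃ := S.f, comm₁₂ := by simp, comm₂₃ := by simp }
      have : Epi φ.τ₁ := by dsimp [φ]; infer_instance
      have : IsIso φ.τ₂ := by dsimp [φ]; infer_instance
      have : Mono φ.τ₃ := hS.mono_f
      exact (ShortComplex.exact_iff_of_epi_of_isIso_of_mono φ).1 G.ex0
    · exact G.ex i
  zero := by
    rintro (_ | i) hi
    · omega
    · exact G.zero i (by omega)

def GoodRes.base {M : ModuleCat.{0} R} [Projective M] : GoodRes M 0 :=
  let P := ProjectiveResolution.self M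
  { C := P.complex
    p := 𝟙 M
    w := Limits.IsZero.eq_of_src (HomologicalComplex.isZero_single_obj_X _ _ _ _ (by simp)) _ _
    proj := P.projective
    epi := inferInstanceAs (Epi (𝟙 M))
    ex0 := by
      refine (ShortComplex.exact_iff_mono _ ?_).2 ?_
      · exact Limits.IsZero.eq_of_src (HomologicalComplex.isZero_single_obj_X (ComplexShape.down ℕ) 0 M 1 (by simp)) _ _
      · change Mono (𝟙 M)
        infer_instance
    ex := P.exact_succ
    zero := fun i hi => HomologicalComplex.isZero_single_obj_X _ _ _ _ (by omega) }

def GoodRes.toPR {M : ModuleCat.{0} R} {n : ℕ} (G : GoodRes M n) : ProjectiveResolution M where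
  complex := G.C
  projective := G.proj
  π := (ChainComplex.toSingle₀Equiv _ _).symm ⟨G.p, G.w⟩
  quasiIso := ⟨fun n => by
    cases n
    · rw [ChainComplex.quasiIsoAt₀_iff, ShortComplex.quasiIso_iff_of_zeros']
      · refine (ShortComplex.exact_and_epi_g_iff_of_iso ?_).2
          ⟨G.ex0, by dsimp; exact G.epi⟩
        exact ShortComplex.isoMk (Iso.refl _) (Iso.refl _) (Iso.refl _)
          (by simp; exact (Category.id_comp _).trans (Category.comp_id _).symm)
          (by simp; exact (Category.id_comp _).trans (Category.comp_id _).symm)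
      · exact G.C.shape _ _ (by simp)
      all_goals rfl
    · rw [quasiIsoAt_iff_exactAt']
      · rename_i m
        exact ((HomologicalComplex.exactAt_iff' _ (m + 2) (m + 1) m) (by simp only [ChainComplex.prev]; rfl)
          (by simp)).2 (G.ex m)
      · apply ChainComplex.exactAt_succ_single_obj⟩

lemma goodRes_of_pd (n : ℕ) : ∀ (M : ModuleCat.{0} R), HasProjectiveDimensionLE M n →
    Nonempty (GoodRes M n) := by
  induction n with
  | zero =>
    intro M h
    have : Projective M := projective_iff_hasProjectiveDimensionLT_one.2 h
    exact ⟨GoodRes.base⟩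
  | succ n ih =>
    intro M h
    let S : ShortComplex (ModuleCat.{0} R) := ShortComplex.mk (Limits.kernel.ι (Projective.π M)) (Projective.π M) (by simp)
    have hS : S.ShortExact := { exact := ShortComplex.exact_kernel (Projective.π M) }
    have hp : Projective S.X₂ := inferInstanceAs (Projective (Projective.over M))
    have := (hS.hasProjectiveDimensionLT_X₃_iff n hp).1 h
    obtain ⟨G⟩ := ih _ this
    exact ⟨GoodRes.step S hS hp G⟩

theorem exists_res_of_pd (J : Ideal R) (n : ℕ) (h : PDLE R (R ⧸ J) n) :
    ∃ P : ProjectiveResolution (ModuleCat.of R (R ⧸ J)),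
      ∀ i, n < i → Limits.IsZero (P.complex.X i) := by
  obtain ⟨G⟩ := goodRes_of_pd n _ h
  exact ⟨G.toPR, G.zero⟩

end resolution

section heights
variable {R : Type} [CommRing R]

lemma idealHeight_eq (J : Ideal R) : idealHeight J = J.height := by
  have key : ∀ p : {q : Ideal R // q.IsPrime}, Order.height p = p.1.height := by
    intro p
    let e : {q : Ideal R // q.IsPrime} ≃o PrimeSpectrum R :=
      { toFun := fun q => ⟨q.1, q.2⟩
        invFun := fun q => ⟨q.1, q.2⟩
        left_inv := fun _ => rfl
        right_inv := fun _ => rfl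
        map_rel_iff' := Iff.rfl }
    rw [← Order.height_orderIso e p, ← PrimeSpectrum.height_eq_orderHeight]
    rfl
  unfold idealHeight
  apply le_antisymm
  · rw [Ideal.height_eq_inf_minimalPrimes]
    refine le_iInf₂ fun q hq => ?_
    rw [← key ⟨q, hq.1.1⟩]
    exact iInf₂_le (⟨q, hq.1.1⟩ : {q : Ideal R // q.IsPrime}) hq.1.2
  · refine le_iInf₂ fun q hq => ?_
    rw [key]
    exact Ideal.height_mono hq

variable [IsNoetherianRing R]

lemma min_of_height_two {C P : Ideal R} [P.IsPrime] (hC : C.height = 2) (hP : P.height = 2)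
    (h : C ≤ P) : P ∈ C.minimalPrimes :=
  Ideal.mem_minimalPrimes_of_height_le h (by rw [hC, hP])

lemma eq_of_height_two {Q P : Ideal R} (hQ' : Q.IsPrime) (hP' : P.IsPrime) (hQ : Q.height = 2)
    (hP : P.height = 2) (h : Q ≤ P) : Q = P :=
  Ideal.eq_of_le_of_height_le Q h (by rw [hQ, hP])

lemma height_le_two {a b : R} {P : Ideal R} (hP : P ∈ (Ideal.span {a, b}).minimalPrimes) :
    P.height ≤ 2 := by
  refine (Ideal.height_le_card_of_mem_minimalPrimes_span (Set.toFinite _) hP).trans ?_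
  have : ({a, b} : Set R).ncard ≤ 2 := (Set.ncard_insert_le a {b}).trans (by simp)
  exact_mod_cast this

lemma height_one_lt {a : R} {J : Ideal R} (h : J ≤ Ideal.span {a}) (hJ : J.height = 2) : IsUnit a := by
  by_contra hu
  have := (Ideal.height_mono h).trans (Ideal.height_span_singleton_le_one hu)
  rw [hJ] at this
  exact absurd this (by norm_num)

end heights

section coprime
variable {R : Type} [CommRing R] [IsNoetherianRing R] [IsDomain R] [UniqueFactorizationMonoid R]

lemma ne_zero_of_height {f g : R} (h : (Ideal.span {f, g}).height = 2) : f ≠ 0 := by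
  rintro rfl
  have : Ideal.span {0, g} = Ideal.span {g} := by
    rw [Ideal.span_insert]; simp
  rw [this] at h
  have hu := height_one_lt le_rfl h
  rw [Ideal.span_singleton_eq_top.2 hu, Ideal.height_top] at h
  exact absurd h (by simp)

lemma relPrime_of_height {f g : R} (h : (Ideal.span {f, g}).height = 2) : IsRelPrime f g := by
  intro d hf hg
  apply height_one_lt _ h
  rw [Ideal.span_le]
  rintro z (rfl | rfl)
  · exact Ideal.mem_span_singleton.2 hf
  · exact Ideal.mem_span_singleton.2 hg

lemma regM_of_ne_zero {f : R} (h : f ≠ 0) : RegM (⊥ : Ideal R) f := by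
  intro a ha
  rw [Ideal.mem_bot] at *
  exact (mul_eq_zero.1 ha).resolve_left h

lemma regM_of_height {f g : R} (h : (Ideal.span {f, g}).height = 2) :
    RegM (⊥ ⊔ Ideal.span {f}) g := by
  intro a ha
  rw [bot_sup_eq, Ideal.mem_span_singleton] at *
  exact (relPrime_of_height h).dvd_of_dvd_mul_left ha

end coprime

section linforms
variable {k : Type} [Field k] {N : ℕ}

/-- the linear form with given coefficient vector -/
def lf : (Fin N → k) →ₗ[k] MvPolynomial (Fin N) k :=
  Fintype.linearCombination k (X : Fin N → MvPolynomial (Fin N) k)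

lemma lf_apply (c : Fin N → k) : lf c = ∑ i, c i • (X i : MvPolynomial (Fin N) k) := by
  simp [lf, Fintype.linearCombination_apply]

lemma lf_single (j : Fin N) : lf (Pi.single j (1 : k)) = X j := by
  rw [lf_apply, Finset.sum_eq_single j]
  · simp
  · intro b _ hb; simp [Pi.single_eq_of_ne hb]
  · simp

lemma lf_hom (c : Fin N → k) : (lf c).IsHomogeneous 1 := by
  rw [lf_apply]
  apply IsHomogeneous.sum
  intro i _
  rw [smul_eq_C_mul]
  exact isHomogeneous_C_mul_X _ _

lemma exists_lf {f : MvPolynomial (Fin N) k} (hf : f.IsHomogeneous 1) : ∃ c, lf c = f := by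
  rw [← mem_homogeneousSubmodule, homogeneousSubmodule_one_eq_span_X] at hf
  rw [← Fintype.range_linearCombination] at hf
  exact hf

lemma lf_inj : Function.Injective (lf : (Fin N → k) →ₗ[k] MvPolynomial (Fin N) k) := by
  rw [← LinearMap.ker_eq_bot, LinearMap.ker_eq_bot']
  intro c hc
  funext j
  have := congrArg (coeff (Finsupp.single j 1)) hc
  rw [lf_apply, coeff_sum] at this
  simp only [coeff_smul, coeff_X, coeff_zero, smul_eq_mul] at this
  rw [Finset.sum_eq_single j] at this
  · simpa using this
  · intro b _ hb
    rw [if_neg]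
    · simp
    · intro h
      exact hb (Finsupp.single_left_injective one_ne_zero h)
  · simp

/-- linear change of coordinates -/
lemma exists_equiv {ι : Type} [Fintype ι] (b : Module.Basis ι k (Fin N → k)) :
    ∃ Ψ : MvPolynomial ι k ≃ₐ[k] MvPolynomial (Fin N) k, ∀ i, Ψ (X i) = lf (b i) := by
  classical
  let F : MvPolynomial ι k →ₐ[k] MvPolynomial (Fin N) k := aeval fun i => lf (b i)
  let L : (Fin N → k) →ₗ[k] MvPolynomial ι k := b.constr k (fun i => (X i : MvPolynomial ι k))
  let G : MvPolynomial (Fin N) k →ₐ[k] MvPolynomial ι k := aeval fun j => L (Pi.single j 1)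
  have hG : ∀ c, G (lf c) = L c := by
    intro c
    have : G.toLinearMap ∘ₗ lf = L := by
      apply LinearMap.pi_ext'
      intro j
      ext
      simp [G, lf_single]
    exact congrArg (fun f => f c) this
  have hF : ∀ c, F (L c) = lf c := by
    intro c
    have : F.toLinearMap ∘ₗ L = lf := by
      apply b.ext
      intro i
      simp [F, L]
    exact congrArg (fun f => f c) this
  refine ⟨AlgEquiv.ofAlgHom F G ?_ ?_, ?_⟩
  · apply algHom_ext
    intro j
    simp only [AlgHom.comp_apply, AlgHom.id_apply]
    rw [← lf_single j, hG, hF]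
  · apply algHom_ext
    intro i
    simp only [AlgHom.comp_apply, AlgHom.id_apply]
    rw [show F (X i) = lf (b i) by simp [F], hG]
    simp [L]
  · intro i
    simp [F]

/-- extension of independent linear forms to coordinates -/
lemma exists_ext_equiv {m : ℕ} (c : Fin m → (Fin N → k)) (hc : LinearIndependent k c) :
    m ≤ N ∧ ∃ (θ : Fin (N - m) → (Fin N → k))
      (Ψ : MvPolynomial (Fin m ⊕ Fin (N - m)) k ≃ₐ[k] MvPolynomial (Fin N) k),
      (∀ i, Ψ (X (Sum.inl i)) = lf (c i)) ∧ (∀ i, Ψ (X (Sum.inr i)) = lf (θ i)) := by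
  classical
  let b0 := Module.Basis.sumExtend hc
  have hfin : Finite (Module.Basis.sumExtendIndex hc) := by
    have : Finite (Fin m ⊕ Module.Basis.sumExtendIndex hc) := Module.Finite.finite_basis b0
    exact Finite.of_injective (Sum.inr : _ → Fin m ⊕ Module.Basis.sumExtendIndex hc) Sum.inr_injective
  have hfin' : Fintype (Module.Basis.sumExtendIndex hc) := Fintype.ofFinite _
  have hcard : m + Fintype.card (Module.Basis.sumExtendIndex hc) = N := by
    have := Module.finrank_eq_card_basis b0
    rw [Fintype.card_sum, Module.finrank_fin_fun, Fintype.card_fin] at this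
    omega
  have hm : m ≤ N := by omega
  refine ⟨hm, ?_⟩
  let e : Module.Basis.sumExtendIndex hc ≃ Fin (N - m) :=
    Fintype.equivFinOfCardEq (by omega)
  let b := b0.reindex (Equiv.sumCongr (Equiv.refl (Fin m)) e)
  obtain ⟨Ψ, hΨ⟩ := exists_equiv b
  refine ⟨fun i => b (Sum.inr i), Ψ, fun i => ?_, fun i => hΨ _⟩
  rw [hΨ]
  congr 1
  simp only [b, b0, Module.Basis.sumExtend, Module.Basis.reindex_apply, Equiv.sumCongr_symm,
    Equiv.sumCongr_apply, Sum.map_inl, Equiv.refl_symm, Equiv.refl_apply]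
  simp
  rfl

lemma coord_proj {m : ℕ} (c : Fin m → (Fin N → k)) (hc : LinearIndependent k c) :
    m ≤ N ∧ ∃ (θ : Fin (N - m) → MvPolynomial (Fin N) k)
      (π : MvPolynomial (Fin N) k →ₐ[k] MvPolynomial (Fin (N - m)) k),
      (∀ j, (θ j).IsHomogeneous 1) ∧ (∀ s, π (aeval θ s) = s) ∧
      (∀ r, π r = 0 ↔ r ∈ Ideal.span (Set.range fun i => lf (c i))) := by
  obtain ⟨hm, θ, Ψ, h1, h2⟩ := exists_ext_equiv c hc
  let E : MvPolynomial (Fin m ⊕ Fin (N - m)) k →ₐ[k] MvPolynomial (Fin (N - m)) k :=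
    aeval (Sum.elim (fun _ => 0) X)
  let T : MvPolynomial (Fin (N - m)) k →ₐ[k] MvPolynomial (Fin N) k := aeval fun i => lf (θ i)
  have hET : ∀ s, E (Ψ.symm (T s)) = s := by
    intro s
    induction s using MvPolynomial.induction_on with
    | C a => rw [← algebraMap_eq, AlgHom.commutes, ← AlgEquiv.commutes Ψ, AlgEquiv.symm_apply_apply, AlgHom.commutes]
    | add p q hp hq => rw [map_add, map_add, map_add, hp, hq]
    | mul_X p i hp =>
      rw [map_mul, map_mul, map_mul, hp]
      congr 1
      simp only [T, aeval_X]
      rw [← h2 i]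
      simp [E]
  set J := Ideal.span (Set.range fun i => lf (c i)) with hJ
  have hTE : ∀ z, Ψ z - T (E z) ∈ J := by
    intro z
    induction z using MvPolynomial.induction_on with
    | C a =>
      rw [← algebraMap_eq, AlgHom.commutes, AlgEquiv.commutes, AlgHom.commutes, sub_self]
      exact J.zero_mem
    | add p q hp hq =>
      simp only [map_add]
      convert J.add_mem hp hq using 1
      ring
    | mul_X p i hp =>
      simp only [map_mul]
      have h3 : Ψ (X i) - T (E (X i)) ∈ J := by
        rcases i with i | i
        · rw [h1]
          simp only [E, aeval_X, Sum.elim_inl, map_zero, sub_zero]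
          exact Ideal.subset_span ⟨i, rfl⟩
        · rw [h2]
          simp [E, T]
      convert J.add_mem (J.mul_mem_left (Ψ p) h3) (J.mul_mem_left (T (E (X i))) hp) using 1
      ring
  obtain ⟨π, hπ⟩ : ∃ π : MvPolynomial (Fin N) k →ₐ[k] MvPolynomial (Fin (N - m)) k,
      ∀ r, π r = E (Ψ.symm r) := ⟨E.comp Ψ.symm.toAlgHom, fun _ => rfl⟩
  refine ⟨hm, fun i => lf (θ i), π, fun j => lf_hom _, fun s => (hπ _).trans (hET s), ?_⟩
  intro r
  constructor
  · intro h
    have := hTE (Ψ.symm r)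
    rw [← hπ, h, AlgEquiv.apply_symm_apply, map_zero, sub_zero] at this
    exact this
  · intro h
    have : J ≤ RingHom.ker π := by
      rw [hJ, Ideal.span_le]
      rintro _ ⟨i, rfl⟩
      change π (lf (c i)) = 0
      rw [hπ, ← h1 i, AlgEquiv.symm_apply_apply]
      simp [E]
    exact this h

lemma ufdi_of_surj {R T : Type} [CommRing R] [CommRing T] [IsDomain T] [UniqueFactorizationMonoid T]
    (π : R →+* T) (hπ : Function.Surjective π) (J : Ideal R) (hJ : ∀ r, π r = 0 ↔ r ∈ J) :
    UFDI J := by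
  have hk : RingHom.ker π = J := by ext r; exact hJ r
  refine ⟨hk ▸ RingHom.ker_isPrime π, ?_⟩
  have key : ∀ a b, π a ≠ 0 → ∃ g a' b', g ∉ J ∧ a - g * a' ∈ J ∧ b - g * b' ∈ J ∧ Cop J a' b' := by
    intro a b ha
    obtain ⟨a', b', g, hrel, h1, h2⟩ :=
      UniqueFactorizationMonoid.exists_reduced_factors (π a) ha (π b)
    obtain ⟨a'', rfl⟩ := hπ a'
    obtain ⟨b'', rfl⟩ := hπ b'
    obtain ⟨g', rfl⟩ := hπ g
    refine ⟨g', a'', b'', ?_, ?_, ?_, ?_⟩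
    · intro h
      rw [← hJ] at h
      rw [h, zero_mul] at h1
      exact ha h1.symm
    · rw [← hJ, map_sub, map_mul, h1, sub_self]
    · rw [← hJ, map_sub, map_mul, h2, sub_self]
    · intro α β h
      rw [← hJ, map_add, map_mul, map_mul] at h
      have ha'' : π a'' ≠ 0 := by
        intro h0
        rw [h0, mul_zero] at h1
        exact ha h1.symm
      have h3 : π a'' ∣ π β * π b'' := ⟨-π α, by linear_combination h⟩
      have h4 : π a'' ∣ π β := hrel.dvd_of_dvd_mul_right h3
      obtain ⟨γ, hγ⟩ := h4
      obtain ⟨γ, rfl⟩ := hπ γ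
      refine ⟨-γ, ?_, ?_⟩
      · rw [← hJ, map_sub, map_mul, map_neg]
        apply mul_left_cancel₀ ha''
        rw [hγ] at h
        linear_combination h
      · rw [← hJ, map_add, map_mul, map_neg, hγ]
        ring
  intro a b hab
  by_cases ha : π a = 0
  · have hb : π b ≠ 0 := by
      intro hb
      rcases hab with h | h
      · exact h ((hJ a).1 ha)
      · exact h ((hJ b).1 hb)
    obtain ⟨g, b', a', h1, h2, h3, h4⟩ := key b a hb
    refine ⟨g, a', b', h1, h3, h2, ?_⟩
    intro α β h
    obtain ⟨γ, h5, h6⟩ := h4 β α (by rwa [add_comm])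
    refine ⟨-γ, ?_, ?_⟩
    · convert h6 using 1; ring
    · convert h5 using 1; ring
  · exact key a b ha

lemma ufdi_lf {m : ℕ} (c : Fin m → (Fin N → k)) (hc : LinearIndependent k c) :
    UFDI (Ideal.span (Set.range fun i => lf (c i))) := by
  obtain ⟨hm, θ, π, h1, h2, h3⟩ := coord_proj c hc
  exact ufdi_of_surj π.toRingHom (fun s => ⟨_, h2 s⟩) _ h3

lemma comp_one_mul (r l : MvPolynomial (Fin N) k) (hl : l.IsHomogeneous 1) :
    homogeneousComponent 1 (r * l) = constantCoeff r • l := by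
  have hd : r * l = ∑ i ∈ Finset.range (r.totalDegree + 1), homogeneousComponent i r * l := by
    rw [← Finset.sum_mul, sum_homogeneousComponent]
  rw [hd, map_sum, Finset.sum_eq_single 0]
  · rw [homogeneousComponent_zero]
    rw [homogeneousComponent_of_mem (m := 1), if_pos rfl, smul_eq_C_mul]
    · rfl
    · rw [← smul_eq_C_mul]
      exact (homogeneousSubmodule _ _ _).smul_mem _ hl
  · intro b _ hb
    rw [homogeneousComponent_of_mem ((homogeneousComponent_isHomogeneous b r).mul hl),
      if_neg (by omega)]
  · simp

lemma lf_mem_span {m : ℕ} (c : Fin m → (Fin N → k)) (c' : Fin N → k)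
    (h : lf c' ∈ Ideal.span (Set.range fun i => lf (c i))) :
    c' ∈ Submodule.span k (Set.range c) := by
  obtain ⟨r, hr⟩ := (Ideal.mem_span_range_iff_exists_fun).1 h
  have := congrArg (homogeneousComponent 1) hr
  rw [homogeneousComponent_of_mem (lf_hom c'), if_pos rfl, map_sum] at this
  simp_rw [comp_one_mul _ _ (lf_hom _), ← map_smul, ← map_sum] at this
  rw [← lf_inj this]
  exact Submodule.sum_mem _ fun i _ => Submodule.smul_mem _ _ (Submodule.subset_span ⟨i, rfl⟩)

end linforms

section coords
variable {k : Type} [Field k]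

lemma hom_scale {σ A : Type} [CommRing A] [Algebra k A] {f : MvPolynomial σ k} {e : ℕ}
    (hf : f.IsHomogeneous e) (g : σ → A) (r : A) :
    aeval (fun i => r * g i) f = r ^ e * aeval g f := by
  rw [aeval_def, aeval_def, eval₂_eq, eval₂_eq, Finset.mul_sum]
  refine Finset.sum_congr rfl fun d hd => ?_
  have hdeg := hf.degree_eq_sum_deg_support hd
  simp_rw [mul_pow, Finset.prod_mul_distrib, Finset.prod_pow_eq_pow_sum]
  rw [show ∑ i ∈ d.support, d i = e from hdeg.symm]
  ring

lemma shear {n e : ℕ} [Infinite k] (f : MvPolynomial (Fin (n+1)) k) (hf : f ≠ 0)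
    (he : f.IsHomogeneous e) :
    ∃ φ : MvPolynomial (Fin (n+1)) k ≃ₐ[k] Polynomial (MvPolynomial (Fin n) k),
      (∃ c : k, c ≠ 0 ∧ ∃ F : Polynomial (MvPolynomial (Fin n) k), F.Monic ∧
        φ f = Polynomial.C (C c) * F) ∧
      (φ.symm Polynomial.X).IsHomogeneous 1 ∧
      ∀ i, (φ.symm (Polynomial.C (X i))).IsHomogeneous 1 := by
  obtain ⟨a0, ha0⟩ : ∃ a0 : Fin (n+1) → k, eval a0 (f * X 0) ≠ 0 := by
    by_contra! h
    have : f * X 0 = 0 := MvPolynomial.funext (by simpa using h)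
    rcases mul_eq_zero.1 this with h | h
    · exact hf h
    · exact X_ne_zero _ h
  have h00 : a0 0 ≠ 0 := by
    intro h; apply ha0; simp [h]
  have hfa : eval a0 f ≠ 0 := by
    intro h; apply ha0; simp [h]
  let a : Fin n → k := fun i => a0 i.succ / a0 0
  let sh : (Fin n → k) → Fin (n+1) → MvPolynomial (Fin (n+1)) k := fun a =>
    Fin.cons (X 0) (fun i => X i.succ + C (a i) * X 0)
  have hsh : ∀ a i, (sh a i).IsHomogeneous 1 := by
    intro a i
    refine Fin.cases ?_ (fun i => ?_) i
    · exact isHomogeneous_X _ _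
    · exact (isHomogeneous_X _ _).add (isHomogeneous_C_mul_X _ _)
  have hinv : ∀ a, (aeval (sh a)).comp (aeval (sh (-a))) = AlgHom.id k (MvPolynomial (Fin (n+1)) k) := by
    intro a
    apply algHom_ext
    intro i
    rw [AlgHom.comp_apply, aeval_X]
    refine Fin.cases ?_ (fun i => ?_) i
    · change aeval (sh a) (X 0) = X 0
      rw [aeval_X]; rfl
    · change aeval (sh a) (X i.succ + C ((-a) i) * X 0) = X i.succ
      rw [map_add, map_mul, aeval_X, aeval_X, aeval_C]
      change X i.succ + C (a i) * X 0 + C (- a i) * X 0 = _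
      rw [C_neg]; ring
  let σ : MvPolynomial (Fin (n+1)) k ≃ₐ[k] MvPolynomial (Fin (n+1)) k :=
    AlgEquiv.ofAlgHom (aeval (sh a)) (aeval (sh (-a))) (hinv a) (by simpa using hinv (-a))
  have hσs : ∀ z, σ.symm z = aeval (sh (-a)) z := fun _ => rfl
  refine ⟨σ.trans (finSuccEquiv k n), ?_, ?_, ?_⟩
  · set g := σ f with hg
    have hgh : g.IsHomogeneous e := by
      have := he.aeval (sh a) (hsh a)
      rwa [one_mul] at this
    have hge : eval (Fin.cons 1 0) g ≠ 0 := by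
      intro h
      apply hfa
      have h1 : eval (Fin.cons 1 0) g = aeval (Fin.cons 1 a : Fin (n+1) → k) f := by
        change eval (Fin.cons 1 0) (aeval (sh a) f) = _
        rw [← coe_aeval_eq_eval, RingHom.coe_coe, ← AlgHom.comp_apply]
        congr 1
        apply algHom_ext
        intro i
        rw [AlgHom.comp_apply, aeval_X, aeval_X]
        refine Fin.cases ?_ (fun i => ?_) i
        · simp [sh]
        · simp [sh]
      have h2 := hom_scale he (Fin.cons 1 a : Fin (n+1) → k) (a0 0)
      have h3 : (fun i => a0 0 * (Fin.cons 1 a : Fin (n+1) → k) i) = a0 := by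
        funext i
        refine Fin.cases ?_ (fun i => ?_) i
        · simp
        · simp [a]; field_simp
      rw [h3, ← h1, h, mul_zero] at h2
      rwa [← coe_aeval_eq_eval]
    set F := finSuccEquiv k n g with hF
    have hco : (F.coeff e).IsHomogeneous 0 := hgh.finSuccEquiv_coeff_isHomogeneous e 0 (by simp)
    obtain ⟨c, hc⟩ : ∃ c, F.coeff e = C c :=
      ⟨_, totalDegree_eq_zero_iff_eq_C.1 (Nat.le_zero.1 hco.totalDegree_le)⟩
    have hnd : F.natDegree ≤ e := by
      rw [hF, natDegree_finSuccEquiv]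
      exact (degreeOf_le_totalDegree _ _).trans hgh.totalDegree_le
    have hc0 : c ≠ 0 := by
      rintro rfl
      apply hge
      rw [eval_eq_eval_mv_eval', ← hF]
      have : Polynomial.map (eval 0) F = 0 := by
        ext i
        rw [Polynomial.coeff_map, Polynomial.coeff_zero]
        rcases lt_trichotomy i e with h | h | h
        · have := hgh.finSuccEquiv_coeff_isHomogeneous i (e - i) (by omega)
          rw [← hF] at this
          rw [show (eval 0 : MvPolynomial (Fin n) k →+* k) = constantCoeff by
            ext <;> simp]
          rw [constantCoeff_eq]
          apply this.coeff_eq_zero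
          simp; omega
        · rw [h, hc]; simp
        · rw [Polynomial.coeff_eq_zero_of_natDegree_lt (by omega)]; simp
      rw [this]; simp
    refine ⟨c, hc0, Polynomial.C (C c⁻¹) * F, ?_, ?_⟩
    · have : F.natDegree = e := by
        apply le_antisymm hnd
        apply Polynomial.le_natDegree_of_ne_zero
        rw [hc]; simpa using hc0
      rw [Polynomial.Monic, Polynomial.leadingCoeff_mul, Polynomial.leadingCoeff_C,
        Polynomial.leadingCoeff, this, hc, ← C_mul, inv_mul_cancel₀ hc0, C_1]
    · change F = _
      rw [← mul_assoc, ← Polynomial.C_mul, ← C_mul, mul_inv_cancel₀ hc0]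
      simp
  · rw [AlgEquiv.symm_trans_apply, ← finSuccEquiv_X_zero, AlgEquiv.symm_apply_apply, hσs, aeval_X]
    exact hsh _ _
  · intro i
    rw [AlgEquiv.symm_trans_apply, ← finSuccEquiv_X_succ, AlgEquiv.symm_apply_apply, hσs, aeval_X]
    exact hsh _ _

/-- graded algebra maps commute with homogeneous components -/
lemma comp_aeval {m n : ℕ} (θ : Fin m → MvPolynomial (Fin n) k) (hθ : ∀ i, (θ i).IsHomogeneous 1)
    (s : MvPolynomial (Fin m) k) (i : ℕ) :
    homogeneousComponent i (aeval θ s) = aeval θ (homogeneousComponent i s) := by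
  have h1 : ∀ j, (aeval θ (homogeneousComponent j s)).IsHomogeneous j := by
    intro j
    have := (homogeneousComponent_isHomogeneous j s).aeval θ hθ
    rwa [one_mul] at this
  conv_lhs => rw [← sum_homogeneousComponent s, map_sum, map_sum]
  by_cases hi : i ∈ Finset.range (s.totalDegree + 1)
  · rw [Finset.sum_eq_single_of_mem i hi]
    · rw [homogeneousComponent_of_mem (h1 i), if_pos rfl]
    · intro j _ hj
      rw [homogeneousComponent_of_mem (h1 j), if_neg hj.symm]
  · rw [homogeneousComponent_eq_zero _ _ (by simpa using hi), map_zero]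
    apply Finset.sum_eq_zero
    intro j hj
    rw [homogeneousComponent_of_mem (h1 j), if_neg]
    rintro rfl; exact hi hj

end coords

/-- closed under taking homogeneous components -/
def CompCl {k : Type} [Field k] {N : ℕ} (J : Ideal (MvPolynomial (Fin N) k)) : Prop :=
  ∀ r ∈ J, ∀ i, homogeneousComponent i r ∈ J

section A11
variable {k : Type} [Field k]

attribute [local instance] MvPolynomial.gradedAlgebra

lemma comp_mul_hom {N : ℕ} {f : MvPolynomial (Fin N) k} {e : ℕ} (hf : f.IsHomogeneous e)
    (a : MvPolynomial (Fin N) k) (i : ℕ) :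
    f ∣ homogeneousComponent i (a * f) := by
  rw [← sum_homogeneousComponent a, Finset.sum_mul, map_sum]
  refine Finset.dvd_sum fun j _ => ?_
  have h : (homogeneousComponent j a * f).IsHomogeneous (j + e) :=
    (homogeneousComponent_isHomogeneous j a).mul hf
  rw [homogeneousComponent_of_mem h]
  split_ifs
  · exact dvd_mul_left _ _
  · exact dvd_zero _

lemma compCl_iff {N : ℕ} (J : Ideal (MvPolynomial (Fin N) k)) :
    CompCl J ↔ Ideal.IsHomogeneous (homogeneousSubmodule (Fin N) k) J := by
  have h : ∀ i (r : MvPolynomial (Fin N) k),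
      (DirectSum.decompose (homogeneousSubmodule (Fin N) k) r i : MvPolynomial (Fin N) k)
        = homogeneousComponent i r := fun i r => decomposition.decompose'_apply r i
  constructor
  · intro hJ i r hr
    rw [h]; exact hJ r hr i
  · intro hJ r hr i
    rw [← h]; exact hJ i hr

lemma CompCl.span {N : ℕ} (S : Set (MvPolynomial (Fin N) k)) (hS : ∀ f ∈ S, ∃ e, f.IsHomogeneous e) :
    CompCl (Ideal.span S) := by
  rw [compCl_iff]
  exact Ideal.homogeneous_span _ _ fun f hf => hS f hf

lemma CompCl.minimal {N : ℕ} {J P : Ideal (MvPolynomial (Fin N) k)} (hJ : CompCl J)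
    (hP : P ∈ J.minimalPrimes) : CompCl P := by
  rw [compCl_iff] at hJ ⊢
  have hp : P.IsPrime := hP.1.1
  have h1 : (P.homogeneousCore (homogeneousSubmodule (Fin N) k)).toIdeal ≤ P :=
    Ideal.toIdeal_homogeneousCore_le _ _
  have h2 := hP.2 (y := (P.homogeneousCore (homogeneousSubmodule (Fin N) k)).toIdeal)
    ⟨hp.homogeneousCore, ?_⟩ h1
  · rw [le_antisymm h2 h1]
    exact (P.homogeneousCore (homogeneousSubmodule (Fin N) k)).isHomogeneous
  · have := Ideal.homogeneousCore_mono (homogeneousSubmodule (Fin N) k) hP.1.2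
    have h3 : ((J.homogeneousCore (homogeneousSubmodule (Fin N) k)).toIdeal) = J :=
      hJ.toIdeal_homogeneousCore_eq_self
    rw [← h3]
    exact this

lemma exists_elim {S : Type} [CommRing S] [IsDomain S] (F f2 : Polynomial S) (hF : F.Monic)
    (h2 : RegM (Ideal.span {F}) f2) :
    ∃ ρ : S, ρ ≠ 0 ∧ Polynomial.C ρ ∈ Ideal.span {F, f2} := by
  let A := Polynomial S ⧸ Ideal.span {F}
  let f : S →+* A := (Ideal.Quotient.mk _).comp Polynomial.C
  let r : A := Ideal.Quotient.mk _ f2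
  have hinteg : f.IsIntegralElem r := by
    have : Algebra.IsIntegral S (AdjoinRoot F) := by
      have := hF.finite_adjoinRoot
      infer_instance
    exact this.isIntegral r
  obtain ⟨p, hp, hpr⟩ := hinteg
  obtain ⟨i, hi, hm⟩ := Ideal.exists_coeff_ne_zero_mem_comap_of_non_zero_divisor_root_mem
    (f := f) (I := Ideal.span {r}) (r := r) (p := p)
    (by
      intro x hx
      obtain ⟨x, rfl⟩ := Ideal.Quotient.mk_surjective x
      rw [← map_mul, Ideal.Quotient.eq_zero_iff_mem, mul_comm] at hx
      exact Ideal.Quotient.eq_zero_iff_mem.2 (h2 x hx))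
    (Ideal.subset_span rfl) hp.ne_zero hpr
  refine ⟨p.coeff i, hi, ?_⟩
  rw [Ideal.mem_comap, Ideal.mem_span_singleton'] at hm
  obtain ⟨a, ha⟩ := hm
  obtain ⟨a, rfl⟩ := Ideal.Quotient.mk_surjective a
  have : Ideal.Quotient.mk (Ideal.span {F}) (Polynomial.C (p.coeff i) - a * f2) = 0 := by
    rw [map_sub, map_mul, sub_eq_zero]; exact ha.symm
  rw [Ideal.Quotient.eq_zero_iff_mem, Ideal.mem_span_singleton'] at this
  obtain ⟨b, hb⟩ := this
  rw [Ideal.mem_span_pair]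
  exact ⟨b, a, by rw [hb]; ring⟩


lemma coords [Infinite k] {d e1 e2 : ℕ} (f1 f2 : MvPolynomial (Fin (d+2)) k) (h1 : f1 ≠ 0)
    (hf1 : f1.IsHomogeneous e1) (hf2 : f2.IsHomogeneous e2) (hr : RegM (Ideal.span {f1}) f2) :
    ∃ Φ : Polynomial (Polynomial (MvPolynomial (Fin d) k)) ≃ₐ[k] MvPolynomial (Fin (d+2)) k,
      (Φ Polynomial.X).IsHomogeneous 1 ∧ (Φ (Polynomial.C Polynomial.X)).IsHomogeneous 1 ∧
      (∀ i, (Φ (Polynomial.C (Polynomial.C (X i)))).IsHomogeneous 1) ∧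
      (∃ F : Polynomial (Polynomial (MvPolynomial (Fin d) k)), F.Monic ∧
        Ideal.span {Φ F} = Ideal.span {f1}) ∧
      (∃ ρ : Polynomial (MvPolynomial (Fin d) k), ρ.Monic ∧
        Φ (Polynomial.C ρ) ∈ Ideal.span {f1, f2}) := by
  obtain ⟨φ, ⟨c, hc, F, hF, hφf⟩, hX, hC⟩ := shear f1 h1 hf1
  have hF1 : F ∈ Ideal.span {φ f1} := by
    rw [Ideal.mem_span_singleton']
    refine ⟨Polynomial.C (C c⁻¹), ?_⟩
    rw [hφf, ← mul_assoc, ← map_mul, ← map_mul, inv_mul_cancel₀ hc]; simp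
  have hreg : RegM (Ideal.span {F}) (φ f2) := by
    intro a ha
    rw [Ideal.mem_span_singleton'] at ha
    obtain ⟨b, hb⟩ := ha
    rw [Ideal.mem_span_singleton'] at hF1
    obtain ⟨g, hg⟩ := hF1
    have : f2 * φ.symm a ∈ Ideal.span {f1} := by
      rw [Ideal.mem_span_singleton']
      refine ⟨φ.symm (b * g), φ.injective ?_⟩
      simp only [map_mul, AlgEquiv.apply_symm_apply]
      rw [← hb, ← hg]
      ring
    have := hr _ this
    rw [Ideal.mem_span_singleton'] at this ⊢
    obtain ⟨s, hs⟩ := this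
    refine ⟨φ s * Polynomial.C (C c), ?_⟩
    rw [mul_assoc, ← hφf, ← map_mul, hs, AlgEquiv.apply_symm_apply]
  obtain ⟨ρ, hρ, hρC⟩ := exists_elim F (φ f2) hF hreg
  set θ : Fin (d+1) → MvPolynomial (Fin (d+2)) k := fun i => φ.symm (Polynomial.C (X i)) with hθ
  have haev : ∀ s, φ.symm (Polynomial.C s) = aeval θ s := by
    intro s
    have : (φ.symm.toAlgHom.comp (Polynomial.CAlgHom : MvPolynomial (Fin (d+1)) k →ₐ[k] _)) = aeval θ := by
      apply algHom_ext
      intro i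
      simp [hθ]
    exact congrArg (fun f : _ →ₐ[k] _ => f s) this
  have hmem : aeval θ ρ ∈ Ideal.span {f1, f2} := by
    rw [← haev]
    rw [Ideal.mem_span_pair] at hρC ⊢
    obtain ⟨a, b, hab⟩ := hρC
    rw [Ideal.mem_span_singleton'] at hF1
    obtain ⟨g, hg⟩ := hF1
    refine ⟨φ.symm (a * g), φ.symm b, φ.injective ?_⟩
    simp only [map_add, map_mul, AlgEquiv.apply_symm_apply]
    rw [← hab, ← hg]
    ring
  obtain ⟨i, hi⟩ : ∃ i, homogeneousComponent i ρ ≠ 0 := by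
    by_contra! h
    apply hρ
    rw [← sum_homogeneousComponent ρ]
    exact Finset.sum_eq_zero fun j _ => h j
  have hcl : CompCl (Ideal.span {f1, f2}) := CompCl.span _ (by
    rintro f (rfl | rfl)
    · exact ⟨_, hf1⟩
    · exact ⟨_, hf2⟩)
  have hmem' := hcl _ hmem i
  rw [comp_aeval θ hC] at hmem'
  obtain ⟨ψ, ⟨c', hc', G, hG, hψ⟩, hX', hC'⟩ := shear _ hi (homogeneousComponent_isHomogeneous i ρ)
  let Φ : Polynomial (Polynomial (MvPolynomial (Fin d) k)) ≃ₐ[k] MvPolynomial (Fin (d+2)) k :=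
    (Polynomial.mapAlgEquiv ψ.symm).trans φ.symm
  have hΦC : ∀ z, Φ (Polynomial.C z) = aeval θ (ψ.symm z) := by
    intro z
    rw [← haev]
    change φ.symm (Polynomial.map _ (Polynomial.C z)) = _
    rw [Polynomial.map_C]; rfl
  refine ⟨Φ, ?_, ?_, ?_, ⟨F.map (ψ : _ →+* _), hF.map _, ?_⟩, ⟨G, hG, ?_⟩⟩
  · change (φ.symm (Polynomial.map _ Polynomial.X)).IsHomogeneous 1
    rw [Polynomial.map_X]; exact hX
  · rw [hΦC]; simpa using hX'.aeval θ hC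
  · intro i
    rw [hΦC]; simpa using (hC' i).aeval θ hC
  · have : Φ (F.map (ψ : _ →+* _)) = φ.symm F := by
      change φ.symm (Polynomial.map _ _) = _
      rw [Polynomial.map_map]
      congr 1
      convert Polynomial.map_id
      ext x
      · simp
      · simp
    rw [this]
    apply le_antisymm
    · rw [Ideal.span_singleton_le_iff_mem, Ideal.mem_span_singleton']
      rw [Ideal.mem_span_singleton'] at hF1
      obtain ⟨g, hg⟩ := hF1
      exact ⟨φ.symm g, φ.injective (by simp [hg])⟩
    · rw [Ideal.span_singleton_le_iff_mem, Ideal.mem_span_singleton']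
      exact ⟨φ.symm (Polynomial.C (C c)), φ.injective (by simp [hφf])⟩
  · rw [hΦC]
    have : G = Polynomial.C (C c'⁻¹) * ψ (homogeneousComponent i ρ) := by
      rw [hψ, ← mul_assoc, ← map_mul, ← map_mul, inv_mul_cancel₀ hc']; simp
    rw [this, map_mul, map_mul, AlgEquiv.symm_apply_apply]
    exact Ideal.mul_mem_left _ _ hmem'

end A11

section A12

lemma C_dvd_of_monic_mul {S : Type} [CommRing S] {s : S} {P z : Polynomial S} (hP : P.Monic)
    (h : Polynomial.C s ∣ P * z) : Polynomial.C s ∣ z := by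
  have key : ∀ w : Polynomial S, Polynomial.C s ∣ w ↔
      w.map (Ideal.Quotient.mk (Ideal.span {s})) = 0 := by
    intro w
    rw [Polynomial.C_dvd_iff_dvd_coeff, Polynomial.ext_iff]
    simp [Polynomial.coeff_map, Ideal.Quotient.eq_zero_iff_mem, Ideal.mem_span_singleton]
  rw [key] at h ⊢
  rw [Polynomial.map_mul] at h
  have hm := hP.map (Ideal.Quotient.mk (Ideal.span {s}))
  exact (hm.mul_right_eq_zero_iff).1 h

lemma C_dvd_of_degree_lt {S : Type} [CommRing S] {s : S} {F h t : Polynomial S} (hF : F.Monic)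
    (hd : h.degree < F.degree) (h' : Polynomial.C s ∣ h - t * F) : Polynomial.C s ∣ h := by
  have key : ∀ w : Polynomial S, Polynomial.C s ∣ w ↔
      w.map (Ideal.Quotient.mk (Ideal.span {s})) = 0 := by
    intro w
    rw [Polynomial.C_dvd_iff_dvd_coeff, Polynomial.ext_iff]
    simp [Polynomial.coeff_map, Ideal.Quotient.eq_zero_iff_mem, Ideal.mem_span_singleton]
  rw [key] at h' ⊢
  rw [Polynomial.map_sub, Polynomial.map_mul, sub_eq_zero] at h'
  by_cases hn : Nontrivial (S ⧸ Ideal.span {s})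
  · have hm := hF.map (Ideal.Quotient.mk (Ideal.span {s}))
    have hdvd : F.map (Ideal.Quotient.mk (Ideal.span {s})) ∣ h.map (Ideal.Quotient.mk (Ideal.span {s})) :=
      ⟨_, by rw [h', mul_comm]⟩
    by_contra hne
    have h1 := Polynomial.degree_map_le (f := Ideal.Quotient.mk (Ideal.span {s})) (p := h)
    have h2 := hF.degree_map (Ideal.Quotient.mk (Ideal.span {s}))
    have h3 := hm.not_dvd_of_degree_lt hne (by rw [h2]; exact lt_of_le_of_lt h1 hd)
    exact h3 hdvd
  · rw [not_nontrivial_iff_subsingleton] at hn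
    exact Subsingleton.elim _ _

lemma regB {B : Type} [CommRing B] [IsDomain B] {F g : Polynomial (Polynomial B)} (hF : F.Monic)
    {ρ : Polynomial B} (hρ : ρ.Monic) (hC : Polynomial.C ρ ∈ Ideal.span {F, g}) {b : B} (hb : b ≠ 0) :
    RegM (Ideal.span {F, g}) (Polynomial.C (Polynomial.C b)) := by
  intro h hh
  rw [Ideal.mem_span_pair] at hh hC ⊢
  obtain ⟨h1, h2, e1⟩ := hh
  obtain ⟨α, β, e2⟩ := hC
  have hmod := Polynomial.modByMonic_add_div h2 F
  set m := h2 %ₘ F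
  set t := h2 /ₘ F
  have hlt : m.degree < F.degree := Polynomial.degree_modByMonic_lt h2 hF
  have hd1 : Polynomial.C (Polynomial.C b) ∣ Polynomial.C ρ * m := by
    refine C_dvd_of_degree_lt (t := h2 * α - β * h1 - Polynomial.C ρ * t) hF ?_ ⟨β * h, ?_⟩
    · refine lt_of_le_of_lt ?_ hlt
      rw [Polynomial.C_mul']
      exact Polynomial.degree_smul_le _ _
    · have : m = h2 - F * t := by rw [← hmod]; ring
      rw [this]
      linear_combination (h2) * (-e2) + β * e1
  have hd2 : Polynomial.C (Polynomial.C b) ∣ m := by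
    rw [Polynomial.C_dvd_iff_dvd_coeff] at hd1 ⊢
    intro i
    have := hd1 i
    rw [Polynomial.coeff_C_mul] at this
    exact C_dvd_of_monic_mul hρ this
  obtain ⟨s, hs⟩ := hd2
  have hd3 : Polynomial.C (Polynomial.C b) ∣ F * (h1 + t * g) := ⟨h - s * g, by
    linear_combination e1 - g * (hs - hmod)⟩
  obtain ⟨w, hw⟩ := C_dvd_of_monic_mul hF hd3
  have hb' : (Polynomial.C (Polynomial.C b)) ≠ 0 := by simpa using hb
  refine ⟨w, s, mul_left_cancel₀ hb' ?_⟩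
  linear_combination e1 - g * (hs - hmod) - F * hw

lemma intB' {B T : Type} [CommRing B] [CommRing T] (q : Polynomial (Polynomial B) →+* T)
    (hq : Function.Surjective q)
    {F : Polynomial (Polynomial B)} (hF : F.Monic)
    {ρ : Polynomial B} (hρ : ρ.Monic) (hFJ : q F = 0) (hC : q (Polynomial.C ρ) = 0) :
    (q.comp (Polynomial.C.comp Polynomial.C)).IsIntegral := by
  let g : AdjoinRoot ρ →+* T :=
    Ideal.Quotient.lift _ (q.comp Polynomial.C) (by
      intro a ha
      rw [Ideal.mem_span_singleton'] at ha
      obtain ⟨b, rfl⟩ := ha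
      rw [RingHom.comp_apply, map_mul, map_mul, hC, mul_zero])
  have hg : ∀ z, g (AdjoinRoot.mk ρ z) = q (Polynomial.C z) := fun z => rfl
  have h1 : (algebraMap B (AdjoinRoot ρ)).IsIntegral := by
    have := hρ.finite_adjoinRoot
    intro z
    exact Algebra.IsIntegral.isIntegral (R := B) z
  have h2 : g.IsIntegral := by
    intro z
    obtain ⟨z, rfl⟩ := hq z
    have hX : g.IsIntegralElem (q Polynomial.X) := by
      refine ⟨F.map (AdjoinRoot.mk ρ), hF.map _, ?_⟩
      rw [Polynomial.eval₂_map]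
      have : Polynomial.eval₂ (g.comp (AdjoinRoot.mk ρ)) (q Polynomial.X) F = q F := by
        have h := Polynomial.hom_eval₂ F Polynomial.C q Polynomial.X
        rw [Polynomial.eval₂_C_X] at h
        exact h.symm
      rw [this, hFJ]
    induction z using Polynomial.induction_on' with
    | add p q hp hq => rw [map_add]; exact RingHom.IsIntegralElem.add g hp hq
    | monomial n a =>
      rw [← Polynomial.C_mul_X_pow_eq_monomial, map_mul, map_pow, ← hg]
      refine RingHom.IsIntegralElem.mul g (RingHom.isIntegralElem_map g) ?_
      induction n with
      | zero => rw [pow_zero]; exact RingHom.isIntegralElem_one g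
      | succ n ih => rw [pow_succ]; exact RingHom.IsIntegralElem.mul g ih hX
  exact RingHom.IsIntegral.trans (algebraMap B (AdjoinRoot ρ)) g h1 h2

lemma noether {k : Type} [Field k] [Infinite k] {d e1 e2 : ℕ} (f1 f2 : MvPolynomial (Fin (d+2)) k)
    (h1 : f1 ≠ 0)
    (hf1 : f1.IsHomogeneous e1) (hf2 : f2.IsHomogeneous e2) (hr : RegM (Ideal.span {f1}) f2) :
    ∃ (θ : Fin d → MvPolynomial (Fin (d+2)) k) (u v : MvPolynomial (Fin (d+2)) k),
      (∀ i, (θ i).IsHomogeneous 1) ∧ u.IsHomogeneous 1 ∧ v.IsHomogeneous 1 ∧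
      (∀ b : MvPolynomial (Fin d) k, b ≠ 0 → RegM (Ideal.span {f1, f2}) (aeval θ b)) ∧
      (∀ r, ∃ p : Polynomial (MvPolynomial (Fin d) k), p.Monic ∧
        p.eval₂ (aeval θ : _ →ₐ[k] MvPolynomial (Fin (d+2)) k).toRingHom r ∈ Ideal.span {f1, f2}) ∧
      (∀ (c c' : k) (b : MvPolynomial (Fin d) k), c • u + c' • v + aeval θ b = 0 → c = 0 ∧ c' = 0) := by
  obtain ⟨Φ, hX, hY, hZ, ⟨F, hF, hF1⟩, ρ, hρ, hρC⟩ := coords f1 f2 h1 hf1 hf2 hr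
  have hΦ : ∀ b, aeval (fun i => Φ (Polynomial.C (Polynomial.C (X i)))) b
      = Φ (Polynomial.C (Polynomial.C b)) := by
    intro b
    have : aeval (fun i => Φ (Polynomial.C (Polynomial.C (X i)))) =
      (Φ.toAlgHom.comp (Polynomial.CAlgHom : Polynomial (MvPolynomial (Fin d) k) →ₐ[k] _)).comp
        (Polynomial.CAlgHom : MvPolynomial (Fin d) k →ₐ[k] _) := by
      apply algHom_ext
      intro i
      simp
    exact congrArg (fun f : _ →ₐ[k] _ => f b) this
  have hJ : Ideal.span {f1, f2} = Ideal.span {Φ F, f2} := by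
    rw [Ideal.span_insert, Ideal.span_insert, hF1]
  have hJ2 : ∀ z, z ∈ Ideal.span {f1, f2} ↔ Φ.symm z ∈ Ideal.span {F, Φ.symm f2} := by
    intro z
    rw [hJ, Ideal.mem_span_pair, Ideal.mem_span_pair]
    constructor
    · rintro ⟨a, b, rfl⟩
      exact ⟨Φ.symm a, Φ.symm b, by simp⟩
    · rintro ⟨a, b, h⟩
      exact ⟨Φ a, Φ b, Φ.symm.injective (by simp [← h])⟩
  have hρC' := hρC
  rw [hJ2, AlgEquiv.symm_apply_apply] at hρC'
  refine ⟨fun i => Φ (Polynomial.C (Polynomial.C (X i))), Φ Polynomial.X, Φ (Polynomial.C Polynomial.X),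
    hZ, hX, hY, ?_, ?_, ?_⟩
  · intro b hb z hz
    rw [hΦ] at hz
    rw [hJ2] at hz ⊢
    rw [map_mul, AlgEquiv.symm_apply_apply] at hz
    exact regB hF hρ hρC' hb _ hz
  · intro r
    obtain ⟨p, hp, hpr⟩ := intB' ((Ideal.Quotient.mk (Ideal.span {f1, f2})).comp
      (Φ : _ →+* MvPolynomial (Fin (d+2)) k))
      (Ideal.Quotient.mk_surjective.comp Φ.surjective) hF hρ
      (by
        rw [RingHom.comp_apply, Ideal.Quotient.eq_zero_iff_mem, hJ]
        exact Ideal.subset_span (by simp))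
      (by
        rw [RingHom.comp_apply, Ideal.Quotient.eq_zero_iff_mem]
        exact hρC) (Ideal.Quotient.mk _ r)
    refine ⟨p, hp, ?_⟩
    rw [← Ideal.Quotient.eq_zero_iff_mem, Polynomial.hom_eval₂, ← hpr]
    congr 1
    exact RingHom.ext fun b => congrArg (Ideal.Quotient.mk _) (hΦ b)
  · intro c c' b h
    rw [hΦ, ← map_smul, ← map_smul, ← map_add, ← map_add, map_eq_zero_iff _ Φ.injective] at h
    constructor
    · have := congrArg (fun z => constantCoeff ((z.coeff 1).coeff 0)) h
      simpa [Polynomial.coeff_smul, Polynomial.coeff_C, Polynomial.coeff_X] using this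
    · have := congrArg (fun z => constantCoeff ((z.coeff 0).coeff 1)) h
      simpa [Polynomial.coeff_smul, Polynomial.coeff_C, Polynomial.coeff_X] using this

end A12

section A13
variable {R : Type} [CommRing R]

/-- saturation of `J` at the prime `P` -/
def satI (J P : Ideal R) (hP : P.IsPrime) : Ideal R where
  carrier := {r | ∃ s, s ∉ P ∧ s * r ∈ J}
  zero_mem' := ⟨1, fun h => hP.ne_top ((Ideal.eq_top_iff_one _).2 h), by simp⟩
  add_mem' := by
    rintro a b ⟨s, hs, hsa⟩ ⟨t, ht, htb⟩
    refine ⟨s * t, fun h => (hP.mem_or_mem h).elim hs ht, ?_⟩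
    rw [show s * t * (a + b) = t * (s * a) + s * (t * b) by ring]
    exact add_mem (Ideal.mul_mem_left _ _ hsa) (Ideal.mul_mem_left _ _ htb)
  smul_mem' := by
    rintro c a ⟨s, hs, hsa⟩
    refine ⟨s, hs, ?_⟩
    rw [smul_eq_mul, show s * (c * a) = c * (s * a) by ring]
    exact Ideal.mul_mem_left _ _ hsa

lemma mem_satI {J P : Ideal R} {hP : P.IsPrime} {r : R} : r ∈ satI J P hP ↔ ∃ s, s ∉ P ∧ s * r ∈ J :=
  Iff.rfl

lemma primaryComponent_eq (J P : Ideal R) (hP : P.IsPrime) : primaryComponent J P = satI J P hP := by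
  apply le_antisymm
  · refine iSup₂_le fun s hs r hr => ?_
    rw [Ideal.mem_colon_span_singleton] at hr
    exact ⟨s, hs, by rwa [mul_comm]⟩
  · rintro r ⟨s, hs, hsr⟩
    have h : r ∈ Submodule.colon J (Ideal.span {s} : Set R) := by
      rw [Ideal.mem_colon_span_singleton, mul_comm]; exact hsr
    exact (le_iSup₂ (f := fun (s : R) (_ : s ∉ P) => Submodule.colon J (Ideal.span {s} : Set R)) s hs) h

lemma mem_primaryComponent {J P : Ideal R} (hP : P.IsPrime) {r : R} :
    r ∈ primaryComponent J P ↔ ∃ s, s ∉ P ∧ s * r ∈ J := by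
  rw [primaryComponent_eq J P hP]; rfl

lemma le_unmixedPart (J : Ideal R) : J ≤ unmixedPart J := by
  refine le_iInf₂ fun p hp r hr => ?_
  rw [mem_primaryComponent hp.1]
  exact ⟨1, fun h => hp.1.ne_top ((Ideal.eq_top_iff_one _).2 h), by simpa using hr⟩

lemma min_of_ass {B : Type} [CommRing B] {C P Q : Ideal R} (f : B →+* R)
    (hreg : ∀ b, b ≠ 0 → RegM C (f b))
    (hinteg : ∀ r, ∃ p : Polynomial B, p.Monic ∧ p.eval₂ f r ∈ C)
    {g : R} (hP : P.IsPrime) (hg : ∀ r, r ∈ P ↔ r * g ∈ C) (hQ : Q.IsPrime) (hCQ : C ≤ Q)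
    (hQP : Q ≤ P) : Q = P := by
  by_contra hne
  obtain ⟨r, hrP, hrQ⟩ := SetLike.exists_of_lt (lt_of_le_of_ne hQP hne)
  obtain ⟨p, hp, hpr⟩ := hinteg r
  have : (Q.comap f).IsPrime := Ideal.IsPrime.comap f
  obtain ⟨i, hi1, hi2⟩ := Ideal.exists_coeff_mem_comap_sdiff_comap_of_root_mem_sdiff (f := f) (p := p)
    hQP ⟨hrP, hrQ⟩ (hp.map _).ne_zero (hCQ hpr)
  have hb : p.coeff i ≠ 0 := by
    intro h; apply hi2; rw [h]; simp
  have hgC := hreg _ hb g ((hg _).1 hi1)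
  exact hP.ne_top ((Ideal.eq_top_iff_one _).2 ((hg 1).2 (by simpa using hgC)))

lemma link [IsNoetherianRing R] {B : Type} [CommRing B] {f1 f2 f3 : R} (f : B →+* R)
    (hreg : ∀ b, b ≠ 0 → RegM (Ideal.span {f1, f2}) (f b))
    (hinteg : ∀ r, ∃ p : Polynomial B, p.Monic ∧ p.eval₂ f r ∈ Ideal.span {f1, f2})
    (hC : (Ideal.span {f1, f2}).height = 2) (hI : (Ideal.span {f1, f2, f3}).height = 2) (r : R) :
    f3 * r ∈ Ideal.span {f1, f2} ↔
      ∀ c ∈ unmixedPart (Ideal.span {f1, f2, f3}), c * r ∈ Ideal.span {f1, f2} := by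
  constructor
  · intro hr c hc
    by_contra hne
    set C := Ideal.span {f1, f2}
    have hI' : ∀ z ∈ Ideal.span {f1, f2, f3}, z * r ∈ C := by
      intro z hz
      induction hz using Submodule.span_induction with
      | mem f hf =>
        rcases hf with rfl | rfl | rfl
        · exact Ideal.mul_mem_right _ _ (Ideal.subset_span (by simp))
        · exact Ideal.mul_mem_right _ _ (Ideal.subset_span (by simp))
        · exact hr
      | zero => simp
      | add a b _ _ ha hb => rw [add_mul]; exact add_mem ha hb
      | smul a f _ hf => rw [smul_eq_mul, mul_assoc]; exact Ideal.mul_mem_left _ _ hf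
    obtain ⟨P, hP, hle⟩ := exists_le_isAssociatedPrime_of_isNoetherianRing R
      (Ideal.Quotient.mk C (c * r)) (by rwa [Ne, Ideal.Quotient.eq_zero_iff_mem])
    rw [isAssociatedPrime_iff] at hP
    obtain ⟨hPp, g, hg⟩ := hP
    obtain ⟨g, rfl⟩ := Ideal.Quotient.mk_surjective g
    have hmem : ∀ (g s : R), s ∈ (⊥ : Submodule R (R ⧸ C)).colon {Ideal.Quotient.mk C g} ↔ s * g ∈ C := by
      intro g s
      rw [Submodule.mem_colon_singleton, Submodule.mem_bot, ← Ideal.Quotient.eq_zero_iff_mem]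
      rfl
    have hgP : ∀ s, s ∈ P ↔ s * g ∈ C := by
      intro s; rw [hg, hmem]
    have hCP : C ≤ P := fun z hz => (hgP z).2 (Ideal.mul_mem_right _ _ hz)
    have hIP : Ideal.span {f1, f2, f3} ≤ P := by
      intro z hz
      apply hle
      rw [hmem, show z * (c * r) = c * (z * r) by ring]
      exact Ideal.mul_mem_left _ _ (hI' z hz)
    have hmin : P ∈ C.minimalPrimes := by
      refine ⟨⟨hPp, hCP⟩, ?_⟩
      rintro Q ⟨hQ, hCQ⟩ hQP
      exact (min_of_ass f hreg hinteg hPp hgP hQ hCQ hQP).ge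
    have hht : P.height = 2 := le_antisymm (height_le_two hmin) (hC ▸ Ideal.height_mono hCP)
    have hc' : c ∈ primaryComponent (Ideal.span {f1, f2, f3}) P := by
      have := (Submodule.mem_iInf _).1 hc P
      exact (Submodule.mem_iInf _).1 this ⟨hPp, hIP, by rw [idealHeight_eq, idealHeight_eq, hht, hI]⟩
    rw [mem_primaryComponent hPp] at hc'
    obtain ⟨t, ht, htc⟩ := hc'
    apply ht
    apply hle
    rw [hmem, ← mul_assoc]
    exact hI' _ htc
  · intro h
    exact h f3 (le_unmixedPart _ (Ideal.subset_span (by simp)))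

lemma inj_min {B : Type} [CommRing B] {C P : Ideal R} (f : B →+* R)
    (hreg : ∀ b, b ≠ 0 → RegM C (f b)) (hP : P ∈ C.minimalPrimes) (b : B) (hb : f b ∈ P) : b = 0 := by
  by_contra hne
  obtain ⟨y, hy, hxy⟩ := Ideal.exists_mul_mem_of_mem_minimalPrimes hP hb
  exact hy (hreg b hne y hxy)

end A13

section A14
variable {k : Type} [Field k] {N : ℕ}

/-- torus action -/
def tor (l : k) : MvPolynomial (Fin N) k →ₐ[k] MvPolynomial (Fin N) k :=
  aeval fun i => C l * X i

lemma tor_hom (l : k) {r : MvPolynomial (Fin N) k} {e : ℕ} (hr : r.IsHomogeneous e) :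
    tor l r = l ^ e • r := by
  rw [tor, hom_scale hr, smul_eq_C_mul, map_pow, aeval_X_left_apply]

lemma tor_eq (l : k) (r : MvPolynomial (Fin N) k) :
    tor l r = ∑ i ∈ Finset.range (r.totalDegree + 1), l ^ i • homogeneousComponent i r := by
  conv_lhs => rw [← sum_homogeneousComponent r, map_sum]
  exact Finset.sum_congr rfl fun i _ => tor_hom l (homogeneousComponent_isHomogeneous i r)

lemma CompCl.tor_mem {J : Ideal (MvPolynomial (Fin N) k)} (hJ : CompCl J) (l : k)
    {r : MvPolynomial (Fin N) k} (hr : r ∈ J) : tor l r ∈ J := by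
  rw [tor_eq]
  refine Ideal.sum_mem _ fun i _ => ?_
  rw [smul_eq_C_mul]
  exact Ideal.mul_mem_left _ _ (hJ r hr i)

lemma tor_inv {l : k} (hl : l ≠ 0) (r : MvPolynomial (Fin N) k) : tor l⁻¹ (tor l r) = r := by
  have : (tor l⁻¹).comp (tor l) = AlgHom.id k (MvPolynomial (Fin N) k) := by
    apply algHom_ext
    intro i
    simp only [tor, AlgHom.comp_apply, aeval_X, map_mul, aeval_C, AlgHom.id_apply, algebraMap_eq,
      ← mul_assoc, ← C_mul, mul_inv_cancel₀ hl, C_1, one_mul]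
  exact congrArg (fun f : _ →ₐ[k] _ => f r) this

lemma compCl_of_tor [Infinite k] {J : Ideal (MvPolynomial (Fin N) k)}
    (h : ∀ l : k, l ≠ 0 → ∀ r ∈ J, tor l r ∈ J) : CompCl J := by
  intro r hr i
  by_contra hi
  obtain ⟨f, hf, hfJ⟩ := Submodule.exists_le_ker_of_notMem (p := J.restrictScalars k) hi
  let P : Polynomial k := ∑ i ∈ Finset.range (r.totalDegree + 1),
    Polynomial.C (f (homogeneousComponent i r)) * Polynomial.X ^ i
  have hP : P * Polynomial.X = 0 := by
    apply Polynomial.funext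
    intro l
    rw [Polynomial.eval_mul, Polynomial.eval_X, Polynomial.eval_zero]
    by_cases hl : l = 0
    · rw [hl, mul_zero]
    · have h1 : f (tor l r) = 0 := hfJ (h l hl r hr)
      rw [tor_eq, map_sum] at h1
      simp only [P, Polynomial.eval_finsetSum, Polynomial.eval_mul, Polynomial.eval_C,
        Polynomial.eval_pow, Polynomial.eval_X]
      simp only [map_smul, smul_eq_mul] at h1
      rw [Finset.sum_congr rfl fun i _ => mul_comm _ _, h1, zero_mul]
  have hP0 : P = 0 := by
    rcases mul_eq_zero.1 hP with h | h
    · exact h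
    · exact absurd h Polynomial.X_ne_zero
  apply hf
  by_cases hir : i ∈ Finset.range (r.totalDegree + 1)
  · have := congrArg (fun q => q.coeff i) hP0
    simpa [P, Polynomial.finsetSum_coeff, Polynomial.coeff_C_mul, Polynomial.coeff_X_pow, hir] using this
  · rw [homogeneousComponent_eq_zero _ _ (by simpa using hir), map_zero]

lemma CompCl.satI_cl [Infinite k] {J P : Ideal (MvPolynomial (Fin N) k)} (hJ : CompCl J) (hP : CompCl P)
    (hPp : P.IsPrime) : CompCl (satI J P hPp) := by
  apply compCl_of_tor
  rintro l hl r ⟨s, hs, hsr⟩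
  refine ⟨tor l s, fun h => hs ?_, ?_⟩
  · rw [← tor_inv hl s]
    exact hP.tor_mem _ h
  · rw [← map_mul]
    exact hJ.tor_mem _ hsr

lemma CompCl.inf {J P : Ideal (MvPolynomial (Fin N) k)} (hJ : CompCl J) (hP : CompCl P) :
    CompCl (J ⊓ P) := fun r hr i => ⟨hJ r hr.1 i, hP r hr.2 i⟩

lemma CompCl.unmixed [Infinite k] {J : Ideal (MvPolynomial (Fin N) k)} (hJ : CompCl J)
    (hh : J.height = 2) : CompCl (unmixedPart J) := by
  intro r hr i
  refine (Submodule.mem_iInf _).2 fun P => (Submodule.mem_iInf _).2 fun hP => ?_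
  have h1 := (Submodule.mem_iInf _).1 ((Submodule.mem_iInf _).1 hr P) hP
  obtain ⟨hPp, hJP, hPh⟩ := hP
  rw [idealHeight_eq, idealHeight_eq, hh] at hPh
  rw [primaryComponent_eq _ _ hPp] at h1 ⊢
  exact hJ.satI_cl (hJ.minimal (min_of_height_two hh hPh hJP)) hPp r h1 i

lemma CompCl.colon [Infinite k] {J : Ideal (MvPolynomial (Fin N) k)} (hJ : CompCl J)
    {f : MvPolynomial (Fin N) k} {e : ℕ} (hf : f.IsHomogeneous e) :
    CompCl (Submodule.colon J (Ideal.span {f})) := by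
  apply compCl_of_tor
  intro l hl r hr
  rw [Ideal.mem_colon_span_singleton] at hr ⊢
  have := hJ.tor_mem l hr
  rw [map_mul, tor_hom l hf, smul_eq_C_mul] at this
  have h2 := Ideal.mul_mem_left _ (C ((l ^ e)⁻¹)) this
  rw [show C ((l ^ e)⁻¹) * (tor l r * (C (l ^ e) * f)) = (C ((l ^ e)⁻¹) * C (l ^ e)) * (tor l r * f) by ring,
    ← C_mul, inv_mul_cancel₀ (pow_ne_zero _ hl), C_1, one_mul] at h2
  exact h2

end A14

section A15

lemma sum_multichoose (d n : ℕ) :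
    ∑ i ∈ Finset.range (n+1), Nat.multichoose d i = Nat.multichoose (d+1) n := by
  induction n with
  | zero => simp
  | succ n ih => rw [Finset.sum_range_succ, ih, Nat.multichoose_succ_succ, add_comm]

lemma fact_mul_sum (d n : ℕ) :
    d.factorial * ∑ i ∈ Finset.range (n+1), Nat.multichoose d i = (n+1).ascFactorial d := by
  rw [sum_multichoose, Nat.multichoose_eq, Nat.ascFactorial_eq_factorial_mul_choose,
    show d + 1 + n - 1 = n + d by omega, ← Nat.choose_symm_add]

/-- polynomials of degree `< n` -/
abbrev Wn (k : Type) [Field k] (d n : ℕ) : Submodule k (MvPolynomial (Fin d) k) :=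
  restrictSupport k {α : Fin d →₀ ℕ | α.degree < n}

lemma set_eq (d n : ℕ) : {α : Fin d →₀ ℕ | α.degree < n} =
    ((Finset.range n).biUnion fun i => Finset.finsuppAntidiag Finset.univ i : Finset (Fin d →₀ ℕ)) := by
  ext α
  simp [Finset.mem_finsuppAntidiag, Finsupp.degree_eq_sum]

instance Wn_finite {k : Type} [Field k] {d n : ℕ} : Module.Finite k (Wn k d n) := by
  have : Finite {α : Fin d →₀ ℕ | α.degree < n} := by rw [set_eq]; infer_instance
  exact Module.Finite.of_basis (basisRestrictSupport k _)

lemma finrank_Wn (k : Type) [Field k] (d n : ℕ) :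
    Module.finrank k (Wn k d n) = ∑ i ∈ Finset.range n, Nat.multichoose d i := by
  rw [Module.finrank_eq_nat_card_basis (basisRestrictSupport k _), set_eq]
  rw [Nat.card_coe_set_eq, Set.ncard_coe_finset, Finset.card_biUnion]
  · refine Finset.sum_congr rfl fun i _ => ?_
    rw [Finset.card_finsuppAntidiag_nat_eq_multichoose]; simp
  · intro i _ j _ hij
    rw [Function.onFun, Finset.disjoint_left]
    intro α h1 h2
    rw [Finset.mem_finsuppAntidiag] at h1 h2
    exact hij (h1.1.symm.trans h2.1)

lemma lim_ratio (d c : ℕ) : Tendsto (fun n : ℕ => ((n + c : ℕ) : ℝ) ^ d / (n : ℝ) ^ d) atTop (nhds 1) := by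
  have h1 : Tendsto (fun n : ℕ => (1 + (c : ℝ) / (n : ℝ)) ^ d) atTop (nhds 1) := by
    have := (tendsto_const_nhds (x := (1:ℝ))).add (tendsto_const_div_atTop_nhds_zero_nat (c : ℝ))
    have := this.pow d
    simpa using this
  refine h1.congr' ?_
  filter_upwards [eventually_gt_atTop 0] with n hn
  rw [← div_pow]
  congr 1
  have : (n : ℝ) ≠ 0 := by positivity
  push_cast
  field_simp

lemma lim_ratio' (d c : ℕ) : Tendsto (fun n : ℕ => (n : ℝ) ^ d / ((n + c : ℕ) : ℝ) ^ d) atTop (nhds 1) := by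
  have := (lim_ratio d c).inv₀ one_ne_zero
  rw [inv_one] at this
  refine this.congr fun n => ?_
  rw [inv_div]

variable {k : Type} [Field k] {N d : ℕ}

lemma HS_ideal : Ideal.span (Set.range (X : Fin N → MvPolynomial (Fin N) k)) = idealOfVars (Fin N) k := rfl

lemma comp_pow {n i : ℕ} (hi : i < n) {w : MvPolynomial (Fin N) k} (hw : w ∈ idealOfVars (Fin N) k ^ n) :
    homogeneousComponent i w = 0 := by
  rw [mem_pow_idealOfVars_iff'] at hw
  ext α
  rw [coeff_homogeneousComponent, coeff_zero]
  split_ifs with h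
  · exact hw α (by omega)
  · rfl

/-- decompose mod high degree -/
lemma exists_trunc (n : ℕ) (r : MvPolynomial (Fin N) k) :
    ∃ w ∈ Wn k N n, r - w ∈ idealOfVars (Fin N) k ^ n := by
  refine ⟨∑ i ∈ Finset.range n, homogeneousComponent i r, ?_, ?_⟩
  · refine Submodule.sum_mem _ fun i hi => ?_
    rw [mem_restrictSupport_iff]
    intro α hα
    have := (homogeneousComponent_isHomogeneous i r).degree_eq_sum_deg_support hα
    rw [Finset.mem_range] at hi
    rw [Set.mem_ofPred_eq, Finsupp.degree_apply]
    omega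
  · rw [mem_pow_idealOfVars_iff']
    intro α hα
    rw [coeff_sub, coeff_sum, Finset.sum_eq_single_of_mem α.degree (by simpa using hα)]
    · rw [coeff_homogeneousComponent, if_pos rfl, sub_self]
    · intro i _ hi
      rw [coeff_homogeneousComponent, if_neg (Ne.symm hi)]

lemma HS_finite (J : Ideal (MvPolynomial (Fin N) k)) (n : ℕ) :
    Module.Finite k (MvPolynomial (Fin N) k ⧸ (J ⊔ idealOfVars (Fin N) k ^ n)) := by
  refine Module.Finite.of_surjective (((Ideal.Quotient.mkₐ k (J ⊔ idealOfVars (Fin N) k ^ n)).toLinearMap).comp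
    (Wn k N n).subtype) ?_
  intro z
  obtain ⟨r, rfl⟩ := Ideal.Quotient.mk_surjective z
  obtain ⟨w, hw, hrw⟩ := exists_trunc n r
  refine ⟨⟨w, hw⟩, ?_⟩
  change Ideal.Quotient.mk _ w = Ideal.Quotient.mk _ r
  symm
  rw [Ideal.Quotient.eq]
  exact Ideal.mem_sup_right hrw

lemma aeval_pow_vars (θ : Fin d → MvPolynomial (Fin N) k) (hθ : ∀ i, (θ i).IsHomogeneous 1) (n : ℕ)
    {s : MvPolynomial (Fin d) k} (hs : s ∈ idealOfVars (Fin d) k ^ n) :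
    aeval θ s ∈ idealOfVars (Fin N) k ^ n := by
  have h1 : (idealOfVars (Fin d) k).map (aeval θ : _ →ₐ[k] MvPolynomial (Fin N) k) ≤ idealOfVars (Fin N) k := by
    rw [idealOfVars, Ideal.map_span, Ideal.span_le]
    rintro _ ⟨_, ⟨i, rfl⟩, rfl⟩
    obtain ⟨c, hc⟩ := exists_lf (hθ i)
    rw [aeval_X, ← hc, lf_apply]
    refine Ideal.sum_mem _ fun j _ => ?_
    rw [smul_eq_C_mul]
    exact Ideal.mul_mem_left _ _ (Ideal.subset_span ⟨j, rfl⟩)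
  have h2 := Ideal.pow_right_mono h1 n
  rw [← Ideal.map_pow] at h2
  exact h2 (Ideal.mem_map_of_mem _ hs)

lemma not_mult_two (J : Ideal (MvPolynomial (Fin N) k)) (θ : Fin d → MvPolynomial (Fin N) k)
    (hθ : ∀ i, (θ i).IsHomogeneous 1) (h : ∀ r, ∃ s : MvPolynomial (Fin d) k, r - aeval θ s ∈ J) :
    ¬ HasMultiplicity J d 2 := by
  intro hm
  have hb : ∀ n, d.factorial * hilbertSamuelFn J (n+1) ≤ (n + d) ^ d := by
    intro n
    have h1 : hilbertSamuelFn J (n+1) ≤ Module.finrank k (Wn k d (n+1)) := by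
      rw [hilbertSamuelFn, HS_ideal]
      refine LinearMap.finrank_le_finrank_of_surjective
        (f := ((Ideal.Quotient.mkₐ k (J ⊔ idealOfVars (Fin N) k ^ (n+1))).toLinearMap).comp
          ((aeval θ : _ →ₐ[k] MvPolynomial (Fin N) k).toLinearMap.comp (Wn k d (n+1)).subtype)) ?_
      intro z
      obtain ⟨r, rfl⟩ := Ideal.Quotient.mk_surjective z
      obtain ⟨s, hs⟩ := h r
      obtain ⟨w, hw, hsw⟩ := exists_trunc (n+1) s
      refine ⟨⟨w, hw⟩, ?_⟩
      change Ideal.Quotient.mk _ (aeval θ w) = Ideal.Quotient.mk _ r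
      symm
      rw [Ideal.Quotient.eq, show r - aeval θ w = (r - aeval θ s) + aeval θ (s - w) by rw [map_sub]; ring]
      exact add_mem (Ideal.mem_sup_left hs) (Ideal.mem_sup_right (aeval_pow_vars θ hθ _ hsw))
    rw [finrank_Wn] at h1
    calc _ ≤ d.factorial * _ := Nat.mul_le_mul_left _ h1
      _ = _ := fact_mul_sum d n
      _ ≤ _ := Nat.ascFactorial_le_pow_add n d
  have h2 : Tendsto (fun n : ℕ => ((n + d : ℕ) : ℝ) ^ d / ((n + 1 : ℕ) : ℝ) ^ d) atTop (nhds 1) := by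
    have := (lim_ratio d d).mul (lim_ratio' d 1)
    rw [one_mul] at this
    refine this.congr' ?_
    filter_upwards [eventually_gt_atTop 0] with n hn
    have : (n : ℝ) ^ d ≠ 0 := by positivity
    field_simp
  have h3 := hm.comp (tendsto_add_atTop_nat 1)
  have := le_of_tendsto_of_tendsto' h3 h2 (fun n => by
    simp only [Function.comp]
    gcongr
    exact_mod_cast hb n)
  norm_num at this

lemma mem_of_trunc {J : Ideal (MvPolynomial (Fin N) k)} (hJ : CompCl J) {n : ℕ}
    {z : MvPolynomial (Fin N) k} (hz : ∀ i, n ≤ i → homogeneousComponent i z = 0)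
    (h : z ∈ J ⊔ idealOfVars (Fin N) k ^ n) : z ∈ J := by
  obtain ⟨j, hj, w, hw, rfl⟩ := Submodule.mem_sup.1 h
  rw [← sum_homogeneousComponent (j + w)]
  refine Ideal.sum_mem _ fun i _ => ?_
  by_cases hi : i < n
  · rw [map_add, comp_pow hi hw, add_zero]
    exact hJ j hj i
  · rw [hz i (by omega)]; exact zero_mem _

lemma comp_aeval_mul (θ : Fin d → MvPolynomial (Fin N) k) (hθ : ∀ i, (θ i).IsHomogeneous 1)
    {m : MvPolynomial (Fin N) k} {δ : ℕ} (hm : m.IsHomogeneous δ) (s : MvPolynomial (Fin d) k) (D : ℕ) :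
    homogeneousComponent D (aeval θ s * m) =
      if D < δ then 0 else aeval θ (homogeneousComponent (D - δ) s) * m := by
  have h1 : ∀ j, (aeval θ (homogeneousComponent j s) * m).IsHomogeneous (j + δ) := by
    intro j
    have := (homogeneousComponent_isHomogeneous j s).aeval θ hθ
    rw [one_mul] at this
    exact this.mul hm
  conv_lhs => rw [← sum_homogeneousComponent s, map_sum, Finset.sum_mul, map_sum]
  split_ifs with h
  · refine Finset.sum_eq_zero fun j _ => ?_
    rw [homogeneousComponent_of_mem (h1 j), if_neg (by omega)]
  · by_cases hi : D - δ ∈ Finset.range (s.totalDegree + 1)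
    · rw [Finset.sum_eq_single_of_mem _ hi]
      · rw [homogeneousComponent_of_mem (h1 _), if_pos (by omega)]
      · intro j _ hj
        rw [homogeneousComponent_of_mem (h1 j), if_neg (by omega)]
    · rw [homogeneousComponent_eq_zero _ _ (by rw [Finset.mem_range] at hi; omega), map_zero, zero_mul]
      refine Finset.sum_eq_zero fun j hj => ?_
      rw [homogeneousComponent_of_mem (h1 j), if_neg]
      rintro rfl
      exact hi (by rwa [Nat.add_sub_cancel])

lemma dep {J : Ideal (MvPolynomial (Fin N) k)} (hJ : CompCl J) (hm : HasMultiplicity J d 2)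
    (θ : Fin d → MvPolynomial (Fin N) k) (hθ : ∀ i, (θ i).IsHomogeneous 1)
    (m : Fin 3 → MvPolynomial (Fin N) k) (δ : Fin 3 → ℕ) (hδ : ∀ i, (m i).IsHomogeneous (δ i))
    (hδ2 : ∀ i, δ i ≤ 2) :
    ∃ (D : ℕ) (s : Fin 3 → MvPolynomial (Fin d) k), s ≠ 0 ∧ (∀ i, (s i).IsHomogeneous (D - δ i)) ∧
      (∀ i, D < δ i → s i = 0) ∧ ∑ i, aeval θ (s i) * m i ∈ J := by
  obtain ⟨s, hs, hsJ⟩ : ∃ s : Fin 3 → MvPolynomial (Fin d) k, s ≠ 0 ∧ ∑ i, aeval θ (s i) * m i ∈ J := by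
    by_contra! hcon
    have hb : ∀ n, 3 * (n + 1) ^ d ≤ d.factorial * hilbertSamuelFn J (n+3) := by
      intro n
      have h1 : 3 * Module.finrank k (Wn k d (n+1)) ≤ hilbertSamuelFn J (n+3) := by
        have := HS_finite J (n+3)
        let f : (Fin 3 → Wn k d (n+1)) →ₗ[k] MvPolynomial (Fin N) k :=
          ∑ i, (LinearMap.mulRight k (m i)).comp ((aeval θ : _ →ₐ[k] MvPolynomial (Fin N) k).toLinearMap.comp
            ((Wn k d (n+1)).subtype.comp (LinearMap.proj i)))
        have hf : ∀ s, f s = ∑ i, aeval θ (s i : MvPolynomial (Fin d) k) * m i := by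
          intro s
          simp [f, LinearMap.sum_apply]
        have := LinearMap.finrank_le_finrank_of_injective
          (f := ((Ideal.Quotient.mkₐ k (J ⊔ idealOfVars (Fin N) k ^ (n+3))).toLinearMap).comp f) ?_
        · rw [Module.finrank_pi_fintype] at this
          simpa [hilbertSamuelFn, HS_ideal] using this
        · rw [← LinearMap.ker_eq_bot, LinearMap.ker_eq_bot']
          intro s hs
          have hs' : f s ∈ J ⊔ idealOfVars (Fin N) k ^ (n+3) := Ideal.Quotient.eq_zero_iff_mem.1 hs
          have h3 : f s ∈ J := by
            refine mem_of_trunc hJ ?_ hs'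
            intro i hi
            rw [hf, map_sum]
            refine Finset.sum_eq_zero fun j _ => ?_
            rw [comp_aeval_mul θ hθ (hδ j)]
            split_ifs with h
            · rfl
            · have hδj := hδ2 j
              rw [show homogeneousComponent (i - δ j) (s j : MvPolynomial (Fin d) k) = 0 from ?_, map_zero, zero_mul]
              ext α
              rw [coeff_homogeneousComponent, coeff_zero]
              split_ifs with hα
              · by_contra hne
                have := (s j).2 (mem_support_iff.2 hne)
                rw [Set.mem_ofPred_eq] at this
                omega
              · rfl
          rw [hf] at h3
          by_contra hne
          refine hcon (fun i => (s i : MvPolynomial (Fin d) k)) (fun h0 => hne ?_) h3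
          funext i
          exact Subtype.ext (congrFun h0 i)
      rw [finrank_Wn] at h1
      calc 3 * (n+1)^d ≤ 3 * (n+1).ascFactorial d := Nat.mul_le_mul_left _ (Nat.pow_succ_le_ascFactorial _ _)
        _ = d.factorial * (3 * ∑ i ∈ Finset.range (n+1), Nat.multichoose d i) := by
          rw [← fact_mul_sum]; ring
        _ ≤ _ := Nat.mul_le_mul_left _ h1
    have h2 : Tendsto (fun n : ℕ => 3 * (((n+1 : ℕ) : ℝ) ^ d / ((n + 3 : ℕ) : ℝ) ^ d)) atTop (nhds (3 * 1)) := by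
      refine Tendsto.const_mul _ ?_
      have := (lim_ratio d 1).mul (lim_ratio' d 3)
      rw [one_mul] at this
      refine this.congr' ?_
      filter_upwards [eventually_gt_atTop 0] with n hn
      have : (n : ℝ) ^ d ≠ 0 := by positivity
      field_simp
    have h3 := hm.comp (tendsto_add_atTop_nat 3)
    have := le_of_tendsto_of_tendsto' h2 h3 (fun n => by
      simp only [Function.comp]
      rw [← mul_div_assoc]
      refine div_le_div_of_nonneg_right ?_ (by positivity)
      exact_mod_cast hb n)
    norm_num at this
  obtain ⟨i, hi⟩ : ∃ i, s i ≠ 0 := by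
    by_contra! h; exact hs (funext h)
  obtain ⟨j, hj⟩ : ∃ j, homogeneousComponent j (s i) ≠ 0 := by
    by_contra! h
    apply hi
    rw [← sum_homogeneousComponent (s i)]
    exact Finset.sum_eq_zero fun j _ => h j
  refine ⟨j + δ i, fun l => if j + δ i < δ l then 0 else homogeneousComponent (j + δ i - δ l) (s l), ?_, ?_, ?_, ?_⟩
  · intro h
    have := congrFun h i
    simp only [Pi.zero_apply] at this
    rw [if_neg (by omega), Nat.add_sub_cancel] at this
    exact hj this
  · intro l
    dsimp only
    split_ifs
    · exact isHomogeneous_zero _ _ _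
    · exact homogeneousComponent_isHomogeneous _ _
  · intro l hl
    dsimp only
    rw [if_pos hl]
  · have := hJ _ hsJ (j + δ i)
    rw [map_sum] at this
    convert this using 2 with l
    rw [comp_aeval_mul θ hθ (hδ l)]
    dsimp only
    split_ifs
    · rw [map_zero, zero_mul]
    · rfl

end A15

section structureH
variable {k : Type} [Field k] {N d : ℕ}

lemma primary_cancel {R : Type} [CommRing R] {H p : Ideal R} (hH : H.IsPrimary) (hr : H.radical = p)
    {a b : R} (h : a * b ∈ H) (ha : a ∉ p) : b ∈ H := by
  rw [Ideal.isPrimary_iff] at hH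
  rw [mul_comm] at h
  rcases hH.2 h with h | h
  · exact h
  · rw [hr] at h; exact absurd h ha

lemma le_of_sigma {R : Type} [CommRing R] [IsNoetherianRing R] {H p : Ideal R} (hH : H.IsPrimary)
    (hr : H.radical = p) {σ : R} (hσ : σ ∉ p) (h : ∀ r ∈ p, σ * r ∈ H ⊔ p ^ 2) : p ≤ H := by
  obtain ⟨n, hn⟩ := Ideal.exists_radical_pow_le_of_fg H (IsNoetherian.noetherian _)
  rw [hr] at hn
  have step : ∀ j, p ^ (j + 2) ≤ H → p ^ (j + 1) ≤ H := by
    intro j hj r hrr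
    refine primary_cancel hH hr (a := σ) ?_ hσ
    rw [pow_succ] at hrr
    refine Submodule.mul_induction_on hrr ?_ ?_
    · intro m hm n hn
      obtain ⟨u, hu, v, hv, huv⟩ := Submodule.mem_sup.1 (h n hn)
      have : σ * (m * n) = m * u + m * v := by rw [← mul_add, huv]; ring
      rw [this]
      refine H.add_mem (H.mul_mem_left _ hu) (hj ?_)
      rw [pow_add]
      exact Ideal.mul_mem_mul hm hv
    · intro a b ha hb
      rw [mul_add]; exact H.add_mem ha hb
  have : ∀ j, p ^ (j + 1) ≤ H → p ≤ H := by
    intro j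
    induction j with
    | zero => intro h; simpa using h
    | succ j ih => intro h; exact ih (step j h)
  exact this n (le_trans (Ideal.pow_le_pow_right (Nat.le_succ n)) hn)

lemma structH {x y : MvPolynomial (Fin N) k} (hx : x.IsHomogeneous 1) (hy : y.IsHomogeneous 1)
    (U : UFDI (Ideal.span {x, y}))
    (θ : Fin d → MvPolynomial (Fin N) k) (π : MvPolynomial (Fin N) k →ₐ[k] MvPolynomial (Fin d) k)
    (hθ : ∀ i, (θ i).IsHomogeneous 1) (hπθ : ∀ s, π (aeval θ s) = s)
    (hπ : ∀ r, π r = 0 ↔ r ∈ Ideal.span {x, y})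
    {H : Ideal (MvPolynomial (Fin N) k)} (hH : H.IsPrimary) (hr : H.radical = Ideal.span {x, y})
    (hC : CompCl H) (hm : HasMultiplicity H d 2) :
    ∃ a b, Cop (Ideal.span {x, y}) a b ∧ H = HI x y a b := by
  set p := Ideal.span {x, y} with hp
  have hHp : H ≤ p := hr ▸ Ideal.le_radical
  have hxp : x ∈ p := Ideal.subset_span (by simp)
  have hyp : y ∈ p := Ideal.subset_span (by simp)
  have hnp : ¬ p ≤ H := by
    intro h
    refine not_mult_two H θ hθ (fun r => ⟨π r, h ?_⟩) hm
    rw [← hπ, map_sub, hπθ, sub_self]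
  have hns : ∀ s : MvPolynomial (Fin d) k, s ≠ 0 → aeval θ s ∉ p := by
    intro s hs h
    rw [← hπ, hπθ] at h; exact hs h
  have P := U.prime
  -- the square
  have sq : ∀ w ∈ p ^ 2, w.IsHomogeneous 2 → w ∈ H := by
    intro w hw hw2
    by_contra hwH
    have : ∃ m2, m2 ∈ p ∧ m2.IsHomogeneous 1 ∧ ∀ s : MvPolynomial (Fin d) k, s ≠ 0 → aeval θ s * m2 ∉ H ⊔ p ^ 2 := by
      by_contra hcon
      push Not at hcon
      obtain ⟨s, hs, h1⟩ := hcon x hxp hx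
      obtain ⟨t, ht, h2⟩ := hcon y hyp hy
      refine hnp (le_of_sigma hH hr (σ := aeval θ s * aeval θ t) ?_ ?_)
      · intro h
        rcases P.mem_or_mem h with h | h
        · exact hns s hs h
        · exact hns t ht h
      · intro r hrp
        obtain ⟨α, β, rfl⟩ := Ideal.mem_span_pair.1 hrp
        have : aeval θ s * aeval θ t * (α * x + β * y) = (α * aeval θ t) * (aeval θ s * x)
          + (β * aeval θ s) * (aeval θ t * y) := by ring
        rw [this]
        exact Ideal.add_mem _ (Ideal.mul_mem_left _ _ h1) (Ideal.mul_mem_left _ _ h2)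
    obtain ⟨m2, hm2, hm2h, hm2s⟩ := this
    obtain ⟨D, s, hs, -, -, hsum⟩ := dep hC hm θ hθ ![1, m2, w] ![0, 1, 2]
      (by intro i; fin_cases i
          · exact isHomogeneous_one _ _
          · exact hm2h
          · exact hw2)
      (by intro i; fin_cases i <;> simp)
    simp only [Fin.sum_univ_three, Matrix.cons_val_zero, Matrix.cons_val_one, Matrix.cons_val, mul_one] at hsum
    have hwp : w ∈ p := Ideal.pow_le_self (by norm_num) hw
    have s0 : s 0 = 0 := by
      by_contra h
      refine hns _ h ?_
      have h1 := hHp hsum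
      have : aeval θ (s 0) = (aeval θ (s 0) + aeval θ (s 1) * m2 + aeval θ (s 2) * w)
        - aeval θ (s 1) * m2 - aeval θ (s 2) * w := by ring
      rw [this]
      exact p.sub_mem (p.sub_mem h1 (p.mul_mem_left _ hm2)) (p.mul_mem_left _ hwp)
    rw [s0, map_zero, zero_add] at hsum
    have s1 : s 1 = 0 := by
      by_contra h
      refine hm2s _ h ?_
      have : aeval θ (s 1) * m2 = (aeval θ (s 1) * m2 + aeval θ (s 2) * w) + (- aeval θ (s 2)) * w := by ring
      rw [this]
      exact Ideal.add_mem _ (Ideal.mem_sup_left hsum) (Ideal.mem_sup_right (Ideal.mul_mem_left _ _ hw))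
    rw [s1, map_zero, zero_mul, zero_add] at hsum
    have s2 : s 2 ≠ 0 := by
      intro s2
      apply hs
      funext i; fin_cases i
      · exact s0
      · exact s1
      · exact s2
    exact hwH (primary_cancel hH hr hsum (hns _ s2))
  have hxx : x * x ∈ H := sq _ (by rw [pow_two]; exact Ideal.mul_mem_mul hxp hxp) (hx.mul hx)
  have hxy : x * y ∈ H := sq _ (by rw [pow_two]; exact Ideal.mul_mem_mul hxp hyp) (hx.mul hy)
  have hyy : y * y ∈ H := sq _ (by rw [pow_two]; exact Ideal.mul_mem_mul hyp hyp) (hy.mul hy)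
  obtain ⟨D, s, hs, -, -, hsum⟩ := dep hC hm θ hθ ![1, x, y] ![0, 1, 1]
      (by intro i; fin_cases i
          · exact isHomogeneous_one _ _
          · exact hx
          · exact hy)
      (by intro i; fin_cases i <;> simp)
  simp only [Fin.sum_univ_three, Matrix.cons_val_zero, Matrix.cons_val_one, Matrix.cons_val, mul_one] at hsum
  have s0 : s 0 = 0 := by
    by_contra h
    refine hns _ h ?_
    have h1 := hHp hsum
    have : aeval θ (s 0) = (aeval θ (s 0) + aeval θ (s 1) * x + aeval θ (s 2) * y)
      - aeval θ (s 1) * x - aeval θ (s 2) * y := by ring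
    rw [this]
    exact p.sub_mem (p.sub_mem h1 (p.mul_mem_left _ hxp)) (p.mul_mem_left _ hyp)
  rw [s0, map_zero, zero_add] at hsum
  have hs12 : aeval θ (s 1) ∉ p ∨ aeval θ (s 2) ∉ p := by
    by_contra hcon
    push Not at hcon
    apply hs
    funext i; fin_cases i
    · exact s0
    · by_contra h; exact hns _ h hcon.1
    · by_contra h; exact hns _ h hcon.2
  obtain ⟨g, a, b, hg, ha, hb, hcop⟩ := U.gcd _ _ hs12
  have hHsq : ∀ α ∈ p, ∀ β ∈ p, α * β ∈ H := by
    intro α hα β hβ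
    obtain ⟨s, t, rfl⟩ := Ideal.mem_span_pair.1 hα
    obtain ⟨s', t', rfl⟩ := Ideal.mem_span_pair.1 hβ
    have : (s * x + t * y) * (s' * x + t' * y) = s * s' * (x * x) + (s * t' + t * s') * (x * y)
      + t * t' * (y * y) := by ring
    rw [this]
    exact H.add_mem (H.add_mem (H.mul_mem_left _ hxx) (H.mul_mem_left _ hxy)) (H.mul_mem_left _ hyy)
  have hab : a * x + b * y ∈ H := by
    refine primary_cancel hH hr (a := g) ?_ hg
    have : g * (a * x + b * y) = (aeval θ (s 1) * x + aeval θ (s 2) * y)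
      - (aeval θ (s 1) - g * a) * x - (aeval θ (s 2) - g * b) * y := by ring
    rw [this]
    exact H.sub_mem (H.sub_mem hsum (hHsq _ ha _ hxp)) (hHsq _ hb _ hyp)
  refine ⟨a, b, hcop, le_antisymm ?_ ?_⟩
  · intro r hrH
    obtain ⟨r1, r2, rfl⟩ := Ideal.mem_span_pair.1 (hHp hrH)
    have hD : a * r2 - b * r1 ∈ p := by
      by_contra hD
      apply hnp
      rw [hp, Ideal.span_le]
      rintro z (rfl | rfl)
      · refine primary_cancel hH hr (a := a * r2 - b * r1) ?_ hD
        have : (a * r2 - b * r1) * z = r2 * (a * z + b * y) - b * (r1 * z + r2 * y) := by ring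
        rw [this]; exact H.sub_mem (H.mul_mem_left _ hab) (H.mul_mem_left _ hrH)
      · refine primary_cancel hH hr (a := a * r2 - b * r1) ?_ hD
        have : (a * r2 - b * r1) * z = a * (r1 * x + r2 * z) - r1 * (a * x + b * z) := by ring
        rw [this]; exact H.sub_mem (H.mul_mem_left _ hrH) (H.mul_mem_left _ hab)
    obtain ⟨γ, h1, h2⟩ := hcop r2 (-r1) (by convert hD using 1; ring)
    have : r1 * x + r2 * y = γ * (a * x + b * y) - (-r1 + γ * a) * x + (r2 - γ * b) * y := by ring
    rw [this]
    exact Ideal.add_mem _ (Ideal.sub_mem _ (Ideal.mul_mem_left _ _ (mem_HI.2 ⟨0, 0, 0, 1, by ring⟩))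
      (sq_mem_HI h2 hxp)) (sq_mem_HI h1 hyp)
  · intro z hz
    obtain ⟨s, t, u, γ, rfl⟩ := mem_HI.1 hz
    exact H.add_mem (H.add_mem (H.add_mem (H.mul_mem_left _ hxx) (H.mul_mem_left _ hxy))
      (H.mul_mem_left _ hyy)) (H.mul_mem_left _ hab)

end structureH

section homdiv
variable {k : Type} [Field k] {d : ℕ}

/-- grading map -/
def grMap (k : Type) [Field k] (d : ℕ) :
    MvPolynomial (Fin d) k →ₐ[k] Polynomial (MvPolynomial (Fin d) k) :=
  aeval (fun i => Polynomial.X * Polynomial.C (X i))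

lemma grMap_hom {f : MvPolynomial (Fin d) k} {e : ℕ} (hf : f.IsHomogeneous e) :
    grMap k d f = Polynomial.monomial e f := by
  rw [grMap, hom_scale hf (fun i => Polynomial.C (X i : MvPolynomial (Fin d) k)) Polynomial.X]
  have : (aeval (fun i => Polynomial.C (X i)) f : Polynomial (MvPolynomial (Fin d) k)) = Polynomial.C f := by
    have h := congrArg (fun φ : MvPolynomial (Fin d) k →ₐ[k] Polynomial (MvPolynomial (Fin d) k) => φ f)
      (MvPolynomial.algHom_ext (f := aeval (fun i => Polynomial.C (X i)))
        (g := (Polynomial.CAlgHom : MvPolynomial (Fin d) k →ₐ[k] Polynomial (MvPolynomial (Fin d) k)))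
        (by intro i; simp))
    simpa using h
  rw [this, ← Polynomial.C_mul_X_pow_eq_monomial, mul_comm]

lemma grMap_coeff (f : MvPolynomial (Fin d) k) (j : ℕ) :
    (grMap k d f).coeff j = homogeneousComponent j f := by
  conv_lhs => rw [← sum_homogeneousComponent f]
  rw [map_sum, Polynomial.finsetSum_coeff]
  simp_rw [grMap_hom (homogeneousComponent_isHomogeneous _ f), Polynomial.coeff_monomial]
  rw [Finset.sum_ite_eq']
  split_ifs with h
  · rfl
  · rw [homogeneousComponent_eq_zero]
    simp at h; omega

lemma hom_of_mul {f g : MvPolynomial (Fin d) k} {n : ℕ} (h : (f * g).IsHomogeneous n) (h0 : f * g ≠ 0) :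
    ∃ i, i ≤ n ∧ f.IsHomogeneous i ∧ g.IsHomogeneous (n - i) := by
  have hf0 : f ≠ 0 := left_ne_zero_of_mul h0
  have hg0 : g ≠ 0 := right_ne_zero_of_mul h0
  have inj : ∀ z : MvPolynomial (Fin d) k, z ≠ 0 → grMap k d z ≠ 0 := by
    intro z hz h
    apply hz
    rw [← sum_homogeneousComponent z]
    refine Finset.sum_eq_zero fun i _ => ?_
    rw [← grMap_coeff, h, Polynomial.coeff_zero]
  have key : ∀ z : MvPolynomial (Fin d) k, z ≠ 0 → (grMap k d z).natDegree = (grMap k d z).natTrailingDegree →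
      z.IsHomogeneous (grMap k d z).natDegree := by
    intro z hz h
    have : ∀ j, j ≠ (grMap k d z).natDegree → homogeneousComponent j z = 0 := by
      intro j hj
      rw [← grMap_coeff]
      rcases lt_or_gt_of_ne hj with h1 | h1
      · exact Polynomial.coeff_eq_zero_of_lt_natTrailingDegree (h ▸ h1)
      · exact Polynomial.coeff_eq_zero_of_natDegree_lt h1
    have hz2 : homogeneousComponent (grMap k d z).natDegree z = z := by
      conv_rhs => rw [← sum_homogeneousComponent z]
      rw [Finset.sum_eq_single (grMap k d z).natDegree]
      · intro b _ hb; exact this b hb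
      · intro hb
        rw [homogeneousComponent_eq_zero]
        simp at hb; omega
    rw [← hz2]
    convert homogeneousComponent_isHomogeneous _ z using 1
    rw [hz2]
  have hm := grMap_hom h
  rw [map_mul] at hm
  have e1 := Polynomial.natDegree_mul (inj f hf0) (inj g hg0)
  have e2 := Polynomial.natTrailingDegree_mul (inj f hf0) (inj g hg0)
  rw [hm, Polynomial.natDegree_monomial_eq _ h0] at e1
  rw [hm, Polynomial.natTrailingDegree_monomial h0] at e2
  have l1 := Polynomial.natTrailingDegree_le_natDegree (grMap k d f)
  have l2 := Polynomial.natTrailingDegree_le_natDegree (grMap k d g)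
  refine ⟨(grMap k d f).natDegree, by omega, key f hf0 (by omega), ?_⟩
  have := key g hg0 (by omega)
  rwa [show n - (grMap k d f).natDegree = (grMap k d g).natDegree by omega]

end homdiv

section quad
variable {k : Type} [Field k] {d : ℕ}

lemma exists_quad_root [IsAlgClosed k] (l m : k) : ∃ z : k, z ^ 2 + l * z + m = 0 := by
  obtain ⟨z, hz⟩ := IsAlgClosed.exists_root
    (Polynomial.C 1 * Polynomial.X ^ 2 + Polynomial.C l * Polynomial.X + Polynomial.C m : Polynomial k)
    (by rw [Polynomial.degree_quadratic one_ne_zero]; norm_num)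
  refine ⟨z, ?_⟩
  simpa [Polynomial.IsRoot] using hz

lemma const_of_hom_zero {f : MvPolynomial (Fin d) k} (h : f.IsHomogeneous 0) : ∃ c : k, f = C c :=
  ⟨_, (totalDegree_eq_zero_iff_eq_C).1 (Nat.le_zero.1 h.totalDegree_le)⟩

/-- square from vanishing derivatives in characteristic two -/
lemma sq_of_pderiv [IsAlgClosed k] [CharP k 2] (c : MvPolynomial (Fin d) k)
    (h : ∀ i, pderiv i c = 0) : ∃ e, e ^ 2 = c := by
  have hp : Fact (Nat.Prime 2) := ⟨Nat.prime_two⟩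
  have hev : ∀ n ∈ c.support, ∃ m : Fin d →₀ ℕ, n = 2 • m := by
    intro n hn
    have hn' : ∀ i, 2 ∣ n i := by
      intro i
      by_cases h0 : n i = 0
      · simp [h0]
      have := congrArg (coeff (n - Finsupp.single i 1)) (h i)
      rw [coeff_pderiv, coeff_zero] at this
      have e : n - Finsupp.single i 1 + Finsupp.single i 1 = n :=
        tsub_add_cancel_of_le (Finsupp.single_le_iff.2 (by omega))
      rw [e] at this
      have h2 := (mul_eq_zero.1 this).resolve_left (mem_support_iff.1 hn)
      have h3 : ((n i : ℕ) : k) = 0 := by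
        rw [← h2]
        have : n i = (n i - 1) + 1 := by omega
        conv_lhs => rw [this]
        simp
      exact (CharP.cast_eq_zero_iff k 2 _).1 h3
    refine ⟨n.mapRange (fun t => t / 2) (by simp), ?_⟩
    ext i
    simp
    have := hn' i
    omega
  choose! m hm using hev
  have hs : ∀ a : k, ∃ b : k, b ^ 2 = a := fun a => by
    obtain ⟨z, hz⟩ := IsAlgClosed.exists_pow_nat_eq a (n := 2) (by norm_num)
    exact ⟨z, hz⟩
  choose s hs using hs
  refine ⟨∑ n ∈ c.support, monomial (m n) (s (coeff n c)), ?_⟩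
  rw [CharTwo.sum_sq]
  conv_rhs => rw [c.as_sum]
  refine Finset.sum_congr rfl fun n hn => ?_
  rw [monomial_pow, hs, ← hm n hn]

end quad

section quadroot
variable {k : Type} [Field k] {d : ℕ}

lemma range_lf1 (a : Fin d → k) : (Set.range fun i => lf ((![a] : Fin 1 → _) i)) = {lf a} := by
  ext z; simp

lemma range_lf2 (a b : Fin d → k) : (Set.range fun i => lf ((![a, b] : Fin 2 → _) i)) = {lf a, lf b} := by
  ext z; simp [Fin.exists_fin_two, eq_comm]

lemma range_lf3 (a b c : Fin d → k) :
    (Set.range fun i => lf ((![a, b, c] : Fin 3 → _) i)) = {lf a, lf b, lf c} := by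
  ext z; simp [Fin.exists_fin_succ, eq_comm]

lemma not_unit_of_hom {γ : MvPolynomial (Fin d) k} {m : ℕ} (hm : 1 ≤ m) (h : γ.IsHomogeneous m) : ¬ IsUnit γ := by
  intro hu
  obtain ⟨g, hg⟩ := hu.exists_right_inv
  have h1 : (γ * g).IsHomogeneous 0 := by rw [hg]; exact isHomogeneous_one _ _
  obtain ⟨i, hi, hγ, -⟩ := hom_of_mul h1 (by rw [hg]; exact one_ne_zero)
  have := hγ.inj_right h hu.ne_zero
  omega

lemma const_of_dvd {γ μ Δ : MvPolynomial (Fin d) k} {m j n : ℕ} (hm : 1 ≤ m) (hj : j = n) (hj1 : 1 ≤ j)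
    (hγ : γ.IsHomogeneous m)
    (hΔ : Δ.IsHomogeneous n) (h0 : Δ ≠ 0) (h : Δ = γ ^ j * μ) : m = 1 ∧ ∃ c, μ = C c := by
  subst hj
  rw [h] at hΔ h0
  obtain ⟨i, hi, h1, h2⟩ := hom_of_mul hΔ h0
  have := h1.inj_right (hγ.pow j) (left_ne_zero_of_mul h0)
  have hmj : m * j ≤ 1 * j := by omega
  have hm1 : m = 1 := le_antisymm (Nat.le_of_mul_le_mul_right hmj hj1) hm
  refine ⟨hm1, const_of_hom_zero ?_⟩
  rw [hm1] at this
  rwa [show j - i = 0 by omega] at h2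

lemma decomp_two {α β γ : MvPolynomial (Fin d) k} (hβ : β.IsHomogeneous 1) (hγ : γ.IsHomogeneous 1)
    (hα : α.IsHomogeneous 2) (h : α ∈ Ideal.span {β, γ}) :
    ∃ e a : MvPolynomial (Fin d) k, e.IsHomogeneous 1 ∧ α = e * β + a * γ := by
  obtain ⟨e, a, h⟩ := Ideal.mem_span_pair.1 h
  have h2 := congrArg (homogeneousComponent 2) h
  rw [homogeneousComponent_eq_self hα, map_add] at h2
  have h3 := comp_aeval_mul X (fun i => isHomogeneous_X k i) hβ e 2
  have h4 := comp_aeval_mul X (fun i => isHomogeneous_X k i) hγ a 2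
  simp only [aeval_X_left, AlgHom.id_apply] at h3 h4
  rw [h3, h4] at h2
  exact ⟨_, _, homogeneousComponent_isHomogeneous 1 e, h2.symm⟩

lemma quad_root [IsAlgClosed k] {m : ℕ} (hm : 1 ≤ m) {α β γ b b' c c' : MvPolynomial (Fin d) k}
    (hγ0 : γ ≠ 0) (hγ : γ.IsHomogeneous m) (hβ : β.IsHomogeneous m) (hα : α.IsHomogeneous (m + 1))
    (hb : b.IsHomogeneous 1) (hc : c.IsHomogeneous 2)
    (hrel : IsRelPrime γ β) (h1 : 2 * α - β * b + γ * b' = 0)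
    (h2 : α ^ 2 - α * β * b + β ^ 2 * c = γ ^ 2 * c') :
    ∃ s, s ^ 2 + b * s + c = 0 := by
  have hrel2 : IsRelPrime (γ ^ 2) (β ^ 2) := hrel.pow
  by_cases hch : (2 : k) = 0
  · have : CharP k 2 := CharTwo.of_one_ne_zero_of_two_eq_zero one_ne_zero hch
    have two0 : (2 : MvPolynomial (Fin d) k) = 0 := by
      have := congrArg (C : k → MvPolynomial (Fin d) k) hch
      rwa [map_ofNat, map_zero] at this
    by_cases hb0 : b = 0
    · have hb' : b' = 0 := by
        rw [hb0, two0] at h1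
        simp at h1
        exact h1.resolve_left hγ0
      have hder : ∀ i, pderiv i c = 0 := by
        intro i
        have h3 := congrArg (pderiv i) h2
        rw [hb0] at h3
        have hsq : ∀ z : MvPolynomial (Fin d) k, pderiv i (z ^ 2) = 0 := by
          intro z
          rw [pow_two, Derivation.leibniz, smul_eq_mul]
          rw [← two_mul, two0, zero_mul]
        simp only [mul_zero, sub_zero, map_add, Derivation.leibniz, hsq, smul_eq_mul, zero_add, mul_zero, add_zero] at h3
        have hdv : γ ^ 2 ∣ pderiv i c := hrel2.dvd_of_dvd_mul_left ⟨_, h3⟩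
        by_contra hne
        obtain ⟨μ, hμ⟩ := hdv
        have hh : (pderiv i c).IsHomogeneous (2 - 1) := hc.pderiv
        rw [hμ] at hh hne
        obtain ⟨j, hj, h5, -⟩ := hom_of_mul hh hne
        have := h5.inj_right (hγ.pow 2) (left_ne_zero_of_mul hne)
        omega
      obtain ⟨e, he⟩ := sq_of_pderiv c hder
      refine ⟨e, ?_⟩
      rw [hb0, he, zero_mul, add_zero]
      linear_combination c * two0
    · have hdv : γ ∣ b := by
        refine hrel.dvd_of_dvd_mul_left ⟨b', ?_⟩
        rw [two0] at h1
        linear_combination -h1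
      obtain ⟨lam, hl⟩ := hdv
      obtain ⟨hm1, l, rfl⟩ := const_of_dvd (j := 1) hm rfl le_rfl hγ hb hb0 (by rw [pow_one]; exact hl)
      subst hm1
      -- α ∈ (β, γ)
      obtain ⟨cβ, rfl⟩ := exists_lf hβ
      obtain ⟨cγ, rfl⟩ := exists_lf hγ
      have hli : LinearIndependent k ![cβ, cγ] := by
        rw [LinearIndependent.pair_iff]
        intro s t hst
        have hst' : C s * lf cβ + C t * lf cγ = 0 := by
          rw [← smul_eq_C_mul, ← smul_eq_C_mul, ← map_smul, ← map_smul, ← map_add, hst, map_zero]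
        have hs : s = 0 := by
          by_contra hs
          refine not_unit_of_hom le_rfl hγ (hrel dvd_rfl ?_)
          refine ⟨C (-t / s), ?_⟩
          have h4 : C s * lf cβ = C s * (lf cγ * C (-t / s)) := by
            have : (C s * C (-t / s) : MvPolynomial (Fin d) k) = - C t := by
              rw [← map_mul, ← map_neg]; congr 1; field_simp
            linear_combination hst' - lf cγ * this
          exact mul_left_cancel₀ (by simpa using hs) h4
        refine ⟨hs, ?_⟩
        rw [hs, map_zero, zero_mul, zero_add] at hst'
        simpa using (mul_eq_zero.1 hst').resolve_right hγ0
      have hpr := (ufdi_lf _ hli).prime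
      rw [range_lf2] at hpr
      have hαm : α ∈ Ideal.span {lf cβ, lf cγ} := by
        refine hpr.mem_of_pow_mem 2 (Ideal.mem_span_pair.2 ⟨α * b - lf cβ * c, lf cγ * c', ?_⟩)
        linear_combination -h2
      obtain ⟨e, a, he, hαe⟩ := decomp_two hβ hγ hα hαm
      have hX : (e ^ 2 + b * e + c).IsHomogeneous 2 := by
        refine ((he.pow 2).add ?_).add hc
        exact hb.mul he
      have hdv : lf cγ ^ 2 ∣ e ^ 2 + b * e + c := by
        refine hrel2.dvd_of_dvd_mul_left ⟨c' - a ^ 2 + a * lf cβ * C l , ?_⟩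
        have h3 := h2
        rw [hαe, hl] at h3
        rw [hl]
        linear_combination h3 + (- e * lf cβ * a * lf cγ + lf cγ * C l * e * lf cβ ^ 2) * two0
      have : ∃ μ : k, e ^ 2 + b * e + c = lf cγ ^ 2 * C μ := by
        by_cases h0 : e ^ 2 + b * e + c = 0
        · exact ⟨0, by rw [h0]; simp⟩
        · obtain ⟨μ, hμ⟩ := hdv
          obtain ⟨-, c0, rfl⟩ := const_of_dvd (j := 2) le_rfl rfl (by norm_num) hγ hX h0 hμ
          exact ⟨c0, hμ⟩
      obtain ⟨μ, hμ⟩ := this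
      obtain ⟨z, hz⟩ := exists_quad_root l μ
      refine ⟨e + lf cγ * C z, ?_⟩
      have hz' := congrArg (C : k → MvPolynomial (Fin d) k) hz
      simp only [map_add, map_mul, map_pow, map_zero] at hz'
      have : b * (lf cγ * C z) = lf cγ ^ 2 * C l * C z := by rw [hl]; ring
      linear_combination hμ + lf cγ ^ 2 * hz' + this + e * lf cγ * C z * two0
  · have h4 : β ^ 2 * (b ^ 2 - 4 * c) = γ ^ 2 * (b' ^ 2 - 4 * c') := by
      linear_combination (-4) * h2 + (2 * α - β * b - γ * b') * h1
    have hdv : γ ^ 2 ∣ b ^ 2 - 4 * c := hrel2.dvd_of_dvd_mul_left ⟨_, h4⟩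
    have hΔ : (b ^ 2 - 4 * c).IsHomogeneous 2 := by
      refine (hb.pow 2).sub ?_
      have := hc.C_mul 4
      rwa [map_ofNat] at this
    have : ∃ μ : k, b ^ 2 - 4 * c = γ ^ 2 * C μ := by
      by_cases h0 : b ^ 2 - 4 * c = 0
      · exact ⟨0, by rw [h0]; simp⟩
      · obtain ⟨μ, hμ⟩ := hdv
        obtain ⟨-, c0, rfl⟩ := const_of_dvd (j := 2) hm rfl (by norm_num) hγ hΔ h0 hμ
        exact ⟨c0, hμ⟩
    obtain ⟨μ, hμ⟩ := this
    obtain ⟨ν, hν⟩ := IsAlgClosed.exists_pow_nat_eq μ (n := 2) (by norm_num)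
    have hh : (2 : MvPolynomial (Fin d) k) * C (2⁻¹ : k) = 1 := by
      have : (2 : MvPolynomial (Fin d) k) = C 2 := by rw [map_ofNat]
      rw [this, ← map_mul, mul_inv_cancel₀ hch, map_one]
    refine ⟨C 2⁻¹ * (γ * C ν - b), ?_⟩
    rw [← hν, map_pow] at hμ
    set w := (C (2⁻¹ : k) : MvPolynomial (Fin d) k)
    linear_combination (-w^2) * hμ + (w * b ^ 2 - w * b * γ * C ν - 2 * w * c - c) * hh
end quadroot

section linform

lemma exists_min {B A : Type} [CommRing B] [IsDomain B] [IsIntegrallyClosed B] [CommRing A] [IsDomain A]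
    (f : B →+* A) (hf : Function.Injective f) {r : A}
    (hr : ∃ p : Polynomial B, p.Monic ∧ p.eval₂ f r = 0) {q : Polynomial B} (hq : q ≠ 0)
    (hqr : q.eval₂ f r = 0) :
    ∃ M : Polynomial B, M.Monic ∧ M.eval₂ f r = 0 ∧ 0 < M.natDegree ∧ M.natDegree ≤ q.natDegree := by
  letI := f.toAlgebra
  haveI : FaithfulSMul B A := (faithfulSMul_iff_algebraMap_injective B A).2 hf
  haveI : Module.IsTorsionFree B A := inferInstance
  have hinteg : IsIntegral B r := hr
  have hd := minpoly.isIntegrallyClosed_dvd hinteg (p := q) hqr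
  exact ⟨minpoly B r, minpoly.monic hinteg, minpoly.aeval B r, minpoly.natDegree_pos hinteg,
    Polynomial.natDegree_le_of_dvd hd hq⟩

lemma lin_int {B A : Type} [CommRing B] [IsDomain B] [IsIntegrallyClosed B] [CommRing A] [IsDomain A]
    (f : B →+* A) (hf : Function.Injective f) {r : A}
    (hr : ∃ p : Polynomial B, p.Monic ∧ p.eval₂ f r = 0) {s t : B} (hs : s ≠ 0)
    (h : f s * r = f t) : ∃ z, r = f z := by
  have hdeg : (Polynomial.C s * Polynomial.X - Polynomial.C t).natDegree = 1 := by
    rw [sub_eq_add_neg, ← Polynomial.C_neg]; exact Polynomial.natDegree_linear hs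
  obtain ⟨M, hM, h1, h2, h3⟩ := exists_min f hf hr (q := Polynomial.C s * Polynomial.X - Polynomial.C t)
    (by intro h0; rw [h0] at hdeg; simp at hdeg) (by simp [h])
  rw [hdeg] at h3
  have h4 : M.natDegree = 1 := by omega
  rw [hM.eq_X_add_C h4] at h1
  simp at h1
  exact ⟨-M.coeff 0, by rw [map_neg]; exact eq_neg_of_add_eq_zero_left h1⟩

lemma quad_int {B A : Type} [CommRing B] [IsDomain B] [IsIntegrallyClosed B] [CommRing A] [IsDomain A]
    (f : B →+* A) (hf : Function.Injective f) {r : A}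
    (hr : ∃ p : Polynomial B, p.Monic ∧ p.eval₂ f r = 0) {s0 s1 s2 : B} (hs : ¬ (s0 = 0 ∧ s1 = 0 ∧ s2 = 0))
    (h : f s0 + f s1 * r + f s2 * r ^ 2 = 0) :
    (∃ z, r = f z) ∨ ∃ b c, r ^ 2 + f b * r + f c = 0 := by
  obtain ⟨M, hM, h1, h2, h3⟩ := exists_min f hf hr
    (q := Polynomial.C s2 * Polynomial.X ^ 2 + Polynomial.C s1 * Polynomial.X + Polynomial.C s0)
    (by
      intro h0
      have e0 := congrArg (fun p => Polynomial.coeff p 0) h0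
      have e1 := congrArg (fun p => Polynomial.coeff p 1) h0
      have e2 := congrArg (fun p => Polynomial.coeff p 2) h0
      simp [Polynomial.coeff_X, Polynomial.coeff_C] at e0 e1 e2
      exact hs ⟨e0, e1, e2⟩)
    (by simp; linear_combination h)
  have h4 := h3.trans Polynomial.natDegree_quadratic_le
  rcases (by omega : M.natDegree = 1 ∨ M.natDegree = 2) with h5 | h5
  · left
    rw [hM.eq_X_add_C h5] at h1
    simp at h1
    exact ⟨-M.coeff 0, by rw [map_neg]; exact eq_neg_of_add_eq_zero_left h1⟩
  · right
    rw [Polynomial.eval₂_eq_sum_range, h5] at h1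
    simp [Finset.sum_range_succ] at h1
    have h6 : M.coeff 2 = 1 := by rw [← h5]; exact hM
    rw [h6] at h1
    refine ⟨M.coeff 1, M.coeff 0, ?_⟩
    rw [map_one] at h1
    linear_combination h1

variable {k : Type} [Field k] {N d : ℕ}

lemma exists_linform [IsAlgClosed k] {P : Ideal (MvPolynomial (Fin N) k)} (hP : P.IsPrime) (hC : CompCl P)
    (hm : HasMultiplicity P d 2) (θ : Fin d → MvPolynomial (Fin N) k) (u v : MvPolynomial (Fin N) k)
    (hθ : ∀ i, (θ i).IsHomogeneous 1) (hu : u.IsHomogeneous 1) (hv : v.IsHomogeneous 1)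
    (hinj : ∀ b : MvPolynomial (Fin d) k, aeval θ b ∈ P → b = 0)
    (hinteg : ∀ r, ∃ p : Polynomial (MvPolynomial (Fin d) k), p.Monic ∧
      p.eval₂ (aeval θ : MvPolynomial (Fin d) k →ₐ[k] MvPolynomial (Fin N) k).toRingHom r ∈ P)
    (hind : ∀ (c c' : k) (b : MvPolynomial (Fin d) k), c • u + c' • v + aeval θ b = 0 → c = 0 ∧ c' = 0) :
    ∃ l ∈ P, l.IsHomogeneous 1 ∧ l ≠ 0 := by
  by_contra hno
  push Not at hno
  let A := MvPolynomial (Fin N) k ⧸ P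
  let f : MvPolynomial (Fin d) k →+* A := (Ideal.Quotient.mk P).comp
    (aeval θ : MvPolynomial (Fin d) k →ₐ[k] MvPolynomial (Fin N) k).toRingHom
  have hfa : ∀ b, f b = Ideal.Quotient.mk P (aeval θ b) := fun b => rfl
  haveI : IsDomain A := Ideal.Quotient.isDomain P
  have hf : Function.Injective f := by
    rw [injective_iff_map_eq_zero]
    intro b hb
    exact hinj b (Ideal.Quotient.eq_zero_iff_mem.1 hb)
  have hI : ∀ r : A, ∃ p : Polynomial (MvPolynomial (Fin d) k), p.Monic ∧ p.eval₂ f r = 0 := by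
    intro r
    obtain ⟨r, rfl⟩ := Ideal.Quotient.mk_surjective r
    obtain ⟨p, hp, h⟩ := hinteg r
    refine ⟨p, hp, ?_⟩
    rw [← Ideal.Quotient.eq_zero_iff_mem, Polynomial.hom_eval₂] at h
    exact h
  have compθ : ∀ (b : MvPolynomial (Fin d) k) i, homogeneousComponent i (aeval θ b) = aeval θ (homogeneousComponent i b) :=
    fun b i => comp_aeval θ hθ b i
  have hN : ∀ (c c' : k) b, Ideal.Quotient.mk P (c • u + c' • v) = f b → c = 0 ∧ c' = 0 := by
    intro c c' b h
    rw [hfa, Ideal.Quotient.eq] at h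
    have h1 := hC _ h 1
    have hcu : (c • u + c' • v).IsHomogeneous 1 := by
      rw [smul_eq_C_mul, smul_eq_C_mul]; exact (hu.C_mul c).add (hv.C_mul c')
    rw [map_sub, homogeneousComponent_eq_self hcu, compθ] at h1
    have hh : (aeval θ (homogeneousComponent 1 b) : MvPolynomial (Fin N) k).IsHomogeneous 1 := by
      rw [← compθ]; exact homogeneousComponent_isHomogeneous _ _
    have h2 := hno _ h1 (hcu.sub hh)
    refine hind c c' (- homogeneousComponent 1 b) ?_
    rw [map_neg, ← sub_eq_add_neg]; exact h2
  have hNu : ∀ b, Ideal.Quotient.mk P u ≠ f b := by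
    intro b h
    have := hN 1 0 b (by simpa using h)
    exact one_ne_zero this.1
  have hNv : ∀ b, Ideal.Quotient.mk P v ≠ f b := by
    intro b h
    have := hN 0 1 b (by simpa using h)
    exact one_ne_zero this.2
  have hquad : ∀ w : MvPolynomial (Fin N) k, w.IsHomogeneous 1 → (∀ b, Ideal.Quotient.mk P w ≠ f b) →
      ∃ b c, b.IsHomogeneous 1 ∧ c.IsHomogeneous 2 ∧
        (Ideal.Quotient.mk P w) ^ 2 + f b * Ideal.Quotient.mk P w + f c = 0 := by
    intro w hw hwN
    obtain ⟨D, s, hs, -, -, hsum⟩ := dep hC hm θ hθ ![1, w, w * w] ![0, 1, 2]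
      (by intro i; fin_cases i
          · exact isHomogeneous_one _ _
          · exact hw
          · exact hw.mul hw)
      (by intro i; fin_cases i <;> simp)
    simp only [Fin.sum_univ_three, Matrix.cons_val_zero, Matrix.cons_val_one, Matrix.cons_val, mul_one] at hsum
    rw [← Ideal.Quotient.eq_zero_iff_mem] at hsum
    rcases quad_int f hf (hI (Ideal.Quotient.mk P w)) (s0 := s 0) (s1 := s 1) (s2 := s 2)
      (by rintro ⟨a, b, c⟩
          apply hs
          funext i; fin_cases i
          · exact a
          · exact b
          · exact c)
      (by rw [← hsum, hfa, hfa, hfa]; simp [pow_two]) with ⟨z, hz⟩ | ⟨b, c, h⟩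
    · exact absurd hz (hwN z)
    · refine ⟨homogeneousComponent 1 b, homogeneousComponent 2 c, homogeneousComponent_isHomogeneous _ _,
        homogeneousComponent_isHomogeneous _ _, ?_⟩
      rw [hfa, hfa, ← map_pow, ← map_mul, ← map_add, ← map_add, Ideal.Quotient.eq_zero_iff_mem] at h
      have h1 := hC _ h 2
      rw [map_add, map_add, compθ, homogeneousComponent_eq_self (hw.pow 2),
        comp_aeval_mul θ hθ hw] at h1
      rw [hfa, hfa, ← map_pow, ← map_mul, ← map_add, ← map_add, Ideal.Quotient.eq_zero_iff_mem]
      exact h1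
  obtain ⟨b, c, hb, hc, hbc⟩ := hquad u hu hNu
  obtain ⟨b', c', hb', hc', hbc'⟩ := hquad v hv hNv
  obtain ⟨D, s, hs, hsh, hsD, hsum⟩ := dep hC hm θ hθ ![1, u, v] ![0, 1, 1]
      (by intro i; fin_cases i
          · exact isHomogeneous_one _ _
          · exact hu
          · exact hv)
      (by intro i; fin_cases i <;> simp)
  simp only [Fin.sum_univ_three, Matrix.cons_val_zero, Matrix.cons_val_one, Matrix.cons_val, mul_one] at hsum
  rw [← Ideal.Quotient.eq_zero_iff_mem] at hsum
  simp only [map_add, map_mul, ← hfa] at hsum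
  set U := Ideal.Quotient.mk P u with hU
  set V := Ideal.Quotient.mk P v with hV
  have hindU : ∀ s t, f s + f t * U = 0 → s = 0 ∧ t = 0 := by
    intro s t h
    have ht : t = 0 := by
      by_contra ht
      obtain ⟨z, hz⟩ := lin_int f hf (hI U) (s := t) (t := -s) ht (by rw [map_neg]; linear_combination h)
      exact hNu z hz
    rw [ht, map_zero, zero_mul, add_zero] at h
    exact ⟨hf (by rw [h, map_zero]), ht⟩
  have hγ0 : s 2 ≠ 0 := by
    intro h
    rw [h, map_zero, zero_mul, add_zero] at hsum
    obtain ⟨h0, h1⟩ := hindU _ _ hsum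
    apply hs
    funext i; fin_cases i
    · exact h0
    · exact h1
    · exact h
  have hβ0 : s 1 ≠ 0 := by
    intro h
    rw [h, map_zero, zero_mul, add_zero] at hsum
    obtain ⟨z, hz⟩ := lin_int f hf (hI V) (s := s 2) (t := - s 0) hγ0 (by rw [map_neg]; linear_combination hsum)
    exact hNv z hz
  obtain ⟨γ, β, g, hrel, hγ, hβ⟩ := UniqueFactorizationMonoid.exists_reduced_factors (s 2) hγ0 (s 1)
  have hh2 := hsh 2
  have hh1 := hsh 1
  simp only [Matrix.cons_val_one, Matrix.cons_val] at hh1 hh2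
  rw [← hγ] at hh2 hγ0
  rw [← hβ] at hh1 hβ0
  obtain ⟨i, hi, hg1, hγh⟩ := hom_of_mul hh2 hγ0
  obtain ⟨j, hj, hg2, hβh⟩ := hom_of_mul hh1 hβ0
  have hg0 : g ≠ 0 := left_ne_zero_of_mul hγ0
  have hγ1 : γ ≠ 0 := right_ne_zero_of_mul hγ0
  have hβ1 : β ≠ 0 := right_ne_zero_of_mul hβ0
  have hij := hg1.inj_right hg2 hg0
  subst hij
  set m := D - 1 - i with hmdef
  rw [← hγ, ← hβ, map_mul, map_mul] at hsum
  obtain ⟨z, hz⟩ := lin_int f hf (hI (f γ * V + f β * U)) (s := g) (t := -s 0) hg0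
    (by rw [map_neg]; linear_combination hsum)
  -- homogenize
  have hzh : f γ * V + f β * U = f (homogeneousComponent (m + 1) z) := by
    rw [hfa, hfa, hfa, hU, hV, ← map_mul, ← map_mul, ← map_add, Ideal.Quotient.eq] at hz ⊢
    have h1 := hC _ hz (m + 1)
    have e1 : (aeval θ γ * v + aeval θ β * u).IsHomogeneous (m + 1) := by
      have a1 := hγh.aeval θ hθ
      have a2 := hβh.aeval θ hθ
      rw [one_mul] at a1 a2
      exact (a1.mul hv).add (a2.mul hu)
    rw [map_sub, homogeneousComponent_eq_self e1, compθ] at h1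
    exact h1
  set α := homogeneousComponent (m + 1) z with hα
  have hαh : α.IsHomogeneous (m + 1) := homogeneousComponent_isHomogeneous _ _
  rcases Nat.eq_zero_or_pos m with hm0 | hm0
  · rw [hm0] at hγh hβh
    obtain ⟨c0, rfl⟩ := const_of_hom_zero hγh
    obtain ⟨c1, rfl⟩ := const_of_hom_zero hβh
    have := hN c1 c0 α (by
      rw [← hzh, hfa, hfa, smul_eq_C_mul, smul_eq_C_mul]
      simp only [map_add, map_mul, algHom_C, ← hU, ← hV, algebraMap_eq]
      ring)
    apply hγ1
    rw [this.2, map_zero]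
  · have hE : f (α ^ 2 - β ^ 2 * c + b' * γ * α + γ ^ 2 * c') +
        f (-β * (2 * α + β * b + γ * b')) * U = 0 := by
      simp only [map_add, map_mul, map_sub, map_pow, map_neg, map_ofNat]
      linear_combination (f γ) ^ 2 * hbc' - (f β) ^ 2 * hbc + (- (f γ * V + f α - f β * U) - f b' * f γ) * hzh
    obtain ⟨hE0, hE1⟩ := hindU _ _ hE
    have hE2 : 2 * α + β * b + γ * b' = 0 :=
      (mul_eq_zero.1 hE1).resolve_left (neg_ne_zero.2 hβ1)
    obtain ⟨t, ht⟩ := quad_root hm0 (α := α) (β := -β) (γ := γ) (b := b) (b' := b') (c := c) (c' := c')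
      hγ1 hγh hβh.neg hαh hb hc (hrel.neg_right)
      (by linear_combination hE2) (by linear_combination -hE0 + α * hE2)
    have hft := congrArg f ht
    simp only [map_add, map_mul, map_pow, map_zero] at hft
    have : (U - f t) * (U + f t + f b) = 0 := by linear_combination hbc - hft
    rcases mul_eq_zero.1 this with h | h
    · exact hNu t (by linear_combination h)
    · exact hNu (-t - b) (by rw [map_sub, map_neg]; linear_combination h)

end linform

section final
variable {k : Type} [Field k] {N d : ℕ}

lemma li_one {c : Fin N → k} (hc : c ≠ 0) : LinearIndependent k (![c] : Fin 1 → Fin N → k) := by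
  rw [linearIndependent_unique_iff]; simpa using hc

lemma prime_lf1 {c : Fin N → k} (hc : c ≠ 0) : (Ideal.span {lf c}).IsPrime := by
  have := (ufdi_lf _ (li_one hc)).prime
  rwa [range_lf1] at this

lemma structP {P : Ideal (MvPolynomial (Fin N) k)} (hP : P.IsPrime) (hh : P.height = 2)
    {c : Fin N → k} (hc : c ≠ 0) (hl : lf c ∈ P) :
    ∃ q, P = Ideal.span {lf c, q} ∧ q ∉ Ideal.span {lf c} := by
  obtain ⟨-, θ, π₀, hθ, hπθ₀, hπ₀⟩ := coord_proj _ (li_one hc)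
  rw [range_lf1] at hπ₀
  obtain ⟨π, hρ⟩ : ∃ ρ : MvPolynomial (Fin N) k →+* MvPolynomial (Fin (N - Nat.succ 0)) k,
      ∀ r, ρ r = π₀ r := ⟨π₀.toRingHom, fun _ => rfl⟩
  have hπθ : ∀ s, π (aeval θ s) = s := fun s => (hρ _).trans (hπθ₀ s)
  have hπ : ∀ r, π r = 0 ↔ r ∈ Ideal.span {lf c} := fun r => by rw [hρ]; exact hπ₀ r
  have hsurj : Function.Surjective π := fun s => ⟨_, hπθ s⟩
  have hker : RingHom.ker π ≤ P := by
    intro r hr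
    have : r ∈ Ideal.span {lf c} := (hπ r).1 hr
    exact (Ideal.span_singleton_le_iff_mem _).2 hl this
  have hQ : (P.map π).IsPrime := Ideal.map_isPrime_of_surjective hsurj hker
  have hmem : ∀ r, π r ∈ P.map π → r ∈ P := by
    intro r hr
    have : r ∈ (P.map π).comap π := hr
    rw [Ideal.comap_map_of_surjective' _ hsurj, sup_eq_left.2 hker] at this
    exact this
  have hQ0 : P.map π ≠ ⊥ := by
    intro h0
    have : P ≤ Ideal.span {lf c} := by
      intro r hr
      have := Ideal.mem_map_of_mem π hr
      rw [h0, Ideal.mem_bot] at this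
      exact (hπ r).1 this
    exact not_unit_of_hom le_rfl (lf_hom c) (height_one_lt this hh)
  obtain ⟨q', hq'Q, hq'⟩ := hQ.exists_mem_prime_of_ne_bot hQ0
  have hM' : (Ideal.span {q'}).IsPrime := (Ideal.span_singleton_prime hq'.ne_zero).2 hq'
  set M := (Ideal.span {q'}).comap π with hM
  have hMp : M.IsPrime := Ideal.comap_isPrime _ _
  have hMP : M ≤ P := by
    intro r hr
    exact hmem r ((Ideal.span_singleton_le_iff_mem _).2 hq'Q hr)
  have hq : π (aeval θ q') = q' := hπθ q'
  have hqn : aeval θ q' ∉ Ideal.span {lf c} := by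
    intro h
    rw [← hπ, hq] at h
    exact hq'.ne_zero h
  have hlM : lf c ∈ M := by
    have : π (lf c) = 0 := (hπ _).2 (Ideal.mem_span_singleton_self _)
    change π (lf c) ∈ Ideal.span {q'}
    rw [this]; exact Ideal.zero_mem _
  have hlp := prime_lf1 hc
  have lt1 : (⊥ : Ideal (MvPolynomial (Fin N) k)) < Ideal.span {lf c} := by
    rw [bot_lt_iff_ne_bot, Ne, Ideal.span_singleton_eq_bot]
    intro h
    exact hc (lf_inj (by rw [h, map_zero]))
  have lt2 : Ideal.span {lf c} < M := by
    refine lt_of_le_of_ne ((Ideal.span_singleton_le_iff_mem _).2 hlM) ?_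
    intro h
    apply hqn
    rw [h]
    change π (aeval θ q') ∈ Ideal.span {q'}
    rw [hq]; exact Ideal.mem_span_singleton_self _
  have hMeq : M = P := by
    by_contra hne
    have lt3 : M < P := lt_of_le_of_ne hMP hne
    have hbot : (⊥ : Ideal (MvPolynomial (Fin N) k)).IsPrime := Ideal.isPrime_bot
    have a1 := Ideal.height_add_one_le_of_lt_of_isPrime lt1
    have a2 := Ideal.height_add_one_le_of_lt_of_isPrime lt2
    have a3 := Ideal.height_add_one_le_of_lt_of_isPrime lt3
    have : ((0 + 1) + 1 + 1 : ℕ∞) ≤ 2 := by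
      rw [← hh]
      refine le_trans ?_ a3
      gcongr
      refine le_trans ?_ a2
      gcongr
      refine le_trans ?_ a1
      gcongr
      exact zero_le
    exact absurd this (by decide)
  refine ⟨aeval θ q', ?_, hqn⟩
  apply le_antisymm
  · intro r hr
    rw [← hMeq] at hr
    obtain ⟨t, ht⟩ := Ideal.mem_span_singleton'.1 (show π r ∈ Ideal.span {q'} from hr)
    have : r - aeval θ t * aeval θ q' ∈ Ideal.span {lf c} := by
      rw [← hπ, map_sub, map_mul, hπθ, hπθ, ht, sub_self]
    obtain ⟨w, hw⟩ := Ideal.mem_span_singleton'.1 this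
    exact Ideal.mem_span_pair.2 ⟨w, aeval θ t, by rw [hw]; ring⟩
  · rw [Ideal.span_le]
    rintro z (rfl | rfl)
    · exact hl
    · rw [SetLike.mem_coe, ← hMeq]
      change π (aeval θ q') ∈ Ideal.span {q'}
      rw [hq]; exact Ideal.mem_span_singleton_self _

lemma li_of_height {a b : Fin N → k} (h : (Ideal.span {lf a, lf b}).height = 2) :
    LinearIndependent k ![a, b] := by
  rw [LinearIndependent.pair_iff]
  have key : ∀ (a b : Fin N → k), (Ideal.span {lf a, lf b}).height = 2 → ∀ s t : k, s • a + t • b = 0 → s = 0 := by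
    intro a b h s t hst
    by_contra hs
    have ha : a = (-(s⁻¹ * t)) • b := by
      have h2 := congrArg (fun z => s⁻¹ • z) hst
      simp only [smul_add, smul_smul, inv_mul_cancel₀ hs, one_smul, smul_zero] at h2
      rw [neg_smul]; exact eq_neg_of_add_eq_zero_left h2
    have : Ideal.span {lf a, lf b} ≤ Ideal.span {lf b} := by
      rw [Ideal.span_le]
      rintro z (rfl | rfl)
      · rw [ha, map_smul, smul_eq_C_mul]
        exact Ideal.mul_mem_left _ _ (Ideal.mem_span_singleton_self _)
      · exact Ideal.mem_span_singleton_self _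
    exact not_unit_of_hom le_rfl (lf_hom b) (height_one_lt this h)
  intro s t hst
  refine ⟨key a b h s t hst, key b a ?_ t s ?_⟩
  · rw [Set.pair_comm]; exact h
  · rw [add_comm]; exact hst

lemma notMem_lf {m : ℕ} {c : Fin m → Fin N → k} {a : Fin N → k}
    (h : LinearIndependent k (Matrix.vecCons a c)) :
    LinearIndependent k c ∧ lf a ∉ Ideal.span (Set.range fun i => lf (c i)) := by
  obtain ⟨h1, h2⟩ := linearIndependent_finCons.1 h
  exact ⟨h1, fun h3 => h2 (lf_mem_span _ _ h3)⟩

lemma li_swap {a b : Fin N → k} (h : LinearIndependent k ![a, b]) : LinearIndependent k ![b, a] := by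
  have := h.comp ![1, 0] (by decide)
  convert this using 1
  funext i; fin_cases i <;> rfl

lemma lf_ne_zero {c : Fin N → k} (hc : c ≠ 0) : lf c ≠ 0 := fun h => hc (lf_inj (by rw [h, map_zero]))

lemma mkBase {a b : Fin N → k} (h : LinearIndependent k ![a, b]) {s t : MvPolynomial (Fin N) k}
    (hcop : Cop (Ideal.span {lf a, lf b}) s t) : Base (lf a) (lf b) s t := by
  have ha : a ≠ 0 := by simpa using h.ne_zero 0
  have h2 := notMem_lf (li_swap h)
  have h3 := h2.2
  rw [range_lf1] at h3
  have hu := ufdi_lf _ h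
  rw [range_lf2] at hu
  refine ⟨regM_of_ne_zero (lf_ne_zero ha), ?_, hu, hcop⟩
  rw [bot_sup_eq]
  exact RegM.of_prime (prime_lf1 ha) h3

lemma goodK_of {H1 H : Ideal (MvPolynomial (Fin N) k)} (hP : H1.IsPrime) (hh1 : H1.height = 2)
    {cx cy cl : Fin N → k} (hpp : (Ideal.span {lf cx, lf cy}).IsPrime)
    (hph : (Ideal.span {lf cx, lf cy}).height = 2)
    (hH : H.IsPrimary) (hr : H.radical = Ideal.span {lf cx, lf cy})
    (hC : CompCl H) (hm : HasMultiplicity H (N - 2) 2)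
    (hne : ¬ H1 ≤ Ideal.span {lf cx, lf cy}) (hcl : cl ≠ 0) (hl : lf cl ∈ H1) :
    GoodK (H1 ⊓ H) := by
  obtain ⟨q, hq, hqn⟩ := structP hP hh1 hcl hl
  by_cases hlp : lf cl ∈ Ideal.span {lf cx, lf cy}
  · -- change of basis
    have : ∃ c', Ideal.span {lf cl, lf c'} = Ideal.span {lf cx, lf cy} := by
      have h1 : cl ∈ Submodule.span k (Set.range (![cx, cy] : Fin 2 → _)) := by
        apply lf_mem_span; rw [range_lf2]; exact hlp
      have key : ∀ (a b : Fin N → k) (s t : k), s ≠ 0 → s • a + t • b = cl →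
          Ideal.span {lf cl, lf b} = Ideal.span {lf a, lf b} := by
        intro a b s t hs hst
        have e1 : lf cl = C s * lf a + C t * lf b := by
          rw [← hst, map_add, map_smul, map_smul, smul_eq_C_mul, smul_eq_C_mul]
        have e2 : lf a = C s⁻¹ * lf cl + (- C (s⁻¹ * t)) * lf b := by
          have : (C s⁻¹ * C s : MvPolynomial (Fin N) k) = 1 := by
            rw [← map_mul, inv_mul_cancel₀ hs, map_one]
          rw [e1, map_mul]; linear_combination (-lf a) * this
        apply le_antisymm
        · rw [Ideal.span_le]
          rintro z (rfl | rfl)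
          · exact Ideal.mem_span_pair.2 ⟨_, _, e1.symm⟩
          · exact Ideal.subset_span (by simp)
        · rw [Ideal.span_le]
          rintro z (rfl | rfl)
          · exact Ideal.mem_span_pair.2 ⟨_, _, e2.symm⟩
          · exact Ideal.subset_span (by simp)
      rw [Matrix.range_cons, Matrix.range_cons, Matrix.range_empty, Set.union_empty,
        Set.singleton_union, Submodule.mem_span_pair] at h1
      obtain ⟨s, t, hst⟩ := h1
      by_cases hs : s = 0
      · have ht : t ≠ 0 := by
          rintro rfl
          apply hcl
          rw [← hst, hs]; simp
        refine ⟨cx, ?_⟩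
        rw [key cy cx t s ht (by rw [add_comm]; exact hst), Set.pair_comm]
      · exact ⟨cy, key cx cy s t hs hst⟩
    obtain ⟨c', hc'⟩ := this
    rw [← hc'] at hr hpp hph hne
    have hli := li_of_height hph
    obtain ⟨-, θ, π, hθ, hπθ, hπ⟩ := coord_proj _ hli
    rw [range_lf2] at hπ
    have hu := ufdi_lf _ hli
    rw [range_lf2] at hu
    obtain ⟨a, b, hcop, rfl⟩ := structH (lf_hom cl) (lf_hom c') hu θ π hθ hπθ hπ hH hr hC hm
    have hqp : q ∉ Ideal.span {lf cl, lf c'} := by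
      intro h
      apply hne
      rw [hq, Ideal.span_le]
      rintro z (rfl | rfl)
      · exact Ideal.subset_span (by simp)
      · exact h
    have := caseiii (mkBase hli hcop) (q := q) (by rw [bot_sup_eq]; exact RegM.of_prime (prime_lf1 hcl) hqn) hqp
      (fun r hr' => primary_cancel hH hr hr' hqp)
    rw [hq]
    exact this
  · have hli := li_of_height hph
    obtain ⟨-, θ, π, hθ, hπθ, hπ⟩ := coord_proj _ hli
    rw [range_lf2] at hπ
    have hu := ufdi_lf _ hli
    rw [range_lf2] at hu
    obtain ⟨a, b, hcop, rfl⟩ := structH (lf_hom cx) (lf_hom cy) hu θ π hθ hπθ hπ hH hr hC hm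
    have hli3 : LinearIndependent k ![cl, cx, cy] := by
      refine linearIndependent_finCons.2 ⟨hli, ?_⟩
      intro h
      apply hlp
      rw [Matrix.range_cons, Matrix.range_cons, Matrix.range_empty, Set.union_empty,
        Set.singleton_union, Submodule.mem_span_pair] at h
      obtain ⟨s, t, hst⟩ := h
      refine Ideal.mem_span_pair.2 ⟨C s, C t, ?_⟩
      rw [← hst, map_add, map_smul, map_smul, smul_eq_C_mul, smul_eq_C_mul]
    have hli3' : LinearIndependent k ![cy, cl, cx] := by
      have := hli3.comp ![2, 0, 1] (by decide)
      convert this using 1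
      funext i; fin_cases i <;> rfl
    obtain ⟨hlx, hy⟩ := notMem_lf hli3'
    obtain ⟨-, hx⟩ := notMem_lf (li_swap hlx)
    have hplx := (ufdi_lf _ hlx).prime
    have hu3 := ufdi_lf _ hli3
    rw [range_lf2] at hy hplx
    rw [range_lf1] at hx
    rw [range_lf3] at hu3
    have B : Base2 (lf cx) (lf cy) a b (lf cl) q := by
      refine { mkBase hli hcop with
        rl := regM_of_ne_zero (lf_ne_zero hcl)
        rlx := ?_
        rly := ?_
        ufdQ := hu3
        rlq := ?_
        rlH := fun r hr' => primary_cancel hH hr hr' hlp }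
      · rw [bot_sup_eq]; exact RegM.of_prime (prime_lf1 hcl) hx
      · rw [bot_sup_eq, ← Ideal.span_union]
        exact RegM.of_prime hplx hy
      · rw [bot_sup_eq]; exact RegM.of_prime (prime_lf1 hcl) hqn
    rw [hq]
    by_cases hqm : q ∈ Ideal.span {lf cl, lf cx, lf cy}
    · exact B.caseii hqm
    · exact B.casei hqm

end final

theorem statement_13
    {k : Type} [Field k] [IsAlgClosed k] {N : ℕ}
    (f₁ f₂ f₃ : MvPolynomial (Fin N) k)
    (hf₁ : f₁.IsHomogeneous 3) (hf₂ : f₂.IsHomogeneous 3) (hf₃ : f₃.IsHomogeneous 3)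
    (hIht : idealHeight (Ideal.span {f₁, f₂, f₃}) = 2)
    (hht₁₂ : idealHeight (Ideal.span {f₁, f₂}) = 2)
    (hht₁₃ : idealHeight (Ideal.span {f₁, f₃}) = 2)
    (hht₂₃ : idealHeight (Ideal.span {f₂, f₃}) = 2)
    (H₁ : Ideal (MvPolynomial (Fin N) k))
    (hH₁prime : H₁.IsPrime) (hH₁ht : idealHeight H₁ = 2)
    (hH₁e : HasMultiplicity H₁ (N - 2) 2)
    (x y : MvPolynomial (Fin N) k) (hx : x.IsHomogeneous 1) (hy : y.IsHomogeneous 1)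
    (hpprime : (Ideal.span {x, y}).IsPrime)
    (hpht : idealHeight (Ideal.span {x, y}) = 2)
    (H : Ideal (MvPolynomial (Fin N) k))
    (hHprimary : H.IsPrimary) (hHrad : H.radical = Ideal.span {x, y})
    (hHe : HasMultiplicity H (N - 2) 2)
    (hK : H₁ ⊓ H = unmixedPart (Ideal.span {f₁, f₂, f₃}) ∨ H₁ ⊓ H = Submodule.colon (Ideal.span {f₁, f₂}) (Ideal.span {f₃})) :
    pdQuotLE (Ideal.span {f₁, f₂, f₃}) 5 := by
  rw [idealHeight_eq] at hIht hht₁₂ hht₁₃ hht₂₃ hH₁ht hpht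
  obtain ⟨cx, rfl⟩ := exists_lf hx
  obtain ⟨cy, rfl⟩ := exists_lf hy
  have hinf : Infinite k := inferInstance
  have hli := li_of_height hpht
  obtain ⟨hN, η, π, hη, hπη, hπ⟩ := coord_proj _ hli
  rw [range_lf2] at hπ
  obtain ⟨d, rfl⟩ : ∃ d, N = d + 2 := ⟨N - 2, (Nat.sub_add_cancel hN).symm⟩
  have hCcl : CompCl (Ideal.span {f₁, f₂}) := CompCl.span _ (by
    rintro f (rfl | rfl)
    · exact ⟨_, hf₁⟩
    · exact ⟨_, hf₂⟩)
  have hIcl : CompCl (Ideal.span {f₁, f₂, f₃}) := CompCl.span _ (by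
    rintro f (rfl | rfl | rfl)
    · exact ⟨_, hf₁⟩
    · exact ⟨_, hf₂⟩
    · exact ⟨_, hf₃⟩)
  have hpcl : CompCl (Ideal.span {lf cx, lf cy}) := CompCl.span _ (by
    rintro f (rfl | rfl)
    · exact ⟨_, hx⟩
    · exact ⟨_, hy⟩)
  have hCI : Ideal.span {f₁, f₂} ≤ Ideal.span {f₁, f₂, f₃} := by
    apply Ideal.span_mono
    rintro z (rfl | rfl) <;> simp
  have hCK : Ideal.span {f₁, f₂} ≤ H₁ ⊓ H := by
    rcases hK with h | h
    · rw [h]; exact hCI.trans (le_unmixedPart _)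
    · rw [h]
      intro r hr
      rw [Ideal.mem_colon_span_singleton]
      exact Ideal.mul_mem_right _ _ hr
  have hKcl : CompCl (H₁ ⊓ H) := by
    rcases hK with h | h
    · rw [h]; exact hIcl.unmixed hIht
    · rw [h]; exact hCcl.colon hf₃
  have hH₁min := min_of_height_two hht₁₂ hH₁ht (hCK.trans inf_le_left)
  have hH₁cl : CompCl H₁ := hCcl.minimal hH₁min
  have hne : ¬ H₁ ≤ Ideal.span {lf cx, lf cy} := by
    intro hle
    have heq := eq_of_height_two hH₁prime hpprime hH₁ht hpht hle
    refine not_mult_two H₁ η hη (fun r => ⟨π r, ?_⟩) hH₁e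
    rw [heq, ← hπ, map_sub, hπη, sub_self]
  have hHeq : H = satI (H₁ ⊓ H) (Ideal.span {lf cx, lf cy}) hpprime := by
    apply le_antisymm
    · intro r hr
      obtain ⟨s, hs, hsp⟩ := SetLike.not_le_iff_exists.1 hne
      exact ⟨s, hsp, Ideal.mul_mem_right _ _ hs, Ideal.mul_mem_left _ _ hr⟩
    · rintro r ⟨s, hs, hsr⟩
      exact primary_cancel hHprimary hHrad hsr.2 hs
  have hHcl : CompCl H := by
    rw [hHeq]; exact hKcl.satI_cl hpcl hpprime
  have h0 := ne_zero_of_height hht₁₂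
  have r1 := regM_of_ne_zero h0
  have r2 := regM_of_height hht₁₂
  obtain ⟨θ, u, v, hθ, hu, hv, hreg, hinteg, hind⟩ :=
    noether f₁ f₂ h0 hf₁ hf₂ (by rw [bot_sup_eq] at r2; exact r2)
  obtain ⟨l, hlH, hl1, hl0⟩ := exists_linform hH₁prime hH₁cl hH₁e θ u v hθ hu hv
    (inj_min (aeval θ : _ →ₐ[k] MvPolynomial (Fin (d+2)) k).toRingHom hreg hH₁min)
    (fun r => by
      obtain ⟨p, hp, hpr⟩ := hinteg r
      exact ⟨p, hp, hH₁min.1.2 hpr⟩) hind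
  obtain ⟨cl, rfl⟩ := exists_lf hl1
  have hcl : cl ≠ 0 := by
    rintro rfl
    exact hl0 (map_zero _)
  have hgood := goodK_of hH₁prime hH₁ht hpprime hpht hHprimary hHrad hHcl hHe hne hcl hlH
  refine exists_res_of_pd _ 5 (pd_I_of_L (L := Submodule.colon (Ideal.span {f₁, f₂}) (Ideal.span {f₃}))
    r1 r2 (fun r => by rw [Ideal.mem_colon_span_singleton, mul_comm]) ?_)
  rcases hK with h | h
  · refine pd_L_of_link (K := H₁ ⊓ H) r1 r2 (hCK (Ideal.subset_span (by simp)))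
      (hCK (Ideal.subset_span (by simp))) (fun r => ?_) hgood.2
    rw [Ideal.mem_colon_span_singleton, mul_comm, h]
    exact link (aeval θ : _ →ₐ[k] MvPolynomial (Fin (d+2)) k).toRingHom hreg hinteg hht₁₂ hIht r
  · rw [← h]; exact hgood.1

end
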